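/- (Lower Green function bound, Harnack form.) Let n ≥ 3, let Ω ⊂ ℝⁿ be open, and let L = −div(A∇·) + B·∇ with measurable coefficients satisfying Σ|A_{ij}(X)| ≤ M, A(X)ξ·ξ ≥ λ|ξ|², and δ(X)|B(X)| ≤ M. Then there is a constant c₀ = c₀(M, λ, n) > 0 such that for every y ∈ Ω, every Green function g for L with pole y, and every z ∈ Ω with 0 < |z − y| ≤ δ(z)/2, one has g(z) ≥ c₀ |z − y|^{2−n}. -/

import Mathlib

open MeasureTheory Metric Set

noncomputable section

/-- Distance to the boundary of `Ω`. -/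
def bdryDist {n : ℕ} (Ω : Set (EuclideanSpace ℝ (Fin n))) (x : EuclideanSpace ℝ (Fin n)) : ℝ :=
  Metric.infDist x (frontier Ω)

/-- Uniform ellipticity and boundedness of the coefficients on `Ω`:
`Σ|A_{ij}| ≤ M`, `A ξ·ξ ≥ λ|ξ|²`, and `δ(X)|B(X)| ≤ M`. -/
def EllipticCoeffs {n : ℕ} (Ω : Set (EuclideanSpace ℝ (Fin n)))
    (A : EuclideanSpace ℝ (Fin n) → Matrix (Fin n) (Fin n) ℝ)
    (B : EuclideanSpace ℝ (Fin n) → EuclideanSpace ℝ (Fin n)) (lam M : ℝ) : Prop :=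
  (∀ x ∈ Ω, ∑ i, ∑ j, |A x i j| ≤ M) ∧
  (∀ x ∈ Ω, ∀ ξ : EuclideanSpace ℝ (Fin n), lam * ‖ξ‖ ^ 2 ≤ ∑ i, ∑ j, A x i j * ξ i * ξ j) ∧
  (∀ x ∈ Ω, bdryDist Ω x * ‖B x‖ ≤ M)

/-- `g` is a Green function for `L = -div(A∇·) + B·∇` in `Ω` with pole `y`:
nonnegative, continuous and locally `W^{1,2}` away from the pole, locally integrable
together with its gradient, and satisfying the adjoint identity
`∫ (Aᵀ∇g·∇φ - g B·∇φ) = φ(y)` for all test functions `φ`. -/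
def IsGreenWithPole {n : ℕ} (Ω : Set (EuclideanSpace ℝ (Fin n)))
    (A : EuclideanSpace ℝ (Fin n) → Matrix (Fin n) (Fin n) ℝ)
    (B : EuclideanSpace ℝ (Fin n) → EuclideanSpace ℝ (Fin n))
    (y : EuclideanSpace ℝ (Fin n)) (g : EuclideanSpace ℝ (Fin n) → ℝ) : Prop :=
  (∀ x ∈ Ω, 0 ≤ g x) ∧
  ContinuousOn g (Ω \ {y}) ∧
  (∀ x ∈ Ω \ {y}, DifferentiableAt ℝ g x) ∧
  LocallyIntegrableOn (fun x => ‖gradient g x‖ ^ 2) (Ω \ {y}) volume ∧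
  LocallyIntegrableOn g Ω volume ∧
  LocallyIntegrableOn (fun x => ‖gradient g x‖) Ω volume ∧
  ∀ φ : EuclideanSpace ℝ (Fin n) → ℝ,
    ContDiff ℝ (⊤ : ℕ∞) φ → HasCompactSupport φ → tsupport φ ⊆ Ω →
    ∫ x in Ω, ((∑ i, ∑ j, A x j i * gradient g x j * gradient φ x i) -
      g x * ∑ i, B x i * gradient φ x i) = φ y

namespace GreenHarnack

open Filter Topology
open scoped ENNReal NNReal RealInnerProductSpace

section Mollification

variable {n : ℕ}

local notation "E" => EuclideanSpace ℝ (Fin n)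

/-- Translations are continuous in `L²`. -/
lemma tendsto_eLpNorm_translate_sub {h : E → E} (hh : MemLp h 2 volume) :
    Tendsto (fun t : E => eLpNorm (fun x => h (x - t) - h x) 2 volume) (𝓝 0) (𝓝 0) := by
  let f : Lp E 2 (volume : Measure E) := hh.toLp h
  let G : C(E, C(E, E)) :=
    (ContinuousMap.mk (fun a : E × E => a.2 - a.1) (by fun_prop)).curry
  have hGm : ∀ t, MeasurePreserving (G t) (volume : Measure E) volume := fun t =>
    measurePreserving_sub_right volume t
  have hcont : Continuous (fun t : E => Lp.compMeasurePreserving (G t) (hGm t) f) :=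
    continuous_const.compMeasurePreservingLp G.continuous hGm (by norm_num)
  have h0 : Lp.compMeasurePreserving (G 0) (hGm 0) f = f := by
    apply Lp.ext
    filter_upwards [Lp.coeFn_compMeasurePreserving f (hGm 0)] with x hx
    rw [hx]; simp [G]
  have ht : Tendsto (fun t : E => ‖Lp.compMeasurePreserving (G t) (hGm t) f - f‖ₑ) (𝓝 0) (𝓝 0) := by
    have : Tendsto (fun t : E => Lp.compMeasurePreserving (G t) (hGm t) f - f) (𝓝 0) (𝓝 0) := by
      have h1 := (hcont.tendsto 0).sub (tendsto_const_nhds (x := f))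
      simpa only [h0, sub_self] using h1
    simpa using this.enorm
  refine ht.congr fun t => ?_
  rw [Lp.enorm_def]
  refine eLpNorm_congr_ae ?_
  have h1 : (fun x => h (x - t)) =ᵐ[volume] fun x => f (x - t) :=
    ((hGm t).quasiMeasurePreserving.ae_eq_comp (MemLp.coeFn_toLp hh)).symm
  filter_upwards [Lp.coeFn_compMeasurePreserving f (hGm t),
    Lp.coeFn_sub (Lp.compMeasurePreserving (G t) (hGm t) f) f, MemLp.coeFn_toLp hh, h1]
    with x hx1 hx2 hx3 hx4
  rw [hx2, Pi.sub_apply, hx1, hx4, ← hx3]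
  rfl

/-- `L²` form of Minkowski's inequality for averages against a probability density. -/
lemma lintegral_enorm_sq_integral_smul_le {ρ : E → ℝ} (hρ : Continuous ρ) (hρ0 : ∀ t, 0 ≤ ρ t)
    (hρ1 : ∫⁻ t, ENNReal.ofReal (ρ t) = 1) {k : E → E → E}
    (hk : AEStronglyMeasurable (fun p : E × E => k p.1 p.2) (volume.prod volume)) :
    ∫⁻ x, ‖∫ t, ρ t • k x t‖ₑ ^ 2 ≤
      ∫⁻ t, ENNReal.ofReal (ρ t) * ∫⁻ x, ‖k x t‖ₑ ^ 2 := by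
  have hρm : Measurable fun t => ENNReal.ofReal (ρ t) := (hρ.measurable).ennreal_ofReal
  have hkx : ∀ᵐ x, AEStronglyMeasurable (fun t => k x t) volume := hk.prodMk_left
  calc ∫⁻ x, ‖∫ t, ρ t • k x t‖ₑ ^ 2
      ≤ ∫⁻ x, ∫⁻ t, ENNReal.ofReal (ρ t) * ‖k x t‖ₑ ^ 2 := by
        refine lintegral_mono_ae ?_
        filter_upwards [hkx] with x hx
        have h1 : ‖∫ t, ρ t • k x t‖ₑ ≤ ∫⁻ t, ENNReal.ofReal (ρ t) * ‖k x t‖ₑ := by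
          refine (enorm_integral_le_lintegral_enorm _).trans_eq ?_
          refine lintegral_congr fun t => ?_
          rw [enorm_smul, Real.enorm_eq_ofReal (hρ0 t)]
        have h2 := ENNReal.lintegral_mul_le_Lp_mul_Lq volume (p := 2) (q := 2)
          (by constructor <;> norm_num)
          (f := fun t => ENNReal.ofReal (ρ t) ^ (1 / 2 : ℝ))
          (g := fun t => ENNReal.ofReal (ρ t) ^ (1 / 2 : ℝ) * ‖k x t‖ₑ)
          (by fun_prop) (AEMeasurable.mul (by fun_prop) hx.enorm)
        have hs : ∀ a : ℝ≥0∞, a ^ (1 / 2 : ℝ) * a ^ (1 / 2 : ℝ) = a := fun a => by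
          rw [← ENNReal.rpow_add_of_nonneg _ _ (by norm_num) (by norm_num)]; norm_num
        simp only [Pi.mul_apply] at h2
        have e1 : ∀ t, ENNReal.ofReal (ρ t) ^ (1 / 2 : ℝ) *
            (ENNReal.ofReal (ρ t) ^ (1 / 2 : ℝ) * ‖k x t‖ₑ) = ENNReal.ofReal (ρ t) * ‖k x t‖ₑ :=
          fun t => by rw [← mul_assoc, hs]
        have e2 : ∀ t, (ENNReal.ofReal (ρ t) ^ (1 / 2 : ℝ)) ^ (2 : ℝ) = ENNReal.ofReal (ρ t) :=
          fun t => by rw [ENNReal.rpow_two, sq, hs]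
        have e3 : ∀ t, (ENNReal.ofReal (ρ t) ^ (1 / 2 : ℝ) * ‖k x t‖ₑ) ^ (2 : ℝ) =
            ENNReal.ofReal (ρ t) * ‖k x t‖ₑ ^ 2 := fun t => by
          rw [ENNReal.rpow_two, mul_pow, sq (_ ^ (1 / 2 : ℝ)), hs]
        simp only [e1, e2, e3, hρ1, ENNReal.one_rpow, one_mul] at h2
        calc ‖∫ t, ρ t • k x t‖ₑ ^ 2 ≤
            ((∫⁻ t, ENNReal.ofReal (ρ t) * ‖k x t‖ₑ ^ 2) ^ (1 / 2 : ℝ)) ^ 2 := by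
              gcongr; exact h1.trans h2
          _ = _ := by rw [sq, hs]
    _ = ∫⁻ t, ∫⁻ x, ENNReal.ofReal (ρ t) * ‖k x t‖ₑ ^ 2 := by
        refine lintegral_lintegral_swap (AEMeasurable.mul ?_ (hk.enorm.pow_const 2))
        exact (hρm.comp measurable_snd).aemeasurable
    _ = _ := by
        refine lintegral_congr fun t => ?_
        exact lintegral_const_mul' _ _ ENNReal.ofReal_ne_top

/-- A shrinking sequence of smooth bumps centred at the origin. -/
def mollBump (k : ℕ) : ContDiffBump (0 : E) where
  rIn := 1 / (2 * ((k : ℝ) + 1))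
  rOut := 1 / ((k : ℝ) + 1)
  rIn_pos := by positivity
  rIn_lt_rOut := by
    apply one_div_lt_one_div_of_lt <;> linarith [(Nat.cast_nonneg k : (0 : ℝ) ≤ k)]

/-- The mollification kernels. -/
def moll (k : ℕ) : E → ℝ := (mollBump (n := n) k).normed volume

lemma moll_contDiff (k : ℕ) {m : ℕ∞} : ContDiff ℝ m (moll (n := n) k) :=
  (mollBump k).contDiff_normed

lemma moll_nonneg (k : ℕ) (x : E) : 0 ≤ moll k x := (mollBump k).nonneg_normed x

lemma moll_hasCompactSupport (k : ℕ) : HasCompactSupport (moll (n := n) k) :=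
  (mollBump k).hasCompactSupport_normed

lemma moll_continuous (k : ℕ) : Continuous (moll (n := n) k) := (mollBump k).continuous_normed

lemma moll_integral (k : ℕ) : ∫ x, moll (n := n) k x = 1 := (mollBump k).integral_normed

lemma moll_lintegral (k : ℕ) : ∫⁻ x, ENNReal.ofReal (moll (n := n) k x) = 1 := by
  have h := ofReal_integral_eq_lintegral_ofReal (f := moll (n := n) k)
    (mollBump k).integrable_normed (Eventually.of_forall (moll_nonneg k))
  rw [← h, moll_integral, ENNReal.ofReal_one]

lemma moll_support (k : ℕ) : Function.support (moll (n := n) k) = ball 0 (1 / ((k : ℝ) + 1)) :=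
  (mollBump k).support_normed_eq

/-- Mollifications converge in `L²`. -/
lemma tendsto_eLpNorm_mollify_sub {h : E → E} (hh : MemLp h 2 volume) :
    Tendsto (fun k : ℕ => eLpNorm (fun x => (∫ t, moll k t • h (x - t)) - h x) 2 volume)
      atTop (𝓝 0) := by
  have hloc : LocallyIntegrable h volume := hh.locallyIntegrable (by norm_num)
  rw [ENNReal.tendsto_nhds_zero]
  intro ε hε
  have h1 := (ENNReal.tendsto_nhds_zero.1 (tendsto_eLpNorm_translate_sub hh)) ε hε
  obtain ⟨δ, hδ, hball⟩ := Metric.eventually_nhds_iff_ball.1 h1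
  obtain ⟨N, hN⟩ := exists_nat_one_div_lt hδ
  filter_upwards [eventually_ge_atTop N] with k hk
  have hkδ : 1 / ((k : ℝ) + 1) < δ := by
    refine lt_of_le_of_lt ?_ hN
    gcongr
  have hex : ∀ x, Integrable (fun t => moll k t • h (x - t)) volume := fun x =>
    (moll_hasCompactSupport k).convolutionExists_left (ContinuousLinearMap.lsmul ℝ ℝ)
      (moll_continuous k) hloc x
  have hmint : Integrable (moll (n := n) k) volume := (mollBump k).integrable_normed
  have heq : ∀ x, (∫ t, moll k t • h (x - t)) - h x = ∫ t, moll k t • (h (x - t) - h x) := by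
    intro x
    simp_rw [smul_sub]
    rw [integral_sub (hex x) (hmint.smul_const _), integral_smul_const, moll_integral, one_smul]
  simp_rw [heq]
  have hsq : ∀ f : E → E, eLpNorm f 2 volume = (∫⁻ x, ‖f x‖ₑ ^ 2) ^ (1 / 2 : ℝ) := fun f => by
    rw [eLpNorm_eq_lintegral_rpow_enorm_toReal (by norm_num) (by norm_num)]
    simp
  have hsq' : ∀ f : E → E, ∫⁻ x, ‖f x‖ₑ ^ 2 = eLpNorm f 2 volume ^ 2 := fun f => by
    rw [hsq, ← ENNReal.rpow_two, ← ENNReal.rpow_mul]; norm_num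
  have hmeas : AEStronglyMeasurable (fun p : E × E => h (p.1 - p.2) - h p.1)
      (volume.prod volume) := by
    have h2 : AEStronglyMeasurable (fun p : E × E => h (p.1 - p.2)) (volume.prod volume) :=
      hh.1.comp_quasiMeasurePreserving
        (quasiMeasurePreserving_sub (volume : Measure E) volume)
    exact h2.sub hh.1.comp_fst
  have key := lintegral_enorm_sq_integral_smul_le (moll_continuous k) (moll_nonneg k)
    (moll_lintegral k) (k := fun x t => h (x - t) - h x) hmeas
  have key2 : ∫⁻ x, ‖∫ t, moll k t • (h (x - t) - h x)‖ₑ ^ 2 ≤ ε ^ 2 := by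
    refine key.trans ?_
    calc ∫⁻ t, ENNReal.ofReal (moll k t) * ∫⁻ x, ‖h (x - t) - h x‖ₑ ^ 2
        ≤ ∫⁻ t, ENNReal.ofReal (moll (n := n) k t) * ε ^ 2 := by
          refine lintegral_mono fun t => ?_
          by_cases ht : t ∈ ball (0 : E) δ
          · have := hball t ht
            simp only [hsq' (fun x => h (x - t) - h x)]
            gcongr
          · have : moll k t = 0 := by
              by_contra h0
              have : t ∈ Function.support (moll (n := n) k) := h0
              rw [moll_support] at this
              exact ht (ball_subset_ball hkδ.le this)
            simp [this]
      _ = ε ^ 2 := by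
          rw [lintegral_mul_const _ (moll_continuous k).measurable.ennreal_ofReal, moll_lintegral,
            one_mul]
  rw [hsq]
  calc (∫⁻ x, ‖∫ t, moll k t • (h (x - t) - h x)‖ₑ ^ 2) ^ (1 / 2 : ℝ) ≤ (ε ^ 2) ^ (1 / 2 : ℝ) := by
        gcongr
    _ = ε := by rw [← ENNReal.rpow_two, ← ENNReal.rpow_mul]; norm_num

/-- The gradient of a mollified function is the mollified gradient. -/
lemma hasGradientAt_mollify (k : ℕ) {ψ : E → ℝ} {ψ' : E → E}
    (hψ : ∀ x, HasGradientAt ψ (ψ' x) x) (hloc : LocallyIntegrable ψ' volume) (x : E) :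
    HasGradientAt (fun x => ∫ t, moll k t • ψ (x - t)) (∫ t, moll k t • ψ' (x - t)) x := by
  have hcont : Continuous ψ := continuous_iff_continuousAt.2 fun x => (hψ x).continuousAt
  have hψl : LocallyIntegrable ψ volume := hcont.locallyIntegrable
  have hd := (moll_hasCompactSupport (n := n) k).hasFDerivAt_convolution_left
    (ContinuousLinearMap.lsmul ℝ ℝ) (moll_contDiff k (m := 1)) hψl x
  have hex : Integrable (fun t => moll k t • ψ' (x - t)) volume :=
    (moll_hasCompactSupport k).convolutionExists_left (ContinuousLinearMap.lsmul ℝ ℝ)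
      (moll_continuous k) hloc x
  rw [hasGradientAt_iff_hasFDerivAt]
  convert! hd using 1
  have hcd : ContDiff ℝ 1 (moll (n := n) k) := moll_contDiff k (m := 1)
  have hfc : Continuous (fderiv ℝ (moll (n := n) k)) := hcd.continuous_fderiv one_ne_zero
  have hfs : HasCompactSupport (fderiv ℝ (moll (n := n) k)) := (moll_hasCompactSupport k).fderiv ℝ
  have hex2 := hfs.convolutionExists_left
    ((ContinuousLinearMap.lsmul ℝ ℝ : ℝ →L[ℝ] ℝ →L[ℝ] ℝ).precompL E) hfc hψl x
  ext e
  have hr : ∀ t, HasFDerivAt (fun t => ψ (x - t)) (-(InnerProductSpace.toDual ℝ E (ψ' (x - t)))) t := by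
    intro t
    have h1 := (hψ (x - t)).hasFDerivAt.comp t ((hasFDerivAt_id t).const_sub x)
    convert! h1 using 1
    ext e; simp
  have ibp := integral_mul_fderiv_eq_neg_fderiv_mul_of_integrable (μ := (volume : Measure E))
    (f := moll k) (g := fun t => ψ (x - t)) (v := e)
    (by
      have := hex2.integrable.apply_continuousLinearMap e
      simpa using this)
    (by
      have : Integrable (fun t => -⟪moll k t • ψ' (x - t), e⟫) volume := by
        exact (hex.inner_const e).neg
      refine this.congr (Eventually.of_forall fun t => ?_)
      simp only [(hr t).fderiv]
      simp [inner_smul_left])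
    ((moll_hasCompactSupport k).convolutionExists_left (ContinuousLinearMap.lsmul ℝ ℝ)
      (moll_continuous k) hψl x)
    (fun t _ => (hcd.differentiable one_ne_zero) t)
    (fun t _ => (hr t).differentiableAt)
  rw [convolution_def, ContinuousLinearMap.integral_apply hex2.integrable]
  simp only [InnerProductSpace.toDual_apply_apply]
  rw [← real_inner_comm, ← integral_inner hex]
  have e1 : ∀ t, moll k t * fderiv ℝ (fun t => ψ (x - t)) t e = -⟪e, moll k t • ψ' (x - t)⟫ := by
    intro t
    rw [(hr t).fderiv]
    simp [inner_smul_right, real_inner_comm]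
  simp_rw [e1] at ibp
  rw [integral_neg, neg_inj] at ibp
  rw [ibp]
  simp

/-- Compactly supported differentiable functions with square integrable gradient are limits of
test functions, with gradients converging in `L²`. -/
lemma exists_smooth_approx {ψ : E → ℝ} {ψ' : E → E}
    (hψ : ∀ x, HasGradientAt ψ (ψ' x) x) (hc : HasCompactSupport ψ) (h2 : MemLp ψ' 2 volume) :
    ∃ φ : ℕ → E → ℝ, (∀ k, ContDiff ℝ (⊤ : ℕ∞) (φ k)) ∧ (∀ k, HasCompactSupport (φ k)) ∧
      (∀ k, tsupport (φ k) ⊆ cthickening (1 / ((k : ℝ) + 1)) (tsupport ψ)) ∧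
      Tendsto (fun k => eLpNorm (fun x => gradient (φ k) x - ψ' x) 2 volume) atTop (𝓝 0) ∧
      ∀ x, Tendsto (fun k => φ k x) atTop (𝓝 (ψ x)) := by
  have hcont : Continuous ψ := continuous_iff_continuousAt.2 fun x => (hψ x).continuousAt
  have hψl : LocallyIntegrable ψ volume := hcont.locallyIntegrable
  have hloc : LocallyIntegrable ψ' volume := h2.locallyIntegrable (by norm_num)
  refine ⟨fun k x => ∫ t, moll k t • ψ (x - t), fun k => ?_, fun k => ?_, fun k => ?_, ?_, ?_⟩
  · exact (moll_hasCompactSupport k).contDiff_convolution_left (ContinuousLinearMap.lsmul ℝ ℝ)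
      (moll_contDiff k) hψl
  · exact (moll_hasCompactSupport k).convolution (ContinuousLinearMap.lsmul ℝ ℝ) hc
  · refine closure_minimal ?_ isClosed_cthickening
    intro x hx
    have h1 := support_convolution_subset_swap (μ := volume) (f := moll k) (g := ψ)
      (ContinuousLinearMap.lsmul ℝ ℝ) hx
    obtain ⟨a, ha, b, hb, rfl⟩ := h1
    rw [moll_support, mem_ball_zero_iff] at hb
    refine mem_cthickening_of_dist_le (a + b) a _ _ (subset_tsupport _ ha) ?_
    simpa using hb.le
  · have := tendsto_eLpNorm_mollify_sub h2
    refine this.congr fun k => ?_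
    congr 1
    ext1 x
    rw [(hasGradientAt_mollify k hψ hloc x).gradient]
  · intro x
    exact ContDiffBump.convolution_tendsto_right_of_continuous (φ := fun k => mollBump k)
      (tendsto_one_div_add_atTop_nhds_zero_nat) hcont x

end Mollification

section Sobolev

variable {n : ℕ}

local notation "E" => EuclideanSpace ℝ (Fin n)

lemma eLpNorm_two_sq {F : Type*} [NormedAddCommGroup F] (f : E → F) (μ : Measure E) :
    eLpNorm f 2 μ ^ 2 = ∫⁻ x, ‖f x‖ₑ ^ 2 ∂μ := by
  rw [eLpNorm_eq_lintegral_rpow_enorm_toReal (by norm_num) (by norm_num)]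
  rw [← ENNReal.rpow_two, ← ENNReal.rpow_mul]; norm_num

lemma norm_gradient (f : E → ℝ) (x : E) : ‖gradient f x‖ = ‖fderiv ℝ f x‖ := by
  rw [← toDual_gradient, LinearIsometryEquiv.norm_map]

lemma measurable_gradient (f : E → ℝ) : Measurable (gradient f) := by
  unfold gradient
  exact (InnerProductSpace.toDual ℝ E).symm.continuous.measurable.comp (measurable_fderiv ℝ f)

/-- Sobolev's inequality for compactly supported differentiable functions. -/
lemma eLpNorm_le_eLpNorm_gradient (hn : 3 ≤ n) :
    ∃ C p : ℝ≥0, (p : ℝ)⁻¹ = 2⁻¹ - (n : ℝ)⁻¹ ∧ ∀ (f : E → ℝ) (f' : E → E),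
      (∀ x, HasGradientAt f (f' x) x) → HasCompactSupport f → MemLp f' 2 volume →
      eLpNorm f p volume ≤ C * eLpNorm f' 2 volume := by
  have hn' : (3 : ℝ) ≤ n := by exact_mod_cast hn
  have hpos : (0 : ℝ) ≤ 2⁻¹ - (n : ℝ)⁻¹ := by
    rw [sub_nonneg]; exact inv_anti₀ (by norm_num) (by linarith)
  refine ⟨eLpNormLESNormFDerivOfEqInnerConst (volume : Measure E) 2,
    (Real.toNNReal (2⁻¹ - (n : ℝ)⁻¹))⁻¹, by
      rw [NNReal.coe_inv, Real.coe_toNNReal _ hpos, inv_inv], ?_⟩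
  intro f f' hf hc h2
  set p : ℝ≥0 := (Real.toNNReal (2⁻¹ - (n : ℝ)⁻¹))⁻¹ with hp
  set C := eLpNormLESNormFDerivOfEqInnerConst (volume : Measure E) 2
  obtain ⟨φ, hφ, hφc, -, hφg, hφt⟩ := exists_smooth_approx hf hc h2
  have hk : ∀ k, eLpNorm (φ k) p volume ≤ C * eLpNorm (gradient (φ k)) 2 volume := by
    intro k
    have := eLpNorm_le_eLpNorm_fderiv_of_eq_inner (volume : Measure E) (p := 2) (p' := p)
      ((hφ k).of_le (by exact_mod_cast le_top)) (hφc k) (by norm_num)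
      (by simp; omega)
      (by rw [hp, NNReal.coe_inv, Real.coe_toNNReal _ hpos, inv_inv]; simp)
    refine this.trans_eq ?_
    congr 1
    exact eLpNorm_congr_norm_ae (Eventually.of_forall fun x => (norm_gradient _ _).symm)
  have hk2 : ∀ k, eLpNorm (φ k) p volume ≤
      C * (eLpNorm (fun x => gradient (φ k) x - f' x) 2 volume + eLpNorm f' 2 volume) := by
    intro k
    refine (hk k).trans ?_
    gcongr
    have : gradient (φ k) = (fun x => gradient (φ k) x - f' x) + f' := by ext1 x; simp
    conv_lhs => rw [this]
    exact eLpNorm_add_le ((measurable_gradient _).aestronglyMeasurable.sub h2.1) h2.1 (by norm_num)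
  have hlim : Tendsto (fun k => C * (eLpNorm (fun x => gradient (φ k) x - f' x) 2 volume +
      eLpNorm f' 2 volume)) atTop (𝓝 (C * (0 + eLpNorm f' 2 volume))) :=
    ENNReal.Tendsto.const_mul (hφg.add tendsto_const_nhds) (Or.inr ENNReal.coe_ne_top)
  calc eLpNorm f p volume ≤ atTop.liminf fun k => eLpNorm (φ k) p volume :=
        Lp.eLpNorm_lim_le_liminf_eLpNorm
          (fun k => ((hφ k).continuous).aestronglyMeasurable) f (Eventually.of_forall hφt)
    _ ≤ atTop.liminf fun k => (C * (eLpNorm (fun x => gradient (φ k) x - f' x) 2 volume +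
          eLpNorm f' 2 volume) : ℝ≥0∞) := liminf_le_liminf (Eventually.of_forall hk2)
    _ = C * eLpNorm f' 2 volume := by rw [hlim.liminf_eq, zero_add]

/-- Faber–Krahn form of Sobolev's inequality. -/
lemma setIntegral_sq_le_measure_rpow_mul (hn : 3 ≤ n) :
    ∃ C : ℝ, 0 < C ∧ ∀ (f : E → ℝ) (f' : E → E),
      (∀ x, HasGradientAt f (f' x) x) → HasCompactSupport f → MemLp f' 2 volume →
      ∀ S : Set E, volume S ≠ ∞ →
      ∫ x in S, f x ^ 2 ≤ C * volume.real S ^ (2 / n : ℝ) * ∫ x, ‖f' x‖ ^ 2 := by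
  obtain ⟨C, p, hp, hC⟩ := eLpNorm_le_eLpNorm_gradient hn
  have hn' : (3 : ℝ) ≤ n := by exact_mod_cast hn
  refine ⟨(C : ℝ) ^ 2 + 1, by positivity, ?_⟩
  intro f f' hf hc h2 S hS
  have hcont : Continuous f := continuous_iff_continuousAt.2 fun x => (hf x).continuousAt
  have h1 := hC f f' hf hc h2
  have hp2 : (2 : ℝ≥0∞) ≤ p := by
    have : (2 : ℝ≥0) ≤ p := by
      have hpi : (p : ℝ)⁻¹ ≤ 2⁻¹ := by rw [hp]; simp
      have hp0 : 0 < (p : ℝ)⁻¹ := by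
        rw [hp, sub_pos]; exact inv_strictAnti₀ (by norm_num) (by linarith)
      have := (inv_le_inv₀ (inv_pos.1 hp0) (by norm_num)).1 hpi
      exact_mod_cast this
    exact_mod_cast this
  have h3 := eLpNorm_le_eLpNorm_mul_rpow_measure_univ (μ := volume.restrict S) hp2
    hcont.aestronglyMeasurable
  have he : (1 / (2 : ℝ≥0∞).toReal - 1 / (p : ℝ≥0∞).toReal : ℝ) = (n : ℝ)⁻¹ := by
    simp only [ENNReal.toReal_ofNat, one_div, ENNReal.coe_toReal, hp]; ring
  rw [he, Measure.restrict_apply_univ] at h3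
  have h4 : eLpNorm f 2 (volume.restrict S) ≤
      C * eLpNorm f' 2 volume * volume S ^ (n : ℝ)⁻¹ := by
    refine h3.trans ?_
    gcongr
    exact (eLpNorm_mono_measure _ Measure.restrict_le_self).trans h1
  have h5 : ∫⁻ x in S, ‖f x‖ₑ ^ 2 ≤
      C ^ 2 * (∫⁻ x, ‖f' x‖ₑ ^ 2) * volume S ^ (2 / n : ℝ) := by
    rw [← eLpNorm_two_sq, ← eLpNorm_two_sq]
    calc _ ≤ (C * eLpNorm f' 2 volume * volume S ^ (n : ℝ)⁻¹) ^ 2 := by gcongr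
      _ = _ := by
        rw [mul_pow, mul_pow, ← ENNReal.rpow_two (volume S ^ (n : ℝ)⁻¹), ← ENNReal.rpow_mul]
        congr 2; ring
  have hfin : ∫⁻ x, ‖f' x‖ₑ ^ 2 ≠ ∞ := by
    rw [← eLpNorm_two_sq]; exact ENNReal.pow_ne_top h2.2.ne
  have e1 : ∫ x in S, f x ^ 2 = (∫⁻ x in S, ‖f x‖ₑ ^ 2).toReal := by
    rw [integral_eq_lintegral_of_nonneg_ae (Eventually.of_forall fun x => sq_nonneg _)
      (hcont.pow 2).aestronglyMeasurable]
    congr 1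
    refine lintegral_congr fun x => ?_
    rw [← Real.enorm_eq_ofReal (sq_nonneg _), enorm_pow]
  have e2 : ∫ x, ‖f' x‖ ^ 2 = (∫⁻ x, ‖f' x‖ₑ ^ 2).toReal := by
    rw [integral_eq_lintegral_of_nonneg_ae (Eventually.of_forall fun x => sq_nonneg _)
      (h2.1.norm.pow 2)]
    congr 1
    refine lintegral_congr fun x => ?_
    rw [← Real.enorm_eq_ofReal (sq_nonneg _), enorm_pow, enorm_norm]
  rw [e1, e2]
  have h6 := ENNReal.toReal_mono (by finiteness) h5
  refine h6.trans ?_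
  rw [ENNReal.toReal_mul, ENNReal.toReal_mul, ← ENNReal.toReal_rpow]
  simp only [ENNReal.toReal_pow, ENNReal.coe_toReal]
  rw [Measure.real]
  have : 0 ≤ (volume S).toReal ^ (2 / n : ℝ) * (∫⁻ x, ‖f' x‖ₑ ^ 2).toReal := by positivity
  nlinarith

lemma integrable_inner_of_memLp_two {μ : Measure E} {f g : E → E} (hf : MemLp f 2 μ)
    (hg : MemLp g 2 μ) : Integrable (fun x => ⟪f x, g x⟫) μ := by
  refine Integrable.mono' (hf.norm.integrable_mul hg.norm) (hf.1.inner hg.1)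
    (Eventually.of_forall fun x => ?_)
  simpa using norm_inner_le_norm (𝕜 := ℝ) (f x) (g x)

/-- Weak equations tested against smooth functions may be tested against differentiable functions
with square integrable gradient. -/
lemma integral_inner_eq_zero_of_smooth {U : Set E} (hU : IsOpen U) {F : E → E}
    (hF : ∀ K ⊆ U, IsCompact K → MemLp F 2 (volume.restrict K))
    (hs : ∀ φ : E → ℝ, ContDiff ℝ (⊤ : ℕ∞) φ → HasCompactSupport φ → tsupport φ ⊆ U →
      ∫ x, ⟪F x, gradient φ x⟫ = 0)
    {ψ : E → ℝ} {ψ' : E → E} (hψ : ∀ x, HasGradientAt ψ (ψ' x) x) (hc : HasCompactSupport ψ)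
    (hsupp : tsupport ψ ⊆ U) (h2 : MemLp ψ' 2 volume) :
    ∫ x, ⟪F x, ψ' x⟫ = 0 := by
  obtain ⟨δ, hδ, hδU⟩ := hc.isCompact.exists_cthickening_subset_open hU hsupp
  obtain ⟨φ, hφ, hφc, hφs, hφg, -⟩ := exists_smooth_approx hψ hc h2
  set K := cthickening δ (tsupport ψ) with hK
  have hKc : IsCompact K := hc.isCompact.cthickening
  have hKm : MeasurableSet K := hKc.measurableSet
  set G : E → E := K.indicator F with hG
  have hGm : MemLp G 2 volume := (memLp_indicator_iff_restrict hKm).2 (hF K hδU hKc)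
  have hzero : ∀ (φ : E → ℝ) x, tsupport φ ⊆ K → x ∉ K → gradient φ x = 0 := by
    intro φ x hφK hx
    have : x ∉ tsupport φ := fun h => hx (hφK h)
    have h0 : fderiv ℝ φ x = 0 := by
      by_contra h
      exact this (support_fderiv_subset ℝ h)
    rw [gradient, h0, map_zero]
  have hGe : ∀ φ : E → ℝ, tsupport φ ⊆ K → ∫ x, ⟪F x, gradient φ x⟫ = ∫ x, ⟪G x, gradient φ x⟫ := by
    intro φ hφK
    refine integral_congr_ae (Eventually.of_forall fun x => ?_)
    by_cases hx : x ∈ K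
    · simp [hG, hx]
    · simp [hzero φ x hφK hx]
  have hψe : ψ' = gradient ψ := (gradient_eq hψ).symm
  have hsub : tsupport ψ ⊆ K := self_subset_cthickening _
  rw [hψe, hGe ψ hsub, ← hψe]
  obtain ⟨N, hN⟩ := exists_nat_one_div_lt hδ
  have hφK : ∀ k ≥ N, tsupport (φ k) ⊆ K := fun k hk =>
    (hφs k).trans (cthickening_mono (le_of_lt (lt_of_le_of_lt (by gcongr) hN)) _)
  have hgm : ∀ k, MemLp (gradient (φ k)) 2 volume := fun k => by
    have hcd : Continuous (fderiv ℝ (φ k)) := (hφ k).continuous_fderiv (by simp)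
    have : Continuous (gradient (φ k)) :=
      (InnerProductSpace.toDual ℝ E).symm.continuous.comp hcd
    refine this.memLp_of_hasCompactSupport ?_
    refine ((hφc k).fderiv ℝ).comp_left (g := (InnerProductSpace.toDual ℝ E).symm) (map_zero _)
  have hbd : ∀ k ≥ N, ‖∫ x, ⟪G x, ψ' x⟫‖ₑ ≤
      eLpNorm G 2 volume * eLpNorm (fun x => gradient (φ k) x - ψ' x) 2 volume := by
    intro k hk
    have h0 : ∫ x, ⟪G x, gradient (φ k) x⟫ = 0 := by
      rw [← hGe _ (hφK k hk)]
      exact hs _ (hφ k) (hφc k) ((hφK k hk).trans hδU)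
    have hi1 : Integrable (fun x => ⟪G x, gradient (φ k) x⟫) volume := integrable_inner_of_memLp_two hGm (hgm k)
    have hi2 : Integrable (fun x => ⟪G x, ψ' x⟫) volume := integrable_inner_of_memLp_two hGm h2
    have h1 : ∫ x, ⟪G x, ψ' x⟫ = -∫ x, ⟪G x, gradient (φ k) x - ψ' x⟫ := by
      simp_rw [inner_sub_right]
      rw [integral_sub hi1 hi2, h0]; ring
    rw [h1, enorm_neg]
    calc _ ≤ ∫⁻ x, ‖⟪G x, gradient (φ k) x - ψ' x⟫‖ₑ := enorm_integral_le_lintegral_enorm _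
      _ = eLpNorm (fun x => ⟪G x, gradient (φ k) x - ψ' x⟫) 1 volume := by
        rw [eLpNorm_one_eq_lintegral_enorm]
      _ ≤ _ := by
        have := eLpNorm_le_eLpNorm_mul_eLpNorm_of_nnnorm (p := 2) (q := 2) (r := 1)
          hGm.1 ((hgm k).1.sub h2.1) (fun a b => ⟪a, b⟫) 1
          (Eventually.of_forall fun x => by
            simpa using (nnnorm_inner_le_nnnorm (𝕜 := ℝ) (G x) (gradient (φ k) x - ψ' x)))
        refine this.trans_eq ?_
        simp [Pi.sub_def]
  have hlim : Tendsto (fun k => eLpNorm G 2 volume *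
      eLpNorm (fun x => gradient (φ k) x - ψ' x) 2 volume) atTop (𝓝 (eLpNorm G 2 volume * 0)) :=
    ENNReal.Tendsto.const_mul hφg (Or.inr hGm.2.ne)
  rw [mul_zero] at hlim
  have := ge_of_tendsto hlim (eventually_atTop.2 ⟨N, hbd⟩)
  simpa using this

end Sobolev

section Cutoff

variable {n : ℕ}

local notation "E" => EuclideanSpace ℝ (Fin n)

lemma integrable_mul_of_tsupport_subset {U : Set E} {f c : E → ℝ}
    (hf : LocallyIntegrableOn f U) (hc : Continuous c) (hcs : HasCompactSupport c)
    (hcU : tsupport c ⊆ U) : Integrable fun x => c x * f x := by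
  have hK : IsCompact (tsupport c) := hcs.isCompact
  have h1 : IntegrableOn f (tsupport c) := hf.integrableOn_compact_subset hcU hK
  have h2 : IntegrableOn (fun x => c x * f x) (tsupport c) :=
    h1.continuousOn_mul hc.continuousOn hK
  refine (integrableOn_iff_integrable_of_support_subset ?_).1 h2
  intro x hx
  exact subset_tsupport c fun h => hx (by simp [h])

lemma HasGradientAt.comp_deriv {f : E → ℝ} {f' x : E} {Φ : ℝ → ℝ} {Φ' : ℝ}
    (hΦ : HasDerivAt Φ Φ' (f x)) (hf : HasGradientAt f f' x) :
    HasGradientAt (fun y => Φ (f y)) (Φ' • f') x := by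
  rw [hasGradientAt_iff_hasFDerivAt] at hf ⊢
  refine (hΦ.comp_hasFDerivAt x hf).congr_fderiv ?_
  ext y; simp

lemma HasGradientAt.mul' {f h : E → ℝ} {f' h' x : E}
    (hf : HasGradientAt f f' x) (hh : HasGradientAt h h' x) :
    HasGradientAt (fun y => f y * h y) (h x • f' + f x • h') x := by
  rw [hasGradientAt_iff_hasFDerivAt] at hf hh ⊢
  refine (hf.mul hh).congr_fderiv ?_
  ext y; simp [add_comm]

lemma hasGradientAt_norm_sq (x : E) : HasGradientAt (fun y : E => ‖y‖ ^ 2) ((2 : ℝ) • x) x := by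
  rw [hasGradientAt_iff_hasFDerivAt]
  refine (hasStrictFDerivAt_norm_sq (F := E) x).hasFDerivAt.congr_fderiv ?_
  ext y; simp [two_smul]

lemma hasDerivAt_max_zero_pow (k : ℕ) (s : ℝ) :
    HasDerivAt (fun s : ℝ => max 0 s ^ (k + 2)) ((k + 2 : ℝ) * max 0 s ^ (k + 1)) s := by
  rcases lt_trichotomy s 0 with h | h | h
  · rw [max_eq_left h.le]
    have : (fun s : ℝ => max 0 s ^ (k + 2)) =ᶠ[𝓝 s] fun _ => 0 := by
      filter_upwards [Iio_mem_nhds h] with t ht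
      simp [max_eq_left (le_of_lt (mem_Iio.1 ht))]
    simpa using (hasDerivAt_const s (0 : ℝ)).congr_of_eventuallyEq this
  · subst h
    rw [hasDerivAt_iff_isLittleO]
    simp only [max_self, sub_zero, ne_eq, Nat.add_eq_zero_iff, OfNat.ofNat_ne_zero, and_false,
      not_false_eq_true, zero_pow, smul_eq_mul, one_ne_zero, mul_zero]
    refine Asymptotics.IsBigO.trans_isLittleO (g := fun s : ℝ => s ^ (k + 2)) ?_ ?_
    · refine Asymptotics.IsBigO.of_bound 1 (Eventually.of_forall fun t => ?_)
      rw [one_mul, norm_pow, norm_pow]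
      gcongr
      rcases le_total 0 t with h | h <;> simp [h]
    · simpa using Asymptotics.isLittleO_pow_id (𝕜 := ℝ) (n := k + 2) (by omega)
  · rw [max_eq_right h.le]
    have : (fun s : ℝ => max 0 s ^ (k + 2)) =ᶠ[𝓝 s] fun s => s ^ (k + 2) := by
      filter_upwards [Ioi_mem_nhds h] with t ht
      simp [max_eq_right (le_of_lt (mem_Ioi.1 ht))]
    have h2 := (hasDerivAt_pow (k + 2) s).congr_of_eventuallyEq this
    simpa using h2

/-- A `C¹` compactly supported cutoff in `U`, together with its gradient. -/
structure IsCutoff (U : Set E) (η : E → ℝ) (η' : E → E) : Prop where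
  grad : ∀ x, HasGradientAt η (η' x) x
  cont : Continuous η'
  compact : HasCompactSupport η
  supp : tsupport η ⊆ U

namespace IsCutoff

variable {U : Set (EuclideanSpace ℝ (Fin n))} {η : EuclideanSpace ℝ (Fin n) → ℝ}
  {η' : EuclideanSpace ℝ (Fin n) → EuclideanSpace ℝ (Fin n)}

lemma continuous (h : IsCutoff U η η') : Continuous η :=
  continuous_iff_continuousAt.2 fun x => (h.grad x).continuousAt

lemma grad_eq_zero (h : IsCutoff U η η') {x : E} (hx : x ∉ tsupport η) : η' x = 0 := by
  have h1 : η =ᶠ[𝓝 x] fun _ => 0 := notMem_tsupport_iff_eventuallyEq.1 hx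
  have h2 : HasGradientAt η 0 x := (hasGradientAt_const x 0).congr_of_eventuallyEq h1
  exact (h.grad x).unique h2

lemma tsupport_grad (h : IsCutoff U η η') : tsupport η' ⊆ tsupport η :=
  closure_minimal (fun _ hx => by_contra fun h' => hx (h.grad_eq_zero h')) (isClosed_tsupport _)

lemma mono (h : IsCutoff U η η') {V : Set E} (hUV : U ⊆ V) : IsCutoff V η η' :=
  ⟨h.grad, h.cont, h.compact, h.supp.trans hUV⟩

lemma sq (h : IsCutoff U η η') : IsCutoff U (fun x => η x ^ 2) (fun x => (2 * η x) • η' x) where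
  grad x := by
    have := HasGradientAt.comp_deriv (Φ := fun s => s ^ 2) (by simpa using hasDerivAt_pow 2 (η x))
      (h.grad x)
    exact this
  cont := (continuous_const.mul h.continuous).smul h.cont
  compact := h.compact.comp_left (g := fun s : ℝ => s ^ 2) (by simp)
  supp := by
    refine (closure_mono ?_).trans h.supp
    intro x hx h0
    exact hx (by simp [h0])

lemma tsupport_mul_left (η h : E → ℝ) : tsupport (fun x => η x * h x) ⊆ tsupport η :=
  closure_mono fun _ hx h0 => hx (by simp [h0])

lemma tsupport_smul_right (η : E → ℝ) (h : E → E) : tsupport (fun x => η x • h x) ⊆ tsupport h :=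
  closure_mono fun _ hx h0 => hx (by simp [h0])

lemma continuous_mul (h : IsCutoff U η η') (hU : IsOpen U) {f : E → ℝ} (hf : ContinuousOn f U) :
    Continuous fun x => η x * f x :=
  (h.continuous.continuousOn.mul hf).continuous_of_tsupport_subset hU
    ((tsupport_mul_left _ _).trans h.supp)

lemma hasCompactSupport_mul (h : IsCutoff U η η') (f : E → ℝ) :
    HasCompactSupport fun x => η x * f x :=
  h.compact.mono fun _ hx h0 => hx (by simp [h0])

lemma integrable_mul (h : IsCutoff U η η') (hU : IsOpen U) {f : E → ℝ} (hf : ContinuousOn f U) :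
    Integrable fun x => η x * f x :=
  (h.continuous_mul hU hf).integrable_of_hasCompactSupport (h.hasCompactSupport_mul f)

lemma integrable_mul_mul (h : IsCutoff U η η') (hU : IsOpen U) {f q : E → ℝ}
    (hf : ContinuousOn f U) (hq : LocallyIntegrableOn q U) :
    Integrable fun x => η x * f x * q x :=
  integrable_mul_of_tsupport_subset hq (h.continuous_mul hU hf) (h.hasCompactSupport_mul f)
    ((tsupport_mul_left _ _).trans h.supp)

lemma continuous_grad_smul (h : IsCutoff U η η') (hU : IsOpen U) {f : E → ℝ}
    (hf : ContinuousOn f U) : Continuous fun x => f x • η' x :=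
  (hf.smul h.cont.continuousOn).continuous_of_tsupport_subset hU
    ((tsupport_smul_right _ _).trans (h.tsupport_grad.trans h.supp))

lemma hasCompactSupport_grad_smul (h : IsCutoff U η η') (f : E → ℝ) :
    HasCompactSupport fun x => f x • η' x :=
  HasCompactSupport.of_support_subset_isCompact h.compact.isCompact
    ((subset_tsupport _).trans ((tsupport_smul_right _ _).trans h.tsupport_grad))

lemma integrable_norm_grad_sq_mul (h : IsCutoff U η η') (hU : IsOpen U) {f : E → ℝ}
    (hf : ContinuousOn f U) : Integrable fun x => ‖f x • η' x‖ ^ 2 := by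
  refine ((h.continuous_grad_smul hU hf).norm.pow 2).integrable_of_hasCompactSupport ?_
  refine (h.hasCompactSupport_grad_smul f).mono fun x hx h0 => hx ?_
  change ‖f x • η' x‖ ^ 2 = 0
  rw [show f x • η' x = 0 from h0, norm_zero, zero_pow two_ne_zero]

lemma hasGradientAt_mul (h : IsCutoff U η η') {f : E → ℝ} {f' : E → E}
    (hf : ∀ x ∈ U, HasGradientAt f (f' x) x) (x : E) :
    HasGradientAt (fun y => η y * f y) (f x • η' x + η x • f' x) x := by
  by_cases hx : x ∈ tsupport η
  · exact HasGradientAt.mul' (h.grad x) (hf x (h.supp hx))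
  · have h1 : η =ᶠ[𝓝 x] fun _ => 0 := notMem_tsupport_iff_eventuallyEq.1 hx
    rw [h.grad_eq_zero hx, h1.eq_of_nhds, smul_zero, zero_smul, zero_add]
    refine (hasGradientAt_const x (0 : ℝ)).congr_of_eventuallyEq ?_
    filter_upwards [h1] with y hy
    simp [hy]

lemma memLp_grad_mul (h : IsCutoff U η η') (hU : IsOpen U) {f k v : E → ℝ}
    (hf : ContinuousOn f U) (hk : ContinuousOn k U)
    (hv : LocallyIntegrableOn (fun x => ‖gradient v x‖ ^ 2) U) :
    MemLp (fun x => f x • η' x + (η x * k x) • gradient v x) 2 volume := by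
  refine MemLp.add ?_ ?_
  · exact (h.continuous_grad_smul hU hf).memLp_of_hasCompactSupport (h.hasCompactSupport_grad_smul f)
  · rw [memLp_two_iff_integrable_sq_norm]
    · have h1 : Integrable fun x => (η x * k x) ^ 2 * ‖gradient v x‖ ^ 2 := by
        refine integrable_mul_of_tsupport_subset hv ((h.continuous_mul hU hk).pow 2) ?_ ?_
        · exact (h.hasCompactSupport_mul k).mono fun x hx h0 => hx (by simp [h0])
        · have : Function.support (fun x => (η x * k x) ^ 2) ⊆ Function.support η :=
            fun x hx h0 => hx (by simp [h0])
          exact (closure_mono this).trans h.supp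
      refine h1.congr (Eventually.of_forall fun x => ?_)
      simp only [norm_smul, mul_pow, Real.norm_eq_abs, sq_abs]
    · exact (h.continuous_mul hU hk).aestronglyMeasurable.smul
        (measurable_gradient v).aestronglyMeasurable

end IsCutoff

lemma memLp_two_restrict_of_norm_le {U K : Set E} {v : E → ℝ} {H : E → E}
    {f : E → ℝ} {M : ℝ}
    (hv : LocallyIntegrableOn (fun x => ‖gradient v x‖ ^ 2) U) (hf : ContinuousOn f U)
    (hm : AEStronglyMeasurable H (volume.restrict U))
    (hb : ∀ x ∈ U, ‖H x‖ ≤ M * ‖gradient v x‖ + f x) (hKU : K ⊆ U) (hK : IsCompact K) :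
    MemLp H 2 (volume.restrict K) := by
  have h1 : MemLp (fun x => ‖gradient v x‖) 2 (volume.restrict K) := by
    rw [memLp_two_iff_integrable_sq]
    · exact hv.integrableOn_compact_subset hKU hK
    · exact (measurable_gradient v).norm.aestronglyMeasurable
  have h2 : MemLp f 2 (volume.restrict K) := by
    rw [memLp_two_iff_integrable_sq]
    · exact ((hf.mono hKU).pow 2).integrableOn_compact hK
    · exact (hf.mono hKU).aestronglyMeasurable hK.measurableSet
  refine MemLp.mono' (g := fun x => M * ‖gradient v x‖ + f x) ?_
    (hm.mono_measure (Measure.restrict_mono hKU le_rfl)) ?_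
  · exact (h1.const_mul M).add h2
  · exact (ae_restrict_mem hK.measurableSet).mono fun x hx => hb x (hKU hx)

lemma integrable_inner_of_tsupport_subset {H ψ : E → E} {K : Set E}
    (hH : MemLp H 2 (volume.restrict K)) (hψ : MemLp ψ 2 volume) (hs : ∀ x ∉ K, ψ x = 0) :
    Integrable fun x => ⟪H x, ψ x⟫ := by
  have := integrable_inner_of_memLp_two hH (hψ.restrict K)
  refine (integrableOn_iff_integrable_of_support_subset (s := K) ?_).1 this
  intro x hx
  by_contra h
  exact hx (by simp [hs x h])

end Cutoff

section DeGiorgi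

variable {n : ℕ}

local notation "E" => EuclideanSpace ℝ (Fin n)

/-- Radial cutoff `((R² - |x|²)₊)²`. -/
def ballCutoff (R : ℝ) (x : EuclideanSpace ℝ (Fin n)) : ℝ := max 0 (R ^ 2 - ‖x‖ ^ 2) ^ 2

/-- Gradient of `ballCutoff`. -/
def ballCutoffGrad (R : ℝ) (x : EuclideanSpace ℝ (Fin n)) : EuclideanSpace ℝ (Fin n) :=
  (-4 * max 0 (R ^ 2 - ‖x‖ ^ 2)) • x

lemma tsupport_ballCutoff {R : ℝ} (hR : 0 < R) :
    tsupport (ballCutoff R : E → ℝ) ⊆ closedBall 0 R := by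
  refine closure_minimal (fun x hx => ?_) isClosed_closedBall
  rw [mem_closedBall_zero_iff]
  by_contra h
  push Not at h
  refine hx ?_
  have : R ^ 2 - ‖x‖ ^ 2 ≤ 0 := by nlinarith
  simp [ballCutoff, max_eq_left this]

lemma isCutoff_ballCutoff {U : Set E} {R : ℝ} (hR : 0 < R) (hU : closedBall 0 R ⊆ U) :
    IsCutoff U (ballCutoff R) (ballCutoffGrad R) where
  grad x := by
    have h1 : HasGradientAt (fun y : E => R ^ 2 - ‖y‖ ^ 2) (-((2 : ℝ) • x)) x := by
      have := HasGradientAt.comp_deriv (Φ := fun s => R ^ 2 - s) (Φ' := -1)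
        ((hasDerivAt_id _).const_sub _) (hasGradientAt_norm_sq x)
      simpa using this
    have h2 := HasGradientAt.comp_deriv (hasDerivAt_max_zero_pow 0 _) h1
    have h3 : ballCutoffGrad R x = ((((0 : ℕ) : ℝ) + 2) * max 0 (R ^ 2 - ‖x‖ ^ 2) ^ (0 + 1)) •
        -((2 : ℝ) • x) := by
      rw [ballCutoffGrad, smul_neg, smul_smul, ← neg_smul]; congr 1; push_cast; ring
    rw [h3]; exact h2
  cont := by unfold ballCutoffGrad; fun_prop
  compact := HasCompactSupport.of_support_subset_isCompact (isCompact_closedBall 0 R)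
    ((subset_tsupport _).trans (tsupport_ballCutoff hR))
  supp := (tsupport_ballCutoff hR).trans hU

lemma ballCutoff_nonneg (R : ℝ) (x : E) : 0 ≤ ballCutoff R x := sq_nonneg _

lemma ballCutoff_eq_zero {R : ℝ} (hR : 0 < R) {x : E} (hx : x ∉ ball (0 : E) R) :
    ballCutoff R x = 0 := by
  rw [mem_ball_zero_iff, not_lt] at hx
  have : R ^ 2 - ‖x‖ ^ 2 ≤ 0 := by nlinarith
  simp [ballCutoff, max_eq_left this]

lemma ballCutoffGrad_eq_zero {R : ℝ} (hR : 0 < R) {x : E} (hx : x ∉ ball (0 : E) R) :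
    ballCutoffGrad R x = 0 := by
  rw [mem_ball_zero_iff, not_lt] at hx
  have : R ^ 2 - ‖x‖ ^ 2 ≤ 0 := by nlinarith
  simp [ballCutoffGrad, max_eq_left this]

lemma ballCutoff_le {R : ℝ} (x : E) : ballCutoff R x ≤ R ^ 4 := by
  have h1 : max 0 (R ^ 2 - ‖x‖ ^ 2) ≤ R ^ 2 := max_le (by positivity) (by nlinarith [norm_nonneg x])
  calc _ ≤ (R ^ 2) ^ 2 := pow_le_pow_left₀ (le_max_left _ _) h1 2
    _ = _ := by ring

lemma norm_ballCutoffGrad_le {R : ℝ} (hR : 0 < R) (x : E) : ‖ballCutoffGrad R x‖ ≤ 4 * R ^ 3 := by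
  by_cases hx : x ∈ ball (0 : E) R
  · rw [mem_ball_zero_iff] at hx
    have h0 : 0 ≤ max 0 (R ^ 2 - ‖x‖ ^ 2) := le_max_left _ _
    have h1 : max 0 (R ^ 2 - ‖x‖ ^ 2) ≤ R ^ 2 :=
      max_le (by positivity) (by nlinarith [norm_nonneg x])
    rw [ballCutoffGrad, norm_smul, norm_mul, Real.norm_eq_abs, Real.norm_eq_abs, abs_of_nonneg h0]
    norm_num
    calc 4 * max 0 (R ^ 2 - ‖x‖ ^ 2) * ‖x‖ ≤ 4 * R ^ 2 * R := by gcongr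
      _ = _ := by ring
  · rw [ballCutoffGrad_eq_zero hR hx, norm_zero]; positivity

lemma le_ballCutoff {R r : ℝ} (hr : 0 ≤ r) (hrR : r ≤ R) {x : E} (hx : x ∈ ball (0 : E) r) :
    (R ^ 2 - r ^ 2) ^ 2 ≤ ballCutoff R x := by
  rw [mem_ball_zero_iff] at hx
  refine pow_le_pow_left₀ (by nlinarith) ?_ 2
  exact le_max_of_le_right (by nlinarith [norm_nonneg x])

/-- `C¹` truncation `t³/(d²+t²)`, `t = (s-l)₊`. -/
def trunc (d l s : ℝ) : ℝ := max 0 (s - l) ^ 3 / (d ^ 2 + max 0 (s - l) ^ 2)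

/-- Derivative of `trunc`. -/
def truncDeriv (d l s : ℝ) : ℝ :=
  max 0 (s - l) ^ 2 * (3 * d ^ 2 + max 0 (s - l) ^ 2) / (d ^ 2 + max 0 (s - l) ^ 2) ^ 2

lemma hasDerivAt_trunc {d : ℝ} (hd : 0 < d) (l s : ℝ) :
    HasDerivAt (trunc d l) (truncDeriv d l s) s := by
  have h0 : HasDerivAt (fun s => s - l) 1 s := (hasDerivAt_id s).sub_const l
  have h3 := (hasDerivAt_max_zero_pow 1 (s - l)).comp s h0
  have h2 := (hasDerivAt_max_zero_pow 0 (s - l)).comp s h0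
  have hne : d ^ 2 + max 0 (s - l) ^ 2 ≠ 0 := by positivity
  have := h3.div (h2.const_add (d ^ 2)) hne
  refine this.congr_deriv ?_
  simp only [Function.comp, truncDeriv]
  push_cast
  congr 1
  ring

lemma continuous_truncDeriv {d : ℝ} (hd : 0 < d) (l : ℝ) : Continuous (truncDeriv d l) := by
  unfold truncDeriv
  refine Continuous.div (by fun_prop) (by fun_prop) fun s => by positivity

lemma trunc_nonneg {d l s : ℝ} : 0 ≤ trunc d l s := by
  have : 0 ≤ max 0 (s - l) := le_max_left _ _
  unfold trunc; positivity

lemma truncDeriv_nonneg {d l s : ℝ} : 0 ≤ truncDeriv d l s := by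
  unfold truncDeriv; positivity

lemma truncDeriv_le_two {d l s : ℝ} (hd : 0 < d) : truncDeriv d l s ≤ 2 := by
  unfold truncDeriv
  rw [div_le_iff₀ (by positivity)]
  nlinarith [sq_nonneg (max 0 (s - l)), sq_nonneg d, sq_nonneg (d * max 0 (s - l)),
    sq_nonneg (max 0 (s - l) ^ 2), sq_nonneg (d ^ 2)]

lemma truncDeriv_le_div {d l s : ℝ} (hd : 0 < d) :
    truncDeriv d l s ≤ 3 / d ^ 2 * max 0 (s - l) ^ 2 := by
  unfold truncDeriv
  set t := max 0 (s - l)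
  rw [div_le_iff₀ (by positivity)]
  have h : t ^ 2 * (3 * d ^ 2 + t ^ 2) ≤ 3 * t ^ 2 * (d ^ 2 + 2 * t ^ 2) := by
    nlinarith [sq_nonneg (t ^ 2)]
  calc _ ≤ 3 * t ^ 2 * (d ^ 2 + 2 * t ^ 2) := h
    _ ≤ 3 * t ^ 2 * (d ^ 2 + 2 * t ^ 2 + t ^ 4 / d ^ 2) := by
      exact mul_le_mul_of_nonneg_left (le_add_of_nonneg_right (by positivity)) (by positivity)
    _ = _ := by field_simp; ring

lemma trunc_sq_le {d l s : ℝ} (hd : 0 < d) :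
    trunc d l s ^ 2 ≤ max 0 (s - l) ^ 2 * truncDeriv d l s := by
  unfold trunc truncDeriv
  set t := max 0 (s - l)
  rw [div_pow, ← mul_div_assoc]
  gcongr
  nlinarith [sq_nonneg (t ^ 2 * d)]

lemma trunc_le_self {d l s : ℝ} (hd : 0 < d) : trunc d l s ≤ max 0 (s - l) := by
  unfold trunc
  have h0 : 0 ≤ max 0 (s - l) := le_max_left _ _
  set t := max 0 (s - l)
  rw [div_le_iff₀ (by positivity)]
  nlinarith [mul_nonneg h0 (sq_nonneg d)]

lemma trunc_le_div {d l s : ℝ} (hd : 0 < d) : trunc d l s ≤ max 0 (s - l) ^ 2 / d := by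
  unfold trunc
  have h0 : 0 ≤ max 0 (s - l) := le_max_left _ _
  set t := max 0 (s - l)
  rw [div_le_div_iff₀ (by positivity) hd]
  nlinarith [mul_nonneg (sq_nonneg t) (sq_nonneg (t - d)), mul_nonneg h0 hd.le,
    mul_nonneg (sq_nonneg t) (mul_nonneg h0 hd.le)]

lemma half_le_trunc {d l s : ℝ} (hd : 0 < d) (hs : l + d ≤ s) : (s - l) / 2 ≤ trunc d l s := by
  unfold trunc
  rw [max_eq_right (by linarith)]
  have h : d ≤ s - l := by linarith
  set t := s - l
  rw [div_le_div_iff₀ (by norm_num) (by positivity)]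
  nlinarith [mul_nonneg (hd.le.trans h) (mul_nonneg (sub_nonneg.2 h) (add_nonneg hd.le
    (hd.le.trans h)))]

/-- Weak subsolutions (in composite-test-function form) in the unit ball. -/
structure SubSol (lam M b K : ℝ) (v : E → ℝ) (H : E → E) : Prop where
  diff : ∀ x ∈ ball (0 : E) 1, DifferentiableAt ℝ v x
  sq_int : LocallyIntegrableOn (fun x => ‖gradient v x‖ ^ 2) (ball 0 1)
  meas : AEStronglyMeasurable H (volume.restrict (ball 0 1))
  bound : ∀ x ∈ ball (0 : E) 1, ‖H x‖ ≤ M * ‖gradient v x‖ + b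
  ell : ∀ x ∈ ball (0 : E) 1,
    lam * ‖gradient v x‖ ^ 2 - b * ‖gradient v x‖ ≤ ⟪H x, gradient v x⟫
  weak : ∀ (η : E → ℝ) (η' : E → E), IsCutoff (ball 0 1) η η' → (∀ x, 0 ≤ η x) →
    ∀ Φ Φ' : ℝ → ℝ, (∀ s, HasDerivAt Φ (Φ' s) s) → Continuous Φ' → (∀ s, 0 ≤ Φ s) →
    ∫ x, ⟪H x, Φ (v x) • η' x + (η x * Φ' (v x)) • gradient v x⟫ ≤ K * ∫ x, η x * Φ (v x)

lemma SubSol.continuousOn {lam M b K : ℝ} {v : E → ℝ} {H : E → E} (h : SubSol lam M b K v H) :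
    ContinuousOn v (ball 0 1) := fun x hx => (h.diff x hx).continuousAt.continuousWithinAt

lemma SubSol.memLp {lam M b K : ℝ} {v : E → ℝ} {H : E → E} (h : SubSol lam M b K v H) {S : Set E}
    (hS : IsCompact S) (hS1 : S ⊆ ball 0 1) : MemLp H 2 (volume.restrict S) :=
  memLp_two_restrict_of_norm_le (f := fun _ => b) h.sq_int
    continuousOn_const h.meas h.bound hS1 hS

lemma caccioppoli_pointwise {lam M b e e' X t τ D p a : ℝ} (hlam : 0 < lam) (hM : 0 < M)
    (hb : 0 ≤ b) (he : 0 ≤ e) (he' : 0 ≤ e') (hX : 0 ≤ X) (ht : 0 ≤ t) (hτ : 0 ≤ τ) (hD : 0 ≤ D)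
    (hτD : τ ^ 2 ≤ t ^ 2 * D) (hp : |p| ≤ (M * X + b) * e') (ha : lam * X ^ 2 - b * X ≤ a) :
    lam / 2 * (e ^ 2 * D * X ^ 2) - ((4 * M ^ 2 / lam + 1) * (t ^ 2 * e' ^ 2) +
      (b ^ 2 / lam + b ^ 2) * (e ^ 2 * D)) ≤ 2 * e * τ * p + e ^ 2 * D * a := by
  set σ := √D with hσ
  have hσ0 : 0 ≤ σ := Real.sqrt_nonneg _
  have hσ2 : D = σ ^ 2 := (Real.sq_sqrt hD).symm
  have hτσ : τ ≤ t * σ := by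
    refine abs_le_of_sq_le_sq' ?_ (by positivity) |>.2
    rw [mul_pow, ← hσ2]; exact hτD
  have h1 : -((M * X + b) * e') ≤ p := (abs_le.1 hp).1
  have h2 : 2 * e * τ * (-((M * X + b) * e')) ≤ 2 * e * τ * p := by gcongr
  have h3 : 2 * e * τ * ((M * X + b) * e') ≤ 2 * e * (t * σ) * ((M * X + b) * e') := by gcongr
  have h4 : e ^ 2 * D * (lam * X ^ 2 - b * X) ≤ e ^ 2 * D * a := by gcongr
  have h5 : 2 * M * (e * σ * X) * (t * e') ≤
      lam / 4 * (e * σ * X) ^ 2 + 4 * M ^ 2 / lam * (t * e') ^ 2 := by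
    have : 0 ≤ (lam * (e * σ * X) - 4 * M * (t * e')) ^ 2 / (4 * lam) := by positivity
    have e1 : (lam * (e * σ * X) - 4 * M * (t * e')) ^ 2 / (4 * lam) =
      lam / 4 * (e * σ * X) ^ 2 + 4 * M ^ 2 / lam * (t * e') ^ 2 -
        2 * M * (e * σ * X) * (t * e') := by field_simp; ring
    linarith
  have h6 : b * (e * σ) * (e * σ * X) ≤
      lam / 4 * (e * σ * X) ^ 2 + b ^ 2 / lam * (e * σ) ^ 2 := by
    have : 0 ≤ (lam * (e * σ * X) - 2 * b * (e * σ)) ^ 2 / (4 * lam) := by positivity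
    have e1 : (lam * (e * σ * X) - 2 * b * (e * σ)) ^ 2 / (4 * lam) =
      lam / 4 * (e * σ * X) ^ 2 + b ^ 2 / lam * (e * σ) ^ 2 -
        b * (e * σ) * (e * σ * X) := by field_simp; ring
    linarith
  have h7 : 2 * (e * σ * b) * (t * e') ≤ (e * σ * b) ^ 2 + (t * e') ^ 2 := two_mul_le_add_sq _ _
  rw [hσ2] at h4 ⊢
  nlinarith [h2, h3, h4, h5, h6, h7]

set_option maxHeartbeats 1000000 in
/-- Caccioppoli inequality for truncations of subsolutions. -/
lemma SubSol.caccioppoli {lam M b K : ℝ} (hlam : 0 < lam) (hM : 0 < M) (hb : 0 ≤ b) (hK : 0 ≤ K)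
    {v : E → ℝ} {H : E → E} (h : SubSol lam M b K v H) (l : ℝ) {d : ℝ} (hd : 0 < d) (hd1 : d ≤ 1)
    {R : ℝ} (hR : 0 < R) (hR1 : R < 1) :
    ∫ x, ‖trunc d l (v x) • ballCutoffGrad R x +
        (ballCutoff R x * truncDeriv d l (v x)) • gradient v x‖ ^ 2 ≤
      (32 + 8 / lam * (16 * (4 * M ^ 2 / lam + 1) + 3 * (b ^ 2 / lam + b ^ 2) + K)) *
        ((∫ x in ball (0 : E) R, max 0 (v x - l) ^ 2) / d ^ 2) := by
  have hU : IsOpen (ball (0 : E) 1) := isOpen_ball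
  have hRU : closedBall (0 : E) R ⊆ ball 0 1 := closedBall_subset_ball hR1
  have hη := isCutoff_ballCutoff hR hRU
  have hvc := h.continuousOn
  have hTc : Continuous (trunc d l) :=
    continuous_iff_continuousAt.2 fun s => (hasDerivAt_trunc hd l s).continuousAt
  have hT'c := continuous_truncDeriv hd l
  have htv : ContinuousOn (fun x => trunc d l (v x)) (ball 0 1) := hTc.comp_continuousOn hvc
  have htv' : ContinuousOn (fun x => truncDeriv d l (v x)) (ball 0 1) := hT'c.comp_continuousOn hvc
  have hη1 : ∀ x : E, ballCutoff R x ≤ 1 := fun x =>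
    (ballCutoff_le x).trans (pow_le_one₀ hR.le hR1.le)
  have hη1' : ∀ x : E, ‖ballCutoffGrad R x‖ ≤ 4 := fun x =>
    (norm_ballCutoffGrad_le hR x).trans (by nlinarith [pow_le_one₀ (n := 3) hR.le hR1.le])
  set η : E → ℝ := ballCutoff R with hηdef
  set η' : E → E := ballCutoffGrad R with hη'def
  set C1 := 16 * (4 * M ^ 2 / lam + 1) + 3 * (b ^ 2 / lam + b ^ 2) + K with hC1
  set J : E → ℝ := (ball (0 : E) R).indicator fun x => max 0 (v x - l) ^ 2 / d ^ 2 with hJ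
  have hJint : Integrable J := by
    rw [hJ, integrable_indicator_iff measurableSet_ball]
    refine IntegrableOn.mono_set ?_ ball_subset_closedBall
    refine ContinuousOn.integrableOn_compact (isCompact_closedBall 0 R) ?_
    have : ContinuousOn v (closedBall 0 R) := hvc.mono hRU
    fun_prop
  have hJe : ∫ x, J x = (∫ x in ball (0 : E) R, max 0 (v x - l) ^ 2) / d ^ 2 := by
    rw [hJ, integral_indicator measurableSet_ball, integral_div]
  have hweak := h.weak _ _ hη.sq (fun x => sq_nonneg _) (trunc d l) (truncDeriv d l)
    (hasDerivAt_trunc hd l) hT'c (fun s => trunc_nonneg)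
  have hmem := hη.sq.memLp_grad_mul hU htv htv' h.sq_int
  have hint1 := integrable_inner_of_tsupport_subset (K := closedBall (0 : E) R)
    (h.memLp (isCompact_closedBall 0 R) hRU) hmem (fun x hx => by
      have hx' : x ∉ ball (0 : E) R := fun hh => hx (ball_subset_closedBall hh)
      simp [hηdef, ballCutoff_eq_zero hR hx'])
  have hint2 : Integrable fun x => η x ^ 2 * truncDeriv d l (v x) * ‖gradient v x‖ ^ 2 :=
    hη.sq.integrable_mul_mul hU htv' h.sq_int
  have hint3 : Integrable fun x => η x ^ 2 * trunc d l (v x) := hη.sq.integrable_mul hU htv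
  have hdd : 1 / d ≤ 1 / d ^ 2 := by
    rw [div_le_div_iff₀ hd (by positivity)]; nlinarith
  have hdiv : ∀ t : ℝ, t ^ 2 ≤ t ^ 2 / d ^ 2 := fun t => by
    rw [le_div_iff₀ (by positivity)]
    exact mul_le_of_le_one_right (sq_nonneg t) (pow_le_one₀ hd.le hd1)
  have hP : ∀ x, lam / 2 * (η x ^ 2 * truncDeriv d l (v x) * ‖gradient v x‖ ^ 2) +
      K * (η x ^ 2 * trunc d l (v x)) ≤
      ⟪H x, trunc d l (v x) • (2 * η x) • η' x + (η x ^ 2 * truncDeriv d l (v x)) • gradient v x⟫ +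
        C1 * J x := by
    intro x
    by_cases hx : x ∈ ball (0 : E) R
    · have hx1 : x ∈ ball (0 : E) 1 := ball_subset_ball hR1.le hx
      have hp : |⟪H x, η' x⟫| ≤ (M * ‖gradient v x‖ + b) * ‖η' x‖ :=
        (abs_real_inner_le_norm _ _).trans (by gcongr; exact h.bound x hx1)
      have key := caccioppoli_pointwise hlam hM hb (ballCutoff_nonneg R x) (norm_nonneg (η' x))
        (norm_nonneg (gradient v x)) (le_max_left 0 (v x - l)) (trunc_nonneg (d := d) (l := l))
        truncDeriv_nonneg (trunc_sq_le hd) hp (h.ell x hx1)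
      have e1 : ⟪H x, trunc d l (v x) • (2 * η x) • η' x +
          (η x ^ 2 * truncDeriv d l (v x)) • gradient v x⟫ =
          2 * η x * trunc d l (v x) * ⟪H x, η' x⟫ +
          η x ^ 2 * truncDeriv d l (v x) * ⟪H x, gradient v x⟫ := by
        rw [inner_add_right, inner_smul_right, inner_smul_right, inner_smul_right]; ring
      rw [e1]
      have e2 : J x = max 0 (v x - l) ^ 2 / d ^ 2 := by rw [hJ, indicator_of_mem hx]
      set t := max 0 (v x - l) with ht
      have a1 : t ^ 2 * ‖η' x‖ ^ 2 ≤ 16 * J x := by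
        have : ‖η' x‖ ^ 2 ≤ 16 := by nlinarith [hη1' x, norm_nonneg (η' x)]
        have h2 : t ^ 2 ≤ J x := by
          rw [e2]; exact hdiv t
        calc _ ≤ J x * 16 := mul_le_mul h2 this (sq_nonneg _) ((sq_nonneg t).trans h2)
          _ = _ := by ring
      have hη2 : η x ^ 2 ≤ 1 := pow_le_one₀ (ballCutoff_nonneg R x) (hη1 x)
      have a2 : η x ^ 2 * truncDeriv d l (v x) ≤ 3 * J x := by
        calc _ ≤ 1 * (3 / d ^ 2 * t ^ 2) :=
              mul_le_mul hη2 (truncDeriv_le_div hd) truncDeriv_nonneg zero_le_one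
          _ = _ := by rw [e2]; ring
      have a3 : η x ^ 2 * trunc d l (v x) ≤ J x := by
        calc _ ≤ 1 * (t ^ 2 / d) := mul_le_mul hη2 (trunc_le_div hd) trunc_nonneg zero_le_one
          _ = t ^ 2 * (1 / d) := by ring
          _ ≤ t ^ 2 * (1 / d ^ 2) := by gcongr
          _ = _ := by rw [e2]; ring
      have c1 : 0 ≤ 4 * M ^ 2 / lam + 1 := by positivity
      have c2 : 0 ≤ b ^ 2 / lam + b ^ 2 := by positivity
      have b1 := mul_le_mul_of_nonneg_left a1 c1
      have b2 := mul_le_mul_of_nonneg_left a2 c2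
      have b3 := mul_le_mul_of_nonneg_left a3 hK
      rw [hC1]
      linarith
    · have e0 : η x = 0 := ballCutoff_eq_zero hR hx
      simp [e0, hJ, hx]
  have hI := integral_mono ((hint2.const_mul (lam / 2)).add (hint3.const_mul K))
    (hint1.add (hJint.const_mul C1)) hP
  simp only [Pi.add_apply] at hI
  rw [integral_add (hint2.const_mul (lam / 2)) (hint3.const_mul K),
    integral_add hint1 (hJint.const_mul C1), integral_const_mul, integral_const_mul,
    integral_const_mul] at hI
  have hE : ∫ x, η x ^ 2 * truncDeriv d l (v x) * ‖gradient v x‖ ^ 2 ≤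
      2 / lam * (C1 * ∫ x, J x) := by
    rw [div_mul_eq_mul_div, le_div_iff₀ hlam]
    linarith
  have hQ : ∀ x, ‖trunc d l (v x) • η' x + (η x * truncDeriv d l (v x)) • gradient v x‖ ^ 2 ≤
      32 * J x + 4 * (η x ^ 2 * truncDeriv d l (v x) * ‖gradient v x‖ ^ 2) := by
    intro x
    by_cases hx : x ∈ ball (0 : E) R
    · have e2 : J x = max 0 (v x - l) ^ 2 / d ^ 2 := by rw [hJ, indicator_of_mem hx]
      set t := max 0 (v x - l) with ht
      have ht0 : 0 ≤ t := le_max_left _ _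
      have n1 : ‖trunc d l (v x) • η' x‖ ≤ t * 4 := by
        rw [norm_smul, Real.norm_eq_abs, abs_of_nonneg trunc_nonneg]
        exact mul_le_mul (trunc_le_self hd) (hη1' x) (norm_nonneg _) ht0
      have n2 : ‖(η x * truncDeriv d l (v x)) • gradient v x‖ ^ 2 ≤
          2 * (η x ^ 2 * truncDeriv d l (v x) * ‖gradient v x‖ ^ 2) := by
        rw [norm_smul, mul_pow, Real.norm_eq_abs, sq_abs, mul_pow]
        have := mul_le_mul_of_nonneg_left (truncDeriv_le_two (l := l) (s := v x) hd)
          (truncDeriv_nonneg (d := d) (l := l) (s := v x))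
        have h0 : 0 ≤ η x ^ 2 * ‖gradient v x‖ ^ 2 := by positivity
        nlinarith
      have h2 : t ^ 2 ≤ J x := by
        rw [e2]; exact hdiv t
      have h3 := norm_add_le (trunc d l (v x) • η' x)
        ((η x * truncDeriv d l (v x)) • gradient v x)
      have h4 : ‖trunc d l (v x) • η' x‖ ^ 2 ≤ 16 * t ^ 2 := by
        calc _ ≤ (t * 4) ^ 2 := pow_le_pow_left₀ (norm_nonneg _) n1 2
          _ = _ := by ring
      calc _ ≤ (‖trunc d l (v x) • η' x‖ + ‖(η x * truncDeriv d l (v x)) • gradient v x‖) ^ 2 := by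
            exact pow_le_pow_left₀ (norm_nonneg _) h3 2
        _ ≤ 2 * ‖trunc d l (v x) • η' x‖ ^ 2 +
            2 * ‖(η x * truncDeriv d l (v x)) • gradient v x‖ ^ 2 := by
          have := add_sq_le (a := ‖trunc d l (v x) • η' x‖)
            (b := ‖(η x * truncDeriv d l (v x)) • gradient v x‖)
          linarith
        _ ≤ _ := by linarith
    · have e0 : η x = 0 := ballCutoff_eq_zero hR hx
      have e0' : η' x = 0 := ballCutoffGrad_eq_zero hR hx
      simp [e0, e0', hJ, hx]
  have hI2 := integral_mono_of_nonneg (Eventually.of_forall fun x => sq_nonneg _)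
    ((hJint.const_mul 32).add (hint2.const_mul 4)) (Eventually.of_forall hQ)
  simp only [Pi.add_apply] at hI2
  rw [integral_add (hJint.const_mul 32) (hint2.const_mul 4), integral_const_mul,
    integral_const_mul] at hI2
  rw [← hJe]
  calc _ ≤ _ := hI2
    _ ≤ 32 * (∫ x, J x) + 4 * (2 / lam * (C1 * ∫ x, J x)) := by gcongr
    _ = _ := by ring

end DeGiorgi

section Iteration

variable {n : ℕ}

local notation "E" => EuclideanSpace ℝ (Fin n)

lemma fast_geometric_convergence {C B a : ℝ} (hC : 0 < C) (hB : 1 < B) (ha : 0 < a) :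
    ∃ θ q : ℝ, 0 < θ ∧ 0 < q ∧ q < 1 ∧ ∀ Y : ℕ → ℝ, (∀ j, 0 ≤ Y j) → Y 0 ≤ θ →
      (∀ j, Y (j + 1) ≤ C * B ^ j * Y j ^ (1 + a)) → ∀ j, Y j ≤ θ * q ^ j := by
  have hB0 : 0 < B := zero_lt_one.trans hB
  set q : ℝ := B ^ (-a⁻¹) with hq
  have hq0 : 0 < q := Real.rpow_pos_of_pos hB0 _
  have hq1 : q < 1 := Real.rpow_lt_one_of_one_lt_of_neg hB (by simpa using ha)
  have hqa : q ^ a = B⁻¹ := by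
    rw [hq, ← Real.rpow_mul hB0.le, neg_mul, inv_mul_cancel₀ ha.ne', Real.rpow_neg_one]
  refine ⟨(q / C) ^ a⁻¹, q, by positivity, hq0, hq1, ?_⟩
  intro Y hY h0 hrec j
  set θ := (q / C) ^ a⁻¹ with hθ
  have hθ0 : 0 < θ := by positivity
  have hθa : θ ^ a = q / C := by
    rw [hθ, ← Real.rpow_mul (by positivity), inv_mul_cancel₀ ha.ne', Real.rpow_one]
  induction j with
  | zero => simpa using h0
  | succ j ih =>
    calc Y (j + 1) ≤ C * B ^ j * Y j ^ (1 + a) := hrec j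
      _ ≤ C * B ^ j * (θ * q ^ j) ^ (1 + a) := by
        gcongr
        exact hY j
      _ = C * B ^ j * ((θ * q ^ j) * (θ ^ a * (q ^ a) ^ j)) := by
        rw [Real.rpow_add (by positivity), Real.rpow_one, Real.mul_rpow hθ0.le (by positivity),
          ← Real.rpow_natCast q j, ← Real.rpow_natCast (q ^ a) j, ← Real.rpow_mul hq0.le,
          ← Real.rpow_mul hq0.le, mul_comm a]
      _ = θ * q ^ (j + 1) := by
        rw [hθa, hqa, inv_pow, pow_succ]; field_simp

/-- One step of De Giorgi's iteration. -/
lemma SubSol.step (hn : 3 ≤ n) {lam M b K : ℝ} (hlam : 0 < lam) (hM : 0 < M) (hb : 0 ≤ b)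
    (hK : 0 ≤ K) : ∃ C : ℝ, 0 < C ∧ ∀ (v : E → ℝ) (H : E → E), SubSol lam M b K v H →
      ∀ l d r R : ℝ, 0 < d → d ≤ 1 → 0 < r → r < R → R < 1 →
      (R ^ 2 - r ^ 2) ^ 4 * ∫ x in ball (0 : E) r, max 0 (v x - (l + d)) ^ 2 ≤
        C * ((∫ x in ball (0 : E) R, max 0 (v x - l) ^ 2) / d ^ 2) ^ (1 + 2 / n : ℝ) := by
  obtain ⟨CS, hCS, hS⟩ := setIntegral_sq_le_measure_rpow_mul (n := n) hn
  set C2 := 32 + 8 / lam * (16 * (4 * M ^ 2 / lam + 1) + 3 * (b ^ 2 / lam + b ^ 2) + K) with hC2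
  have hC2p : 0 < C2 := by positivity
  refine ⟨4 * (CS * C2), by positivity, ?_⟩
  intro v H h l d r R hd hd1 hr hrR hR1
  have hR : 0 < R := hr.trans hrR
  have hU : IsOpen (ball (0 : E) 1) := isOpen_ball
  have hRU : closedBall (0 : E) R ⊆ ball 0 1 := closedBall_subset_ball hR1
  have hrU : closedBall (0 : E) r ⊆ ball 0 1 := closedBall_subset_ball (hrR.trans hR1)
  have hη := isCutoff_ballCutoff hR hRU
  have hvc := h.continuousOn
  have hcacc := h.caccioppoli hlam hM hb hK l hd hd1 hR hR1
  set Q := (∫ x in ball (0 : E) R, max 0 (v x - l) ^ 2) / d ^ 2 with hQ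
  have hQ0 : 0 ≤ Q := div_nonneg (integral_nonneg fun x => sq_nonneg _) (sq_nonneg d)
  have hTc : Continuous (trunc d l) :=
    continuous_iff_continuousAt.2 fun s => (hasDerivAt_trunc hd l s).continuousAt
  have htv : ContinuousOn (fun x => trunc d l (v x)) (ball 0 1) := hTc.comp_continuousOn hvc
  have htv' : ContinuousOn (fun x => truncDeriv d l (v x)) (ball 0 1) :=
    (continuous_truncDeriv hd l).comp_continuousOn hvc
  have hgrad : ∀ x, HasGradientAt (fun y => ballCutoff R y * trunc d l (v y))
      (trunc d l (v x) • ballCutoffGrad R x +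
        (ballCutoff R x * truncDeriv d l (v x)) • gradient v x) x := by
    intro x
    have := hη.hasGradientAt_mul (f := fun x => trunc d l (v x))
      (f' := fun x => truncDeriv d l (v x) • gradient v x) (fun x hx =>
        HasGradientAt.comp_deriv (hasDerivAt_trunc hd l (v x)) (h.diff x hx).hasGradientAt) x
    rwa [smul_smul] at this
  set S : Set E := {x ∈ ball (0 : E) r | l + d < v x} with hSdef
  have hSr : S ⊆ ball 0 r := fun x hx => hx.1
  have hSo : IsOpen S := by
    have := (hvc.mono (ball_subset_closedBall.trans hrU)).isOpen_inter_preimage isOpen_ball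
      (isOpen_Ioi (a := l + d))
    exact this
  have hSm : MeasurableSet S := hSo.measurableSet
  have hSfin : volume S ≠ ∞ := ne_top_of_le_ne_top measure_ball_lt_top.ne (measure_mono hSr)
  have hFK := hS _ _ hgrad (hη.hasCompactSupport_mul _) (hη.memLp_grad_mul hU htv htv' h.sq_int)
    S hSfin
  have hmint : ∀ (m : ℝ) {ρ : ℝ}, ρ < 1 →
      IntegrableOn (fun x => max 0 (v x - m) ^ 2) (ball (0 : E) ρ) := by
    intro m ρ hρ
    refine IntegrableOn.mono_set ?_ ball_subset_closedBall
    refine ContinuousOn.integrableOn_compact (isCompact_closedBall 0 ρ) ?_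
    have : ContinuousOn v (closedBall 0 ρ) := hvc.mono (closedBall_subset_ball hρ)
    fun_prop
  have hmeas : volume.real S ≤ Q := by
    rw [hQ, le_div_iff₀ (by positivity)]
    calc volume.real S * d ^ 2 = ∫ x in S, d ^ 2 := by
          rw [setIntegral_const, smul_eq_mul]
      _ ≤ ∫ x in S, max 0 (v x - l) ^ 2 := by
        refine setIntegral_mono_on (integrableOn_const hSfin) ?_ hSm ?_
        · exact (hmint l hR1).mono_set (hSr.trans (ball_subset_ball hrR.le))
        · intro x hx
          exact pow_le_pow_left₀ hd.le (le_max_of_le_right (by linarith [hx.2])) 2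
      _ ≤ _ := by
        refine setIntegral_mono_set (hmint l hR1) (Eventually.of_forall fun x => sq_nonneg _) ?_
        exact (hSr.trans (ball_subset_ball hrR.le)).eventuallyLE
  have hfint : Integrable fun x => (ballCutoff R x * trunc d l (v x)) ^ 2 := by
    refine ((hη.continuous_mul hU htv).pow 2).integrable_of_hasCompactSupport ?_
    refine (hη.hasCompactSupport_mul fun x => trunc d l (v x)).mono fun x hx h0 => hx ?_
    exact (pow_eq_zero_iff two_ne_zero).2 h0
  have hlow : (R ^ 2 - r ^ 2) ^ 4 / 4 * ∫ x in ball (0 : E) r, max 0 (v x - (l + d)) ^ 2 ≤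
      ∫ x in S, (ballCutoff R x * trunc d l (v x)) ^ 2 := by
    have e1 : ∫ x in ball (0 : E) r, max 0 (v x - (l + d)) ^ 2 =
        ∫ x in S, max 0 (v x - (l + d)) ^ 2 := by
      refine setIntegral_eq_of_subset_of_forall_sdiff_eq_zero measurableSet_ball hSr ?_
      intro x hx
      have : v x - (l + d) ≤ 0 := by
        by_contra hh
        exact hx.2 ⟨hx.1, by linarith⟩
      simp [max_eq_left this]
    rw [e1, ← integral_const_mul]
    refine setIntegral_mono_on (((hmint (l + d) (hrR.trans hR1)).mono_set hSr).const_mul _)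
      hfint.integrableOn hSm ?_
    intro x hx
    have h1 := le_ballCutoff hr.le hrR.le hx.1
    have h2 := half_le_trunc (l := l) (s := v x) hd hx.2.le
    have h3 : 0 ≤ v x - (l + d) := by linarith [hx.2]
    rw [max_eq_right h3]
    calc (R ^ 2 - r ^ 2) ^ 4 / 4 * (v x - (l + d)) ^ 2 =
          ((R ^ 2 - r ^ 2) ^ 2 * ((v x - (l + d)) / 2)) ^ 2 := by ring
      _ ≤ _ := by
        have : (v x - (l + d)) / 2 ≤ trunc d l (v x) := by linarith
        have h0 := ballCutoff_nonneg R x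
        gcongr
  have hQpow : Q ^ (1 + 2 / n : ℝ) = Q ^ (2 / n : ℝ) * Q := by
    have hn0 : (0 : ℝ) < n := by positivity
    rw [Real.rpow_add_of_nonneg hQ0 zero_le_one (by positivity), Real.rpow_one, mul_comm]
  have hfin : (R ^ 2 - r ^ 2) ^ 4 / 4 * ∫ x in ball (0 : E) r, max 0 (v x - (l + d)) ^ 2 ≤
      CS * Q ^ (2 / n : ℝ) * (C2 * Q) := by
    refine hlow.trans (hFK.trans ?_)
    have : 0 ≤ volume.real S := measureReal_nonneg
    gcongr
  rw [hQpow]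
  linarith

/-- De Giorgi's lemma. -/
lemma SubSol.le_one_of_integral_le (hn : 3 ≤ n) {lam M b K : ℝ} (hlam : 0 < lam) (hM : 0 < M)
    (hb : 0 ≤ b) (hK : 0 ≤ K) :
    ∃ θ : ℝ, 0 < θ ∧ ∀ (v : E → ℝ) (H : E → E), SubSol lam M b K v H →
      ∫ x in ball (0 : E) (3 / 4), max 0 (v x) ^ 2 ≤ θ → ∀ x ∈ ball (0 : E) (1 / 2), v x ≤ 1 := by
  obtain ⟨C, hC, hrec⟩ := SubSol.step (n := n) hn hlam hM hb hK
  have hn0 : (0 : ℝ) < n := by positivity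
  have hn3 : (3 : ℝ) ≤ n := by exact_mod_cast hn
  obtain ⟨θ, q, hθ, hq0, hq1, hconv⟩ := fast_geometric_convergence
    (C := 2 ^ 12 * C * 4 ^ 2) (B := 2 ^ 4 * 4 ^ 2) (a := 2 / n) (by positivity) (by norm_num)
    (by positivity)
  refine ⟨θ, hθ, ?_⟩
  intro v H h hY0
  set R : ℕ → ℝ := fun j => 1 / 2 + (1 / 2) ^ (j + 2) with hR
  set l : ℕ → ℝ := fun j => 1 - (1 / 2) ^ j with hl
  set Y : ℕ → ℝ := fun j => ∫ x in ball (0 : E) (R j), max 0 (v x - l j) ^ 2 with hY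
  have hpow : ∀ j : ℕ, 0 < (1 / 2 : ℝ) ^ j := fun j => by positivity
  have hpow1 : ∀ j : ℕ, (1 / 2 : ℝ) ^ j ≤ 1 := fun j => pow_le_one₀ (by norm_num) (by norm_num)
  have hRlt : ∀ j, R j < 1 := fun j => by
    have := hpow1 j
    simp only [hR, pow_add]; linarith
  have hYnn : ∀ j, 0 ≤ Y j := fun j => integral_nonneg fun x => sq_nonneg _
  have hYle := hconv Y hYnn (by simpa [hY, hR, hl, show (1 / 2 + 1 / 4 : ℝ) = 3 / 4 by norm_num,
      show (2⁻¹ + (2 ^ 2)⁻¹ : ℝ) = 3 / 4 by norm_num] using hY0) (by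
    intro j
    set p := (1 / 2 : ℝ) ^ j with hp
    have hp0 : 0 < p := hpow j
    have e1 : l (j + 1) = l j + p / 2 := by simp only [hl, pow_succ]; ring
    have h1 := hrec v H h (l j) (p / 2) (R (j + 1)) (R j) (by positivity)
      (by linarith [hpow1 j]) (by simp only [hR]; positivity)
      (by simp only [hR, pow_succ]; linarith) (hRlt j)
    rw [← e1] at h1
    have h2 : p / 8 ≤ R j ^ 2 - R (j + 1) ^ 2 := by
      simp only [hR, pow_succ, ← hp]; nlinarith
    have h3 : (p / 8) ^ 4 * Y (j + 1) ≤ (R j ^ 2 - R (j + 1) ^ 2) ^ 4 * Y (j + 1) := by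
      gcongr
    have h4 := h3.trans h1
    have h5 : (Y j / (p / 2) ^ 2) ^ (1 + 2 / n : ℝ) ≤ (1 / (p / 2) ^ 2) ^ 2 *
        Y j ^ (1 + 2 / n : ℝ) := by
      rw [div_eq_mul_one_div, mul_comm, Real.mul_rpow (by positivity) (hYnn j)]
      refine mul_le_mul_of_nonneg_right ?_ (Real.rpow_nonneg (hYnn j) _)
      rw [← Real.rpow_two (1 / (p / 2) ^ 2)]
      refine Real.rpow_le_rpow_of_exponent_le ?_ ?_
      · rw [le_div_iff₀ (by positivity)]; nlinarith [hpow1 j]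
      · have : 2 / (n : ℝ) ≤ 1 := by rw [div_le_one hn0]; linarith
        linarith
    have h6 := h4.trans (mul_le_mul_of_nonneg_left h5 hC.le)
    have h7 : Y (j + 1) ≤ (8 / p) ^ 4 * (C * ((1 / (p / 2) ^ 2) ^ 2 * Y j ^ (1 + 2 / n : ℝ))) := by
      rw [div_pow, div_mul_eq_mul_div, le_div_iff₀ (by positivity)]
      rw [div_pow, div_mul_eq_mul_div, div_le_iff₀ (by positivity)] at h6
      linarith
    refine h7.trans_eq ?_
    have e2 : ((2 : ℝ) ^ 4 * 4 ^ 2) ^ j = (1 / p) ^ 8 := by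
      rw [hp, one_div, ← inv_pow, ← pow_mul, mul_comm j, pow_mul]; norm_num
    rw [e2]; field_simp; ring)
  have hvc := h.continuousOn
  have hsub : ball (0 : E) (1 / 2) ⊆ ball 0 1 := ball_subset_ball (by norm_num)
  have hmint : ∀ (m : ℝ) {ρ : ℝ}, ρ < 1 →
      IntegrableOn (fun x => max 0 (v x - m) ^ 2) (ball (0 : E) ρ) := by
    intro m ρ hρ
    refine IntegrableOn.mono_set ?_ ball_subset_closedBall
    refine ContinuousOn.integrableOn_compact (isCompact_closedBall 0 ρ) ?_
    have : ContinuousOn v (closedBall 0 ρ) := hvc.mono (closedBall_subset_ball hρ)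
    fun_prop
  have hle : ∀ j, ∫ x in ball (0 : E) (1 / 2), max 0 (v x - 1) ^ 2 ≤ Y j := by
    intro j
    calc _ ≤ ∫ x in ball (0 : E) (1 / 2), max 0 (v x - l j) ^ 2 := by
          refine setIntegral_mono (hmint 1 (by norm_num)) (hmint _ (by norm_num)) fun x => ?_
          refine pow_le_pow_left₀ (le_max_left _ _) (max_le_max le_rfl ?_) 2
          simp only [hl]; linarith [hpow j]
      _ ≤ _ := by
        refine setIntegral_mono_set (hmint _ (hRlt j)) (Eventually.of_forall fun x => sq_nonneg _) ?_
        refine (ball_subset_ball ?_).eventuallyLE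
        simp only [hR]; linarith [hpow (j + 2)]
  have hzero : ∫ x in ball (0 : E) (1 / 2), max 0 (v x - 1) ^ 2 = 0 := by
    refine le_antisymm ?_ (integral_nonneg fun x => sq_nonneg _)
    have hlim : Tendsto (fun j : ℕ => θ * q ^ j) atTop (𝓝 (θ * 0)) :=
      (tendsto_pow_atTop_nhds_zero_of_lt_one hq0.le hq1).const_mul θ
    rw [mul_zero] at hlim
    exact ge_of_tendsto' hlim fun j => (hle j).trans (hYle j)
  rw [setIntegral_eq_zero_iff_of_nonneg_ae (Eventually.of_forall fun x => sq_nonneg _)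
    (hmint 1 (by norm_num))] at hzero
  have hcont : ContinuousOn (fun x => max 0 (v x - 1) ^ 2) (ball (0 : E) (1 / 2)) := by
    have : ContinuousOn v (ball (0 : E) (1 / 2)) := hvc.mono hsub
    fun_prop
  have heq := Measure.eqOn_open_of_ae_eq hzero isOpen_ball hcont continuousOn_const
  intro x hx
  have h0 := heq hx
  simp only [Pi.zero_apply, ne_eq, OfNat.ofNat_ne_zero, not_false_eq_true, pow_eq_zero_iff] at h0
  have := le_max_right 0 (v x - 1)
  linarith

end Iteration

section Solution

variable {n : ℕ}

local notation "E" => EuclideanSpace ℝ (Fin n)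

/-- Nonnegative weak solutions `g` of `div F = 0`, where the flux `F` obeys the structure conditions
of a linear elliptic operator with drift at most `b`. -/
structure IsSol (lam M b : ℝ) (U : Set E) (g : E → ℝ) (F : E → E) : Prop where
  isOpen : IsOpen U
  nonneg : ∀ x ∈ U, 0 ≤ g x
  diff : ∀ x ∈ U, DifferentiableAt ℝ g x
  sq_int : LocallyIntegrableOn (fun x => ‖gradient g x‖ ^ 2) U
  meas : AEStronglyMeasurable F (volume.restrict U)
  bound : ∀ x ∈ U, ‖F x‖ ≤ M * ‖gradient g x‖ + b * g x
  ell : ∀ x ∈ U, lam * ‖gradient g x‖ ^ 2 - b * g x * ‖gradient g x‖ ≤ ⟪F x, gradient g x⟫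
  weak : ∀ (η : E → ℝ) (η' : E → E), IsCutoff U η η' →
    ∀ Φ Φ' : ℝ → ℝ, (∀ s, 0 ≤ s → HasDerivAt Φ (Φ' s) s) → ContinuousOn Φ' (Ici 0) →
    ∫ x, ⟪F x, Φ (g x) • η' x + (η x * Φ' (g x)) • gradient g x⟫ = 0

namespace IsSol

lemma continuousOn {lam M b : ℝ} {U : Set E} {g : E → ℝ} {F : E → E}
    (h : IsSol lam M b U g F) : ContinuousOn g U :=
  fun x hx => (h.diff x hx).continuousAt.continuousWithinAt

lemma mono {lam M b : ℝ} {U V : Set E} {g : E → ℝ} {F : E → E}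
    (h : IsSol lam M b U g F) (hV : IsOpen V) (hVU : V ⊆ U) : IsSol lam M b V g F where
  isOpen := hV
  nonneg x hx := h.nonneg x (hVU hx)
  diff x hx := h.diff x (hVU hx)
  sq_int := h.sq_int.mono_set hVU
  meas := h.meas.mono_measure (Measure.restrict_mono hVU le_rfl)
  bound x hx := h.bound x (hVU hx)
  ell x hx := h.ell x (hVU hx)
  weak η η' hη := h.weak η η' (hη.mono hVU)

lemma mono_drift {lam M b b' : ℝ} {U : Set E} {g : E → ℝ} {F : E → E}
    (h : IsSol lam M b U g F) (hb : b ≤ b') : IsSol lam M b' U g F where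
  isOpen := h.isOpen
  nonneg := h.nonneg
  diff := h.diff
  sq_int := h.sq_int
  meas := h.meas
  bound x hx := (h.bound x hx).trans (by have := h.nonneg x hx; gcongr)
  ell x hx := by
    refine le_trans ?_ (h.ell x hx)
    have := h.nonneg x hx
    gcongr
  weak := h.weak

lemma memLp {lam M b : ℝ} {U : Set E} {g : E → ℝ} {F : E → E} (h : IsSol lam M b U g F)
    {S : Set E} (hS : IsCompact S) (hSU : S ⊆ U) : MemLp F 2 (volume.restrict S) :=
  memLp_two_restrict_of_norm_le (f := fun x => b * g x) h.sq_int
    (continuousOn_const.mul h.continuousOn) h.meas h.bound hSU hS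

lemma integrable_inner {lam M b : ℝ} {U : Set E} {g : E → ℝ} {F : E → E} (h : IsSol lam M b U g F)
    {η : E → ℝ} {η' : E → E} (hη : IsCutoff U η η') {f k : E → ℝ} (hf : ContinuousOn f U)
    (hk : ContinuousOn k U) :
    Integrable fun x => ⟪F x, f x • η' x + (η x * k x) • gradient g x⟫ :=
  integrable_inner_of_tsupport_subset (h.memLp hη.compact.isCompact hη.supp)
    (hη.memLp_grad_mul h.isOpen hf hk h.sq_int) fun x hx => by
      simp [hη.grad_eq_zero hx, image_eq_zero_of_notMem_tsupport hx]

/-- Affine functions of solutions are subsolutions. -/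
lemma subSol_affine {lam M b : ℝ} (hb : 0 ≤ b) {g : E → ℝ} {F : E → E}
    (h : IsSol lam M b (ball 0 1) g F)
    {c a G : ℝ} (hc : 0 < c) (hG : ∀ x ∈ ball (0 : E) 1, c * g x ≤ G) :
    SubSol lam M (b * G) 0 (fun x => c * g x - a) (fun x => c • F x) := by
  have hgrad : ∀ x ∈ ball (0 : E) 1, HasGradientAt (fun x => c * g x - a) (c • gradient g x) x :=
    fun x hx => HasGradientAt.comp_deriv (Φ := fun s => c * s - a)
      (by simpa using ((hasDerivAt_id (g x)).const_mul c).sub_const a) (h.diff x hx).hasGradientAt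
  have hge : ∀ x ∈ ball (0 : E) 1, gradient (fun x => c * g x - a) x = c • gradient g x :=
    fun x hx => (hgrad x hx).gradient
  have hn : ∀ x, ‖c • gradient g x‖ = c * ‖gradient g x‖ := fun x => by
    rw [norm_smul, Real.norm_eq_abs, abs_of_pos hc]
  refine ⟨fun x hx => (hgrad x hx).differentiableAt, ?_, h.meas.const_smul c, ?_, ?_, ?_⟩
  · have h1 := h.sq_int.smul (c ^ 2)
    refine (locallyIntegrableOn_iff (isOpen_ball.isLocallyClosed)).2 fun k hk hkc => ?_
    refine (h1.integrableOn_compact_subset hk hkc).congr_fun ?_ hkc.measurableSet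
    intro x hx
    simp only [Pi.smul_apply, smul_eq_mul]
    rw [hge x (hk hx), hn, mul_pow]
  · intro x hx
    rw [hge x hx, hn, norm_smul, Real.norm_eq_abs, abs_of_pos hc]
    calc c * ‖F x‖ ≤ c * (M * ‖gradient g x‖ + b * g x) := by gcongr; exact h.bound x hx
      _ = M * (c * ‖gradient g x‖) + b * (c * g x) := by ring
      _ ≤ _ := by gcongr; exact hG x hx
  · intro x hx
    rw [hge x hx, hn, inner_smul_left, inner_smul_right]
    simp only [conj_trivial]
    have h1 := mul_le_mul_of_nonneg_left (h.ell x hx) (sq_nonneg c)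
    have h2 := mul_le_mul_of_nonneg_left (hG x hx)
      (mul_nonneg hb (mul_nonneg hc.le (norm_nonneg (gradient g x))))
    nlinarith
  · intro η η' hη hη0 Φ Φ' hΦ hΦ' hΦ0
    have hw := h.weak η η' hη (fun s => Φ (c * s - a)) (fun s => Φ' (c * s - a) * c)
      (fun s _ => (hΦ _).comp s (by simpa using ((hasDerivAt_id s).const_mul c).sub_const a))
      (by fun_prop)
    rw [zero_mul]
    refine le_of_eq ?_
    rw [show (0 : ℝ) = c * 0 by simp, ← hw, ← integral_const_mul]
    refine integral_congr_ae (Eventually.of_forall fun x => ?_)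
    by_cases hx : x ∈ tsupport η
    · simp only [hge x (hη.supp hx), inner_smul_left, inner_add_right, inner_smul_right,
        conj_trivial]
      ring
    · simp [hη.grad_eq_zero hx, image_eq_zero_of_notMem_tsupport hx]

/-- Logarithms of solutions are subsolutions up to a bounded right-hand side. -/
lemma subSol_log {lam M b : ℝ} (hlam : 0 < lam) (hb : 0 ≤ b) {g : E → ℝ} {F : E → E}
    (h : IsSol lam M b (ball 0 1) g F) {ε D : ℝ} (a : ℝ) (hε : 0 < ε) (hD : 1 ≤ D) :
    SubSol lam M b (b ^ 2 / (4 * lam)) (fun x => (a - Real.log (g x + ε)) / D)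
      (fun x => (-(D * (g x + ε))⁻¹) • F x) := by
  have hD0 : 0 < D := zero_lt_one.trans_le hD
  have hder : ∀ s : ℝ, 0 ≤ s →
      HasDerivAt (fun s => (a - Real.log (s + ε)) / D) (-(D * (s + ε))⁻¹) s := by
    intro s hs
    have h1 := ((((hasDerivAt_id s).add_const ε).log (by simp; positivity)).const_sub a).div_const D
    refine h1.congr_deriv ?_
    simp only [id]
    field_simp
  have hgrad : ∀ x ∈ ball (0 : E) 1, HasGradientAt (fun x => (a - Real.log (g x + ε)) / D)
      ((-(D * (g x + ε))⁻¹) • gradient g x) x :=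
    fun x hx => HasGradientAt.comp_deriv (hder _ (h.nonneg x hx)) (h.diff x hx).hasGradientAt
  have hge : ∀ x ∈ ball (0 : E) 1, gradient (fun x => (a - Real.log (g x + ε)) / D) x =
      (-(D * (g x + ε))⁻¹) • gradient g x := fun x hx => (hgrad x hx).gradient
  have hpos : ∀ x ∈ ball (0 : E) 1, 0 < g x + ε := fun x hx => by
    have := h.nonneg x hx; positivity
  have hn : ∀ x ∈ ball (0 : E) 1, ∀ w : E, ‖(-(D * (g x + ε))⁻¹) • w‖ = ‖w‖ / (D * (g x + ε)) := by
    intro x hx w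
    have := hpos x hx
    rw [norm_smul, norm_neg, norm_inv, Real.norm_eq_abs, abs_of_pos (by positivity), div_eq_inv_mul]
  have hgc := h.continuousOn
  have hgi : ContinuousOn (fun x => (g x + ε)⁻¹) (ball 0 1) :=
    (hgc.add continuousOn_const).inv₀ fun x hx => (hpos x hx).ne'
  have hDgi : ContinuousOn (fun x => (D * (g x + ε))⁻¹) (ball 0 1) :=
    (continuousOn_const.mul (hgc.add continuousOn_const)).inv₀ fun x hx =>
      (mul_pos hD0 (hpos x hx)).ne'
  have hvc : ContinuousOn (fun x => (a - Real.log (g x + ε)) / D) (ball 0 1) :=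
    fun x hx => (hgrad x hx).continuousAt.continuousWithinAt
  have hquot : ∀ x ∈ ball (0 : E) 1, g x / (D * (g x + ε)) ≤ 1 := by
    intro x hx
    have h1 := hpos x hx
    rw [div_le_one (by positivity)]
    nlinarith [h.nonneg x hx]
  have hell : ∀ x ∈ ball (0 : E) 1, lam * (‖gradient g x‖ / (g x + ε)) ^ 2 -
      b * (‖gradient g x‖ / (g x + ε)) ≤ ⟪F x, gradient g x⟫ / (g x + ε) ^ 2 := by
    intro x hx
    have h1 := hpos x hx
    have h2 : (lam * ‖gradient g x‖ ^ 2 - b * g x * ‖gradient g x‖) / (g x + ε) ^ 2 ≤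
        ⟪F x, gradient g x⟫ / (g x + ε) ^ 2 := by gcongr; exact h.ell x hx
    refine le_trans ?_ h2
    rw [sub_div, div_pow, mul_div_assoc]
    gcongr
    rw [← mul_div_assoc, div_le_div_iff₀ (by positivity) h1]
    have h4 : 0 ≤ b * ‖gradient g x‖ * (g x + ε) * ε := by positivity
    nlinarith
  refine ⟨fun x hx => (hgrad x hx).differentiableAt, ?_, ?_, ?_, ?_, ?_⟩
  · refine (locallyIntegrableOn_iff (isOpen_ball.isLocallyClosed)).2 fun k hk hkc => ?_
    have h1 := (h.sq_int.integrableOn_compact_subset hk hkc).continuousOn_mul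
      ((hDgi.mono hk).pow 2) hkc
    refine h1.congr_fun ?_ hkc.measurableSet
    intro x hx
    simp only
    rw [hge x (hk hx), hn x (hk hx)]
    simp only [Pi.pow_apply]
    ring
  · exact (hDgi.neg.aestronglyMeasurable measurableSet_ball).smul h.meas
  · intro x hx
    have h1 := hpos x hx
    rw [hge x hx, hn x hx, hn x hx]
    calc ‖F x‖ / (D * (g x + ε)) ≤ (M * ‖gradient g x‖ + b * g x) / (D * (g x + ε)) := by
          gcongr; exact h.bound x hx
      _ = M * (‖gradient g x‖ / (D * (g x + ε))) + b * (g x / (D * (g x + ε))) := by ring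
      _ ≤ _ := by
        have := mul_le_mul_of_nonneg_left (hquot x hx) hb
        linarith
  · intro x hx
    have h1 := hpos x hx
    rw [hge x hx, hn x hx, inner_smul_left, inner_smul_right]
    simp only [conj_trivial]
    have h2 := hell x hx
    have e1 : -(D * (g x + ε))⁻¹ * (-(D * (g x + ε))⁻¹ * ⟪F x, gradient g x⟫) =
      (⟪F x, gradient g x⟫ / (g x + ε) ^ 2) * (D⁻¹) ^ 2 := by field_simp
    have e2 : ‖gradient g x‖ / (D * (g x + ε)) = (‖gradient g x‖ / (g x + ε)) * D⁻¹ := by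
      field_simp
    rw [e1, e2]
    set X := ‖gradient g x‖ / (g x + ε)
    have hX : 0 ≤ X := by positivity
    have hDi : D⁻¹ ≤ 1 := inv_le_one_of_one_le₀ hD
    have hDi0 : 0 < D⁻¹ := by positivity
    have h3 := mul_le_mul_of_nonneg_right h2 (sq_nonneg D⁻¹)
    have h5 : 0 ≤ b * X * D⁻¹ * (1 - D⁻¹) :=
      mul_nonneg (by positivity) (sub_nonneg.2 hDi)
    nlinarith
  · intro η η' hη hη0 Φ Φ' hΦ hΦ' hΦ0
    have hΦc : Continuous Φ := continuous_iff_continuousAt.2 fun s => (hΦ s).continuousAt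
    have hlogc : ContinuousOn (fun s : ℝ => (a - Real.log (s + ε)) / D) (Ici 0) :=
      fun s hs => (hder s hs).continuousAt.continuousWithinAt
    have hsc : ∀ s ∈ Ici (0 : ℝ), s + ε ≠ 0 := fun s hs => by
      have : (0 : ℝ) ≤ s := hs
      positivity
    have hw := h.weak η η' hη (fun s => Φ ((a - Real.log (s + ε)) / D) * (s + ε)⁻¹)
      (fun s => (Φ' ((a - Real.log (s + ε)) / D) * -(D * (s + ε))⁻¹) * (s + ε)⁻¹ +
        Φ ((a - Real.log (s + ε)) / D) * (-1 / (s + ε) ^ 2))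
      (fun s hs => ((hΦ _).comp s (hder s hs)).mul
        (((hasDerivAt_id s).add_const ε).inv (hsc s hs)))
      (by
        have i1 : ContinuousOn (fun s : ℝ => (s + ε)⁻¹) (Ici 0) :=
          (by fun_prop : ContinuousOn (fun s : ℝ => s + ε) (Ici 0)).inv₀ hsc
        have i2 : ContinuousOn (fun s : ℝ => (D * (s + ε))⁻¹) (Ici 0) :=
          (by fun_prop : ContinuousOn (fun s : ℝ => D * (s + ε)) (Ici 0)).inv₀
            fun s hs => mul_ne_zero hD0.ne' (hsc s hs)
        have i3 : ContinuousOn (fun s : ℝ => -1 / (s + ε) ^ 2) (Ici 0) :=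
          continuousOn_const.div (by fun_prop) fun s hs => pow_ne_zero 2 (hsc s hs)
        exact (((hΦ'.comp_continuousOn hlogc).mul i2.neg).mul i1).add
          ((hΦc.comp_continuousOn hlogc).mul i3))
    set v : E → ℝ := fun x => (a - Real.log (g x + ε)) / D with hv
    have hfv : ContinuousOn (fun x => Φ (v x)) (ball 0 1) := hΦc.comp_continuousOn hvc
    have hfv' : ContinuousOn (fun x => Φ' (v x)) (ball 0 1) := hΦ'.comp_continuousOn hvc
    have hi3 : ContinuousOn (fun x => -1 / (g x + ε) ^ 2) (ball 0 1) :=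
      continuousOn_const.div ((hgc.add continuousOn_const).pow 2)
        fun x hx => pow_ne_zero 2 (hpos x hx).ne'
    have int0 : Integrable fun x => ⟪F x, (Φ (v x) * (g x + ε)⁻¹) • η' x +
        (η x * (Φ' (v x) * -(D * (g x + ε))⁻¹ * (g x + ε)⁻¹ +
          Φ (v x) * (-1 / (g x + ε) ^ 2))) • gradient g x⟫ :=
      h.integrable_inner hη (hfv.mul hgi) (((hfv'.mul hDgi.neg).mul hgi).add (hfv.mul hi3))
    have int1 := h.integrable_inner hη (hDgi.neg.mul hfv) (hDgi.neg.mul (hfv'.mul hDgi.neg))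
    have int2 : Integrable fun x => η x * Φ (v x) := hη.integrable_mul isOpen_ball hfv
    have e1 : ∀ x, ⟪(-(D * (g x + ε))⁻¹) • F x, Φ (v x) • η' x +
        (η x * Φ' (v x)) • gradient v x⟫ = ⟪F x, (-(D * (g x + ε))⁻¹ * Φ (v x)) • η' x +
        (η x * (-(D * (g x + ε))⁻¹ * (Φ' (v x) * -(D * (g x + ε))⁻¹))) • gradient g x⟫ := by
      intro x
      by_cases hx : x ∈ tsupport η
      · simp only [hge x (hη.supp hx), inner_smul_left, inner_add_right, inner_smul_right,
          conj_trivial]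
        ring
      · simp [hη.grad_eq_zero hx, image_eq_zero_of_notMem_tsupport hx]
    refine le_of_eq_of_le (integral_congr_ae (Eventually.of_forall e1)) ?_
    have hle : ∀ x, ⟪F x, (-(D * (g x + ε))⁻¹ * Φ (v x)) • η' x +
        (η x * (-(D * (g x + ε))⁻¹ * (Φ' (v x) * -(D * (g x + ε))⁻¹))) • gradient g x⟫ ≤
        (-D⁻¹) * ⟪F x, (Φ (v x) * (g x + ε)⁻¹) • η' x + (η x * (Φ' (v x) * -(D * (g x + ε))⁻¹ *
          (g x + ε)⁻¹ + Φ (v x) * (-1 / (g x + ε) ^ 2))) • gradient g x⟫ +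
        b ^ 2 / (4 * lam) * (η x * Φ (v x)) := by
      intro x
      by_cases hx : x ∈ tsupport η
      · have hx1 := hη.supp hx
        have h1 := hpos x hx1
        have h2 := hell x hx1
        simp only [inner_add_right, inner_smul_right]
        have h3 : -(b ^ 2 / (4 * lam)) ≤ ⟪F x, gradient g x⟫ / (g x + ε) ^ 2 := by
          refine le_trans ?_ h2
          set X := ‖gradient g x‖ / (g x + ε)
          have e3 : lam * X ^ 2 - b * X + b ^ 2 / (4 * lam) =
            (2 * lam * X - b) ^ 2 / (4 * lam) := by field_simp; ring
          have : 0 ≤ (2 * lam * X - b) ^ 2 / (4 * lam) := by positivity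
          linarith
        have hDi : D⁻¹ ≤ 1 := inv_le_one_of_one_le₀ hD
        have hDi0 : 0 < D⁻¹ := by positivity
        have hK : 0 ≤ b ^ 2 / (4 * lam) := by positivity
        have h4 : 0 ≤ D⁻¹ * (⟪F x, gradient g x⟫ / (g x + ε) ^ 2) + b ^ 2 / (4 * lam) := by
          nlinarith
        have h5 := mul_nonneg (mul_nonneg (hη0 x) (hΦ0 (v x))) h4
        rw [mul_inv]
        generalize ⟪F x, gradient g x⟫ = p at *
        generalize ⟪F x, η' x⟫ = q at *
        rw [show p / (g x + ε) ^ 2 = p * ((g x + ε)⁻¹) ^ 2 by rw [inv_pow]; rfl] at h5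
        rw [show -1 / (g x + ε) ^ 2 = -((g x + ε)⁻¹) ^ 2 by rw [inv_pow]; field_simp]
        linarith
      · simp [hη.grad_eq_zero hx, image_eq_zero_of_notMem_tsupport hx]
    have hI := integral_mono int1 ((int0.const_mul (-D⁻¹)).add (int2.const_mul _)) hle
    simp only [Pi.add_apply] at hI
    rw [integral_add (int0.const_mul (-D⁻¹)) (int2.const_mul _), integral_const_mul,
      integral_const_mul] at hI
    have hw' : ∫ x, ⟪F x, (Φ (v x) * (g x + ε)⁻¹) • η' x + (η x * (Φ' (v x) * -(D * (g x + ε))⁻¹ *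
          (g x + ε)⁻¹ + Φ (v x) * (-1 / (g x + ε) ^ 2))) • gradient g x⟫ = 0 := hw
    rw [hw', mul_zero, zero_add] at hI
    exact hI

/-- Logarithmic energy estimate. -/
lemma integral_log_le {lam M b : ℝ} (hlam : 0 < lam) (hM : 0 < M) (hb : 0 ≤ b) {U : Set E}
    {g : E → ℝ} {F : E → E} (h : IsSol lam M b U g F) {ε : ℝ} (hε : 0 < ε)
    {η : E → ℝ} {η' : E → E} (hη : IsCutoff U η η') (hη0 : ∀ x, 0 ≤ η x) :
    Integrable (fun x => η x ^ 2 * (‖gradient g x‖ / (g x + ε)) ^ 2) ∧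
    lam / 2 * ∫ x, η x ^ 2 * (‖gradient g x‖ / (g x + ε)) ^ 2 ≤
      ∫ x, ((4 * M ^ 2 / lam + 1) * ‖η' x‖ ^ 2 + (b ^ 2 / lam + b ^ 2) * η x ^ 2) := by
  have hpos : ∀ x ∈ U, 0 < g x + ε := fun x hx => by
    have := h.nonneg x hx; positivity
  have hgc := h.continuousOn
  have hgi : ContinuousOn (fun x => (g x + ε)⁻¹) U :=
    (hgc.add continuousOn_const).inv₀ fun x hx => (hpos x hx).ne'
  have hi3 : ContinuousOn (fun x => -1 / (g x + ε) ^ 2) U :=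
    continuousOn_const.div ((hgc.add continuousOn_const).pow 2)
      fun x hx => pow_ne_zero 2 (hpos x hx).ne'
  have hsc : ∀ s ∈ Ici (0 : ℝ), s + ε ≠ 0 := fun s hs => by
    have : (0 : ℝ) ≤ s := hs
    positivity
  have hw := h.weak _ _ hη.sq (fun s => (s + ε)⁻¹) (fun s => -1 / (s + ε) ^ 2)
    (fun s hs => ((hasDerivAt_id s).add_const ε).inv (hsc s hs))
    (continuousOn_const.div (by fun_prop) fun s hs => pow_ne_zero 2 (hsc s hs))
  have int0 := h.integrable_inner hη.sq hgi hi3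
  have int1 : Integrable fun x => η x ^ 2 * (‖gradient g x‖ / (g x + ε)) ^ 2 := by
    have := hη.sq.integrable_mul_mul h.isOpen (hgi.pow 2) h.sq_int
    refine this.congr (Eventually.of_forall fun x => ?_)
    simp only [Pi.pow_apply]
    ring
  have int2 : Integrable fun x => (4 * M ^ 2 / lam + 1) * ‖η' x‖ ^ 2 +
      (b ^ 2 / lam + b ^ 2) * η x ^ 2 := by
    refine Integrable.add (Integrable.const_mul ?_ _) (Integrable.const_mul ?_ _)
    · simpa using hη.integrable_norm_grad_sq_mul h.isOpen (f := fun _ => 1) continuousOn_const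
    · simpa using hη.sq.integrable_mul h.isOpen (f := fun _ => 1) continuousOn_const
  refine ⟨int1, ?_⟩
  have hle : ∀ x, lam / 2 * (η x ^ 2 * (‖gradient g x‖ / (g x + ε)) ^ 2) ≤
      (-1) * ⟪F x, (g x + ε)⁻¹ • (2 * η x) • η' x +
        (η x ^ 2 * (-1 / (g x + ε) ^ 2)) • gradient g x⟫ +
      ((4 * M ^ 2 / lam + 1) * ‖η' x‖ ^ 2 + (b ^ 2 / lam + b ^ 2) * η x ^ 2) := by
    intro x
    by_cases hx : x ∈ tsupport η
    · have hx1 := hη.supp hx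
      have h1 := hpos x hx1
      have hgx := h.nonneg x hx1
      have hgq : g x / (g x + ε) ≤ 1 := by rw [div_le_one h1]; linarith
      set X := ‖gradient g x‖ / (g x + ε) with hX
      have hp : |-(⟪F x, η' x⟫ / (g x + ε))| ≤ (M * X + b) * ‖η' x‖ := by
        rw [abs_neg, abs_div, abs_of_pos h1, div_le_iff₀ h1]
        calc |⟪F x, η' x⟫| ≤ ‖F x‖ * ‖η' x‖ := abs_real_inner_le_norm _ _
          _ ≤ (M * ‖gradient g x‖ + b * g x) * ‖η' x‖ := by gcongr; exact h.bound x hx1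
          _ ≤ (M * ‖gradient g x‖ + b * (g x + ε)) * ‖η' x‖ := by gcongr; linarith
          _ = _ := by rw [hX]; field_simp
      have ha : lam * X ^ 2 - b * X ≤ ⟪F x, gradient g x⟫ / (g x + ε) ^ 2 := by
        rw [le_div_iff₀ (by positivity)]
        refine le_trans ?_ (h.ell x hx1)
        have e1 : (lam * X ^ 2 - b * X) * (g x + ε) ^ 2 =
            lam * ‖gradient g x‖ ^ 2 - b * (g x + ε) * ‖gradient g x‖ := by rw [hX]; field_simp
        rw [e1]
        gcongr
        linarith
      have key := caccioppoli_pointwise (t := 1) (τ := 1) (D := 1) hlam hM hb (hη0 x)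
        (norm_nonneg (η' x)) (by positivity : 0 ≤ X) zero_le_one zero_le_one zero_le_one
        (by norm_num) hp ha
      simp only [inner_add_right, inner_smul_right]
      have e2 : -1 * ((g x + ε)⁻¹ * (2 * η x * ⟪F x, η' x⟫) +
          η x ^ 2 * (-1 / (g x + ε) ^ 2) * ⟪F x, gradient g x⟫) =
          2 * η x * 1 * -(⟪F x, η' x⟫ / (g x + ε)) +
          η x ^ 2 * 1 * (⟪F x, gradient g x⟫ / (g x + ε) ^ 2) := by ring
      rw [e2]
      linarith
    · simp [hη.grad_eq_zero hx, image_eq_zero_of_notMem_tsupport hx]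
  have hI := integral_mono (int1.const_mul (lam / 2)) ((int0.const_mul (-1)).add int2) hle
  simp only [Pi.add_apply] at hI
  rw [integral_add (int0.const_mul (-1)) int2, integral_const_mul, integral_const_mul] at hI
  have hw' : ∫ x, ⟪F x, (g x + ε)⁻¹ • (2 * η x) • η' x +
        (η x ^ 2 * (-1 / (g x + ε) ^ 2)) • gradient g x⟫ = 0 := hw
  rw [hw', mul_zero, zero_add] at hI
  exact hI

end IsSol

end Solution

section Scaling

variable {n : ℕ}

local notation "E" => EuclideanSpace ℝ (Fin n)

/-- The dilation `ξ ↦ x₀ + ρ ξ` as a homeomorphism. -/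
def dilation (x₀ : E) {ρ : ℝ} (hρ : ρ ≠ 0) : E ≃ₜ E :=
  (Homeomorph.smulOfNeZero ρ hρ).trans (Homeomorph.addLeft x₀)

lemma dilation_apply (x₀ : E) {ρ : ℝ} (hρ : ρ ≠ 0) (ξ : E) : dilation x₀ hρ ξ = x₀ + ρ • ξ := rfl

lemma dilation_symm_apply (x₀ : E) {ρ : ℝ} (hρ : ρ ≠ 0) (x : E) :
    (dilation x₀ hρ).symm x = ρ⁻¹ • (x - x₀) := by
  rw [Homeomorph.symm_apply_eq, dilation_apply, smul_smul, mul_inv_cancel₀ hρ, one_smul]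
  abel

lemma dist_dilation (x₀ : E) {ρ : ℝ} (hρ : 0 < ρ) (ξ ζ : E) :
    dist (dilation x₀ hρ.ne' ξ) (dilation x₀ hρ.ne' ζ) = ρ * dist ξ ζ := by
  rw [dilation_apply, dilation_apply, dist_add_left, dist_smul₀, Real.norm_eq_abs, abs_of_pos hρ]

lemma dilation_preimage_ball (x₀ : E) {ρ : ℝ} (hρ : 0 < ρ) (r : ℝ) :
    dilation x₀ hρ.ne' ⁻¹' ball x₀ (ρ * r) = ball 0 r := by
  ext ξ
  have h0 : dilation x₀ hρ.ne' 0 = x₀ := by simp [dilation_apply]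
  have h1 := dist_dilation x₀ hρ ξ 0
  rw [h0] at h1
  rw [mem_preimage, mem_ball, mem_ball, h1]
  exact mul_lt_mul_iff_right₀ hρ

lemma map_dilation (x₀ : E) {ρ : ℝ} (hρ : ρ ≠ 0) :
    Measure.map (dilation x₀ hρ) (volume : Measure E) =
      ENNReal.ofReal |(ρ ^ n)⁻¹| • (volume : Measure E) := by
  have h1 : (dilation x₀ hρ : E → E) = (fun x => x₀ + x) ∘ fun x => ρ • x := rfl
  rw [h1, ← Measure.map_map (by fun_prop) (by fun_prop), Measure.map_addHaar_smul _ hρ,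
    Measure.map_smul, map_add_left_eq_self, finrank_euclideanSpace_fin]

lemma integral_comp_dilation (x₀ : E) {ρ : ℝ} (hρ : 0 < ρ) (f : E → ℝ) :
    ∫ ξ, f (dilation x₀ hρ.ne' ξ) = (ρ ^ n)⁻¹ * ∫ x, f x := by
  rw [← (dilation x₀ hρ.ne').measurableEmbedding.integral_map, map_dilation,
    integral_smul_measure, ENNReal.toReal_ofReal (abs_nonneg _), abs_of_pos (by positivity),
    smul_eq_mul]

lemma measureReal_dilation_preimage (x₀ : E) {ρ : ℝ} (hρ : 0 < ρ) (S : Set E) :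
    volume.real (dilation x₀ hρ.ne' ⁻¹' S) = (ρ ^ n)⁻¹ * volume.real S := by
  rw [measureReal_def, ← (dilation x₀ hρ.ne').measurableEmbedding.map_apply, map_dilation,
    Measure.smul_apply, smul_eq_mul, ENNReal.toReal_mul, ENNReal.toReal_ofReal (abs_nonneg _),
    abs_of_pos (by positivity), measureReal_def]

lemma hasGradientAt_comp_dilation (x₀ : E) {ρ : ℝ} (hρ : ρ ≠ 0) {g : E → ℝ} {w ξ : E}
    (h : HasGradientAt g w (dilation x₀ hρ ξ)) :
    HasGradientAt (fun ξ => g (dilation x₀ hρ ξ)) (ρ • w) ξ := by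
  have h1 : HasFDerivAt (fun ξ : E => x₀ + ρ • ξ) (ρ • ContinuousLinearMap.id ℝ E) ξ :=
    ((hasFDerivAt_id ξ).const_smul ρ).const_add x₀
  have h2 := h.hasFDerivAt.comp ξ h1
  rw [hasGradientAt_iff_hasFDerivAt]
  refine h2.congr_fderiv ?_
  ext v
  simp [inner_smul_left, inner_smul_right]

lemma hasGradientAt_comp_dilation_symm (x₀ : E) {ρ : ℝ} (hρ : ρ ≠ 0) {g : E → ℝ} {w x : E}
    (h : HasGradientAt g w ((dilation x₀ hρ).symm x)) :
    HasGradientAt (fun x => g ((dilation x₀ hρ).symm x)) (ρ⁻¹ • w) x := by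
  have h1 : HasFDerivAt (fun x : E => ρ⁻¹ • (x - x₀)) (ρ⁻¹ • ContinuousLinearMap.id ℝ E) x :=
    ((hasFDerivAt_id x).sub_const x₀).const_smul ρ⁻¹
  simp only [dilation_symm_apply] at h ⊢
  have h2 := HasFDerivAt.comp x h.hasFDerivAt h1
  rw [hasGradientAt_iff_hasFDerivAt]
  refine h2.congr_fderiv ?_
  ext v
  simp [inner_smul_left, inner_smul_right]

lemma IsCutoff.comp_dilation_symm (x₀ : E) {ρ : ℝ} (hρ : ρ ≠ 0) {U : Set E} {η : E → ℝ}
    {η' : E → E} (hη : IsCutoff (dilation x₀ hρ ⁻¹' U) η η') :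
    IsCutoff U (fun x => η ((dilation x₀ hρ).symm x))
      (fun x => ρ⁻¹ • η' ((dilation x₀ hρ).symm x)) where
  grad x := hasGradientAt_comp_dilation_symm x₀ hρ (hη.grad _)
  cont := by
    have h1 : Continuous fun x => η' ((dilation x₀ hρ).symm x) :=
      hη.cont.comp (dilation x₀ hρ).symm.continuous
    exact h1.const_smul ρ⁻¹
  compact := hη.compact.comp_homeomorph _
  supp := by
    have := tsupport_comp_eq_preimage η (dilation x₀ hρ).symm
    rw [Function.comp_def] at this
    rw [this]
    intro x hx
    simpa using hη.supp hx

lemma IsSol.comp_dilation (x₀ : E) {ρ : ℝ} (hρ : 0 < ρ) {lam M b : ℝ} {U : Set E}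
    {g : E → ℝ} {F : E → E} (h : IsSol lam M b U g F) :
    IsSol lam M (ρ * b) (dilation x₀ hρ.ne' ⁻¹' U) (fun ξ => g (dilation x₀ hρ.ne' ξ))
      (fun ξ => ρ • F (dilation x₀ hρ.ne' ξ)) := by
  set T := dilation x₀ hρ.ne' with hT
  have hgrad : ∀ ξ ∈ T ⁻¹' U, HasGradientAt (fun ξ => g (T ξ)) (ρ • gradient g (T ξ)) ξ :=
    fun ξ hξ => hasGradientAt_comp_dilation x₀ hρ.ne' (h.diff _ hξ).hasGradientAt
  have hge : ∀ ξ ∈ T ⁻¹' U, gradient (fun ξ => g (T ξ)) ξ = ρ • gradient g (T ξ) :=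
    fun ξ hξ => (hgrad ξ hξ).gradient
  have hn : ∀ w : E, ‖ρ • w‖ = ρ * ‖w‖ := fun w => by
    rw [norm_smul, Real.norm_eq_abs, abs_of_pos hρ]
  have hTU : IsOpen (T ⁻¹' U) := h.isOpen.preimage T.continuous
  have hmap : Measure.map T (volume : Measure E) = _ := map_dilation x₀ hρ.ne'
  refine ⟨hTU, fun ξ hξ => h.nonneg _ hξ, fun ξ hξ => (hgrad ξ hξ).differentiableAt,
    ?_, ?_, ?_, ?_, ?_⟩
  · refine (locallyIntegrableOn_iff hTU.isLocallyClosed).2 fun k hk hkc => ?_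
    have h1 : IntegrableOn (fun x => ‖gradient g x‖ ^ 2) (T '' k) :=
      h.sq_int.integrableOn_compact_subset (image_subset_iff.2 hk) (hkc.image T.continuous)
    have h2 : IntegrableOn (fun x => ‖gradient g x‖ ^ 2) (T '' k) (Measure.map T volume) := by
      rw [hmap, IntegrableOn, Measure.restrict_smul]
      exact h1.smul_measure ENNReal.ofReal_ne_top
    rw [T.measurableEmbedding.integrableOn_map_iff, preimage_image_eq k T.injective] at h2
    refine IntegrableOn.congr_fun (h2.const_mul (ρ ^ 2)) (fun ξ hξ => ?_) hkc.measurableSet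
    simp only [Function.comp]
    rw [hge ξ (hk hξ), hn, mul_pow]
  · have h2 : AEStronglyMeasurable F ((Measure.map T volume).restrict U) := by
      rw [hmap, Measure.restrict_smul]
      exact h.meas.smul_measure _
    rw [T.measurableEmbedding.restrict_map, T.measurableEmbedding.aestronglyMeasurable_map_iff]
      at h2
    exact h2.const_smul ρ
  · intro ξ hξ
    rw [hge ξ hξ, hn, hn]
    have := mul_le_mul_of_nonneg_left (h.bound _ hξ) hρ.le
    linarith
  · intro ξ hξ
    rw [hge ξ hξ, hn, inner_smul_left, inner_smul_right]
    simp only [conj_trivial]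
    have := mul_le_mul_of_nonneg_left (h.ell _ hξ) (sq_nonneg ρ)
    linarith
  · intro η η' hη Φ Φ' hΦ hΦ'
    have hw := h.weak _ _ (hη.comp_dilation_symm x₀ hρ.ne') Φ Φ' hΦ hΦ'
    have h1 := integral_comp_dilation x₀ hρ (fun x => ⟪F x, Φ (g x) • ρ⁻¹ • η' (T.symm x) +
      (η (T.symm x) * Φ' (g x)) • gradient g x⟫)
    rw [← hT] at h1
    rw [hw, mul_zero] at h1
    rw [show (0 : ℝ) = ρ ^ 2 * 0 by simp, ← h1, ← integral_const_mul]
    refine integral_congr_ae (Eventually.of_forall fun ξ => ?_)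
    by_cases hx : ξ ∈ tsupport η
    · simp only [hge ξ (hη.supp hx), Homeomorph.symm_apply_apply, inner_smul_left,
        inner_add_right, inner_smul_right, conj_trivial]
      field_simp
    · simp [hη.grad_eq_zero hx, image_eq_zero_of_notMem_tsupport hx]

end Scaling

section Poincare

variable {n : ℕ}

local notation "E" => EuclideanSpace ℝ (Fin n)

lemma lintegral_comp_dilation (x₀ : E) {ρ : ℝ} (hρ : 0 < ρ) (f : E → ℝ≥0∞) :
    ∫⁻ ξ, f (dilation x₀ hρ.ne' ξ) = ENNReal.ofReal ((ρ ^ n)⁻¹) * ∫⁻ x, f x := by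
  rw [← (dilation x₀ hρ.ne').measurableEmbedding.lintegral_map, map_dilation,
    lintegral_smul_measure, abs_of_pos (by positivity), smul_eq_mul]

lemma lintegral_comp_add_smul_le (a : E) {t : ℝ} (ht : 1 / 2 ≤ t) (G : E → ℝ≥0∞) :
    ∫⁻ y, G (a + t • y) ≤ 2 ^ n * ∫⁻ x, G x := by
  have ht0 : 0 < t := by linarith
  have h1 := lintegral_comp_dilation a ht0 G
  simp only [dilation_apply] at h1
  rw [h1]
  gcongr
  have h2 : (t ^ n)⁻¹ ≤ (2 : ℝ) ^ n := by
    rw [← inv_pow]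
    gcongr
    rw [inv_le_comm₀ ht0 two_pos]
    linarith
  calc ENNReal.ofReal ((t ^ n)⁻¹) ≤ ENNReal.ofReal (2 ^ n) := ENNReal.ofReal_le_ofReal h2
    _ = 2 ^ n := by rw [ENNReal.ofReal_pow two_pos.le]; norm_num

/-- The fundamental theorem of calculus followed by the Cauchy-Schwarz inequality. -/
lemma ofReal_sq_sub_le_lintegral {f f' : ℝ → ℝ} (hf : ∀ t ∈ Icc (0 : ℝ) 1, HasDerivAt f (f' t) t)
    (hm : AEStronglyMeasurable f' (volume.restrict (Ioc 0 1))) :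
    ENNReal.ofReal ((f 1 - f 0) ^ 2) ≤ ∫⁻ t in Ioc (0 : ℝ) 1, ENNReal.ofReal (f' t ^ 2) := by
  by_cases hfin : ∫⁻ t in Ioc (0 : ℝ) 1, ENNReal.ofReal (f' t ^ 2) = ⊤
  · rw [hfin]; exact le_top
  have hsq : Integrable (fun t => f' t ^ 2) (volume.restrict (Ioc 0 1)) :=
    ⟨hm.pow 2, by
      rw [hasFiniteIntegral_iff_ofReal (Eventually.of_forall fun t => sq_nonneg _)]
      exact lt_top_iff_ne_top.2 hfin⟩
  have hmint : Integrable f' (volume.restrict (Ioc 0 1)) :=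
    ((memLp_two_iff_integrable_sq hm).2 hsq).integrable (by norm_num)
  have hftc : ∫ t in (0 : ℝ)..1, f' t = f 1 - f 0 :=
    intervalIntegral.integral_eq_sub_of_hasDerivAt
      (fun t ht => hf t (by rwa [uIcc_of_le zero_le_one] at ht))
      (by rwa [intervalIntegrable_iff_integrableOn_Ioc_of_le zero_le_one])
  rw [intervalIntegral.integral_of_le zero_le_one] at hftc
  rw [← ofReal_integral_eq_lintegral_ofReal hsq (Eventually.of_forall fun t => sq_nonneg _),
    ← hftc]
  apply ENNReal.ofReal_le_ofReal
  set c := ∫ t in Ioc (0 : ℝ) 1, f' t with hc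
  have hmass : (volume : Measure ℝ).real (Ioc 0 1) = 1 := by simp
  have h0 : 0 ≤ ∫ t in Ioc (0 : ℝ) 1, (f' t - c) ^ 2 := integral_nonneg fun t => sq_nonneg _
  have h1 : ∫ t in Ioc (0 : ℝ) 1, (f' t - c) ^ 2 =
      ∫ t in Ioc (0 : ℝ) 1, (f' t ^ 2 - 2 * c * f' t + c ^ 2) :=
    integral_congr_ae (Eventually.of_forall fun t => by ring)
  have hlin : Integrable (fun t => f' t ^ 2 - 2 * c * f' t) (volume.restrict (Ioc 0 1)) :=
    hsq.sub (hmint.const_mul (2 * c))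
  rw [h1, integral_add hlin (integrable_const _), integral_sub hsq (hmint.const_mul _), integral_const_mul, setIntegral_const, hmass] at h0
  simp only [one_smul] at h0
  nlinarith

lemma lintegral_convexCombination_le {S : Set E} {G : E → ℝ≥0∞} (hG : Measurable G) {t : ℝ} :
    ∫⁻ x in S, ∫⁻ y in S, G (x + t • (y - x)) ≤ volume S * (2 ^ n * ∫⁻ x, G x) := by
  have key : ∀ s : ℝ, 1 / 2 ≤ s →
      ∫⁻ x in S, ∫⁻ y in S, G (x + s • (y - x)) ≤ volume S * (2 ^ n * ∫⁻ x, G x) := by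
    intro s hs
    calc ∫⁻ x in S, ∫⁻ y in S, G (x + s • (y - x))
        ≤ ∫⁻ x in S, 2 ^ n * ∫⁻ x, G x := by
          refine lintegral_mono fun x => (setLIntegral_le_lintegral _ _).trans ?_
          have := lintegral_comp_add_smul_le (x - s • x) hs G
          refine le_trans (le_of_eq ?_) this
          congr 1
          ext y
          congr 1
          rw [smul_sub]
          abel
      _ = _ := by rw [setLIntegral_const, mul_comm]
  rcases le_total (1 / 2) t with ht | ht
  · exact key t ht
  · refine le_trans (le_of_eq ?_) (key (1 - t) (by linarith))
    rw [lintegral_lintegral_swap (by fun_prop)]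
    refine lintegral_congr fun y => lintegral_congr fun x => ?_
    congr 1
    module

/-- A Poincaré inequality on bounded convex sets, for functions which are nonpositive on a subset
of positive measure. -/
lemma measure_mul_lintegral_posPart_le {S : Set E} (hS : Convex ℝ S) (hSo : IsOpen S)
    (hS1 : S ⊆ ball 0 1) {w : E → ℝ} (hw : ∀ x ∈ S, DifferentiableAt ℝ w x) :
    volume {x ∈ S | w x ≤ 0} * ∫⁻ x in S, ENNReal.ofReal (max 0 (w x) ^ 2) ≤
      4 * (volume S * (2 ^ n * ∫⁻ x in S, ENNReal.ofReal (‖gradient w x‖ ^ 2))) := by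
  set K := {x ∈ S | w x ≤ 0} with hKdef
  have hKS : K ⊆ S := sep_subset _ _
  have hKm : MeasurableSet K := by
    have h1 : IsOpen (S ∩ w ⁻¹' Ioi 0) :=
      ContinuousOn.isOpen_inter_preimage
        (fun x hx => (hw x hx).continuousAt.continuousWithinAt) hSo isOpen_Ioi
    have h2 : K = S \ (S ∩ w ⁻¹' Ioi 0) := by
      ext x
      simp only [hKdef, mem_ofPred_eq, Set.mem_sdiff, mem_inter_iff, mem_preimage, mem_Ioi, not_and,
        not_lt]
      tauto
    rw [h2]
    exact hSo.measurableSet.diff h1.measurableSet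
  set G : E → ℝ≥0∞ := S.indicator fun x => ENNReal.ofReal (‖gradient w x‖ ^ 2) with hGdef
  have hG : Measurable G :=
    ((measurable_gradient w).norm.pow_const 2).ennreal_ofReal.indicator hSo.measurableSet
  have hGS : ∫⁻ x, G x = ∫⁻ x in S, ENNReal.ofReal (‖gradient w x‖ ^ 2) :=
    lintegral_indicator hSo.measurableSet _
  have hseg : ∀ x ∈ S, ∀ y ∈ S, ∀ t ∈ Icc (0 : ℝ) 1, x + t • (y - x) ∈ S := by
    intro x hx y hy t ht
    exact hS.add_smul_sub_mem hx hy ht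
  have hpt : ∀ x ∈ S, ∀ y ∈ S, ENNReal.ofReal ((w y - w x) ^ 2) ≤
      4 * ∫⁻ t in Ioc (0 : ℝ) 1, G (x + t • (y - x)) := by
    intro x hx y hy
    have hder : ∀ t ∈ Icc (0 : ℝ) 1, HasDerivAt (fun t => w (x + t • (y - x)))
        ⟪gradient w (x + t • (y - x)), y - x⟫ t := by
      intro t ht
      have h1 : HasDerivAt (fun t : ℝ => x + t • (y - x)) (y - x) t := by
        simpa using ((hasDerivAt_id t).smul_const (y - x)).const_add x
      have h2 := (hw _ (hseg x hx y hy t ht)).hasGradientAt.hasFDerivAt.comp_hasDerivAt t h1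
      exact h2.congr_deriv (by simp)
    have h3 := ofReal_sq_sub_le_lintegral hder
      (by
        have : Measurable fun t : ℝ => gradient w (x + t • (y - x)) :=
          (measurable_gradient w).comp (by fun_prop)
        exact (this.inner_const (c := y - x)).aestronglyMeasurable)
    simp only [one_smul, zero_smul, add_zero, add_sub_cancel] at h3
    refine h3.trans ?_
    have hGt : Measurable fun t : ℝ => G (x + t • (y - x)) := hG.comp (by fun_prop)
    rw [← lintegral_const_mul _ hGt]
    refine setLIntegral_mono' measurableSet_Ioc fun t ht => ?_
    rw [hGdef, indicator_of_mem (hseg x hx y hy t ⟨ht.1.le, ht.2⟩),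
      show (4 : ℝ≥0∞) = ENNReal.ofReal 4 by norm_num, ← ENNReal.ofReal_mul (by norm_num)]
    apply ENNReal.ofReal_le_ofReal
    have hxy : ‖y - x‖ ≤ 2 := by
      have h5 := mem_ball_zero_iff.1 (hS1 hx)
      have h6 := mem_ball_zero_iff.1 (hS1 hy)
      linarith [norm_sub_le y x]
    have h4 := abs_real_inner_le_norm (gradient w (x + t • (y - x))) (y - x)
    rw [← sq_abs]
    calc |⟪gradient w (x + t • (y - x)), y - x⟫| ^ 2
        ≤ (‖gradient w (x + t • (y - x))‖ * 2) ^ 2 := by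
          gcongr
          exact h4.trans (by gcongr)
      _ = _ := by ring
  calc volume K * ∫⁻ x in S, ENNReal.ofReal (max 0 (w x) ^ 2)
      ≤ ∫⁻ x in S, volume K * ENNReal.ofReal (max 0 (w x) ^ 2) := lintegral_const_mul_le _ _
    _ ≤ ∫⁻ x in S, ∫⁻ y in S, 4 * ∫⁻ t in Ioc (0 : ℝ) 1, G (x + t • (y - x)) := by
        refine setLIntegral_mono' hSo.measurableSet fun x hx => ?_
        rw [mul_comm, ← setLIntegral_const]
        refine le_trans ?_ (lintegral_mono_set hKS)
        refine setLIntegral_mono' hKm fun y hy => ?_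
        refine le_trans (ENNReal.ofReal_le_ofReal ?_) (hpt x hx y (hKS hy))
        have hy0 : w y ≤ 0 := hy.2
        rcases le_total 0 (w x) with h0 | h0
        · rw [max_eq_right h0]
          nlinarith
        · rw [max_eq_left h0]
          nlinarith [sq_nonneg (w y - w x)]
    _ = 4 * ∫⁻ t in Ioc (0 : ℝ) 1, ∫⁻ x in S, ∫⁻ y in S, G (x + t • (y - x)) := by
        have hxt : Measurable fun p : E × ℝ => ∫⁻ y in S, G (p.1 + p.2 • (y - p.1)) :=
          (hG.comp (by fun_prop : Measurable fun q : (E × ℝ) × E =>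
            q.1.1 + q.1.2 • (q.2 - q.1.1))).lintegral_prod_right'
        rw [lintegral_lintegral_swap (f := fun t x => ∫⁻ y in S, G (x + t • (y - x)))
          (hxt.comp measurable_swap).aemeasurable, ← lintegral_const_mul _ (hxt.lintegral_prod_right')]
        refine lintegral_congr fun x => ?_
        have hyt : Measurable fun p : E × ℝ => G (x + p.2 • (p.1 - x)) := hG.comp (by fun_prop)
        rw [lintegral_const_mul _ hyt.lintegral_prod_right',
          lintegral_lintegral_swap hyt.aemeasurable]
    _ ≤ 4 * ∫⁻ t in Ioc (0 : ℝ) 1, volume S * (2 ^ n * ∫⁻ x, G x) := by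
        gcongr
        exact lintegral_convexCombination_le hG
    _ = _ := by rw [setLIntegral_const, hGS]; simp

end Poincare

section Growth

variable {n : ℕ}

local notation "E" => EuclideanSpace ℝ (Fin n)

namespace IsSol

/-- Measure-to-pointwise estimate at unit scale. -/
lemma growth_unit (hn : 3 ≤ n) {lam M b θ' : ℝ} (hlam : 0 < lam) (hM : 0 < M) (hb : 0 ≤ b)
    (hθ' : 0 < θ') :
    ∃ γ : ℝ, 0 < γ ∧ ∀ (g : E → ℝ) (F : E → E), IsSol lam M b (ball 0 2) g F →
      ∀ k : ℝ, 0 < k → θ' ≤ volume.real {x ∈ ball (0 : E) 1 | k ≤ g x} →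
      ∀ x ∈ ball (0 : E) (1 / 2), γ * k ≤ g x := by
  obtain ⟨θ, hθ, hDG⟩ := SubSol.le_one_of_integral_le hn hlam hM hb
    (by positivity : 0 ≤ b ^ 2 / (4 * lam))
  set C₁ : ℝ := 2 / lam * ∫ x : E, ((4 * M ^ 2 / lam + 1) * ‖ballCutoffGrad (3 / 2) x‖ ^ 2 +
    (b ^ 2 / lam + b ^ 2) * ballCutoff (3 / 2) x ^ 2) with hC₁
  have hC₁0 : 0 ≤ C₁ := mul_nonneg (by positivity) (integral_nonneg fun x => by
    have : 0 ≤ ‖ballCutoffGrad (3 / 2) x‖ ^ 2 := by positivity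
    positivity)
  set C₂ : ℝ := 4 * (volume.real (ball (0 : E) 1) * (2 ^ n * C₁)) / θ' with hC₂
  have hC₂0 : 0 ≤ C₂ := by positivity
  set D : ℝ := max 1 (C₂ / θ) with hD
  have hD1 : 1 ≤ D := le_max_left _ _
  have hD0 : 0 < D := by linarith
  have hDC : C₂ / D ^ 2 ≤ θ := by
    rw [div_le_iff₀ (by positivity)]
    have h1 : C₂ / θ ≤ D := le_max_right _ _
    rw [div_le_iff₀ hθ] at h1
    nlinarith
  refine ⟨Real.exp (-D), Real.exp_pos _, fun g F h k hk hmeas x hx => ?_⟩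
  suffices hε : ∀ ε : ℝ, 0 < ε → Real.exp (-D) * k ≤ g x + ε from le_of_forall_pos_le_add hε
  intro ε hε
  have h1 : IsSol lam M b (ball 0 1) g F := h.mono isOpen_ball (ball_subset_ball one_le_two)
  have hpos : ∀ x ∈ ball (0 : E) 1, 0 < g x + ε := fun x hx => by
    have := h1.nonneg x hx; positivity
  set v : E → ℝ := fun x => (Real.log (k + ε) - Real.log (g x + ε)) / D with hv
  have hsub : SubSol lam M b (b ^ 2 / (4 * lam)) v (fun x => (-(D * (g x + ε))⁻¹) • F x) :=
    h1.subSol_log hlam hb (Real.log (k + ε)) hε hD1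
  have hvd : ∀ x ∈ ball (0 : E) 1, DifferentiableAt ℝ v x := hsub.diff
  have hgradv : ∀ x ∈ ball (0 : E) 1,
      ‖gradient v x‖ ^ 2 = (D ^ 2)⁻¹ * (‖gradient g x‖ / (g x + ε)) ^ 2 := by
    intro x hx
    have hp := hpos x hx
    have h2 : HasDerivAt (fun s => (Real.log (k + ε) - Real.log (s + ε)) / D)
        (-(1 / (g x + ε)) / D) (g x) :=
      ((((hasDerivAt_id (g x)).add_const ε).log hp.ne').const_sub _).div_const D
    have h3 : HasGradientAt v _ x :=
      HasGradientAt.comp_deriv (f := g) h2 (h1.diff x hx).hasGradientAt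
    rw [h3.gradient, norm_smul, mul_pow, Real.norm_eq_abs, sq_abs]
    field_simp
  have hη := isCutoff_ballCutoff (n := n) (R := 3 / 2) (U := ball 0 2) (by norm_num)
    (closedBall_subset_ball (by norm_num))
  obtain ⟨hmint, hlog⟩ := h.integral_log_le hlam hM hb hε hη (ballCutoff_nonneg _)
  have hlog' : ∫ x, ballCutoff (3 / 2) x ^ 2 * (‖gradient g x‖ / (g x + ε)) ^ 2 ≤ C₁ := by
    rw [hC₁, div_mul_eq_mul_div, le_div_iff₀ hlam]
    linarith
  have hgl : ∫⁻ x in ball (0 : E) 1, ENNReal.ofReal (‖gradient v x‖ ^ 2) ≤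
      ENNReal.ofReal ((D ^ 2)⁻¹ * C₁) := by
    calc ∫⁻ x in ball (0 : E) 1, ENNReal.ofReal (‖gradient v x‖ ^ 2)
        ≤ ∫⁻ x in ball (0 : E) 1, ENNReal.ofReal ((D ^ 2)⁻¹ *
            (ballCutoff (3 / 2) x ^ 2 * (‖gradient g x‖ / (g x + ε)) ^ 2)) := by
          refine setLIntegral_mono' measurableSet_ball fun x hx => ENNReal.ofReal_le_ofReal ?_
          rw [hgradv x hx]
          have h2 := le_ballCutoff (R := 3 / 2) (r := 1) zero_le_one (by norm_num) hx
          have h3 : 1 ≤ ballCutoff (3 / 2) x := le_trans (by norm_num) h2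
          have h4 : 1 ≤ ballCutoff (3 / 2) x ^ 2 := one_le_pow₀ h3
          gcongr
          exact le_mul_of_one_le_left (sq_nonneg _) h4
      _ ≤ ∫⁻ x, ENNReal.ofReal ((D ^ 2)⁻¹ *
            (ballCutoff (3 / 2) x ^ 2 * (‖gradient g x‖ / (g x + ε)) ^ 2)) :=
          setLIntegral_le_lintegral _ _
      _ = ENNReal.ofReal ((D ^ 2)⁻¹ *
            ∫ x, ballCutoff (3 / 2) x ^ 2 * (‖gradient g x‖ / (g x + ε)) ^ 2) := by
          rw [← ofReal_integral_eq_lintegral_ofReal (hmint.const_mul _)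
            (Eventually.of_forall fun x => by positivity), integral_const_mul]
      _ ≤ _ := by gcongr
  have hset : {x ∈ ball (0 : E) 1 | v x ≤ 0} = {x ∈ ball (0 : E) 1 | k ≤ g x} := by
    ext x
    simp only [mem_ofPred_eq]
    refine and_congr_right fun hx => ?_
    rw [hv]
    simp only
    rw [div_le_iff₀ hD0, zero_mul, sub_nonpos,
      Real.log_le_log_iff (by positivity) (hpos x hx)]
    exact add_le_add_iff_right ε
  have hP := measure_mul_lintegral_posPart_le (convex_ball (0 : E) 1) isOpen_ball subset_rfl hvd
  rw [hset] at hP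
  set K := {x ∈ ball (0 : E) 1 | k ≤ g x} with hK
  have hKfin : volume K ≠ ⊤ := measure_ne_top_of_subset (sep_subset _ _) measure_ball_lt_top.ne
  have hJ : ∫⁻ x in ball (0 : E) 1, ENNReal.ofReal (max 0 (v x) ^ 2) ≤ ENNReal.ofReal θ := by
    have h2 : ENNReal.ofReal θ' * ∫⁻ x in ball (0 : E) 1, ENNReal.ofReal (max 0 (v x) ^ 2) ≤
        ENNReal.ofReal θ' * ENNReal.ofReal θ := by
      calc _ ≤ volume K * ∫⁻ x in ball (0 : E) 1, ENNReal.ofReal (max 0 (v x) ^ 2) := by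
            gcongr
            rw [← ofReal_measureReal hKfin]
            exact ENNReal.ofReal_le_ofReal hmeas
        _ ≤ _ := hP
        _ ≤ 4 * (volume (ball (0 : E) 1) * (2 ^ n * ENNReal.ofReal ((D ^ 2)⁻¹ * C₁))) := by
            gcongr
        _ = ENNReal.ofReal (4 * (volume.real (ball (0 : E) 1) *
              (2 ^ n * ((D ^ 2)⁻¹ * C₁)))) := by
            generalize (D ^ 2)⁻¹ * C₁ = c
            rw [ENNReal.ofReal_mul (by norm_num), ENNReal.ofReal_mul measureReal_nonneg,
              ofReal_measureReal measure_ball_lt_top.ne,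
              ENNReal.ofReal_mul (p := 2 ^ n) (by positivity), ENNReal.ofReal_pow (by norm_num)]
            norm_num
        _ ≤ ENNReal.ofReal (θ' * θ) := by
            apply ENNReal.ofReal_le_ofReal
            have h3 := mul_le_mul_of_nonneg_left hDC hθ'.le
            refine le_trans (le_of_eq ?_) h3
            rw [hC₂]
            field_simp
        _ = _ := ENNReal.ofReal_mul hθ'.le
    exact (ENNReal.mul_le_mul_iff_right (by simpa using hθ') ENNReal.ofReal_ne_top).1 h2
  have hvle : v x ≤ 1 := by
    refine hDG v _ hsub ?_ x hx
    have hvc : ContinuousOn v (ball 0 (3 / 4)) := fun x hx =>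
      (hvd x (ball_subset_ball (by norm_num) hx)).continuousAt.continuousWithinAt
    rw [integral_eq_lintegral_of_nonneg_ae (Eventually.of_forall fun x => sq_nonneg _)
      (((continuousOn_const.sup hvc).pow 2).aestronglyMeasurable measurableSet_ball)]
    refine ENNReal.toReal_le_of_le_ofReal hθ.le (le_trans ?_ hJ)
    exact lintegral_mono_set (ball_subset_ball (by norm_num))
  have hp := hpos x (ball_subset_ball (by norm_num) hx)
  rw [hv] at hvle
  simp only at hvle
  rw [div_le_one hD0] at hvle
  have h5 : Real.log (k + ε) - D ≤ Real.log (g x + ε) := by linarith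
  have h6 := Real.exp_le_exp.2 h5
  rw [Real.exp_log hp, sub_eq_add_neg, Real.exp_add, Real.exp_log (by positivity)] at h6
  refine le_trans ?_ h6
  rw [mul_comm]
  gcongr
  linarith

/-- Measure-to-pointwise estimate. -/
lemma growth (hn : 3 ≤ n) {lam M b θ' : ℝ} (hlam : 0 < lam) (hM : 0 < M) (hb : 0 ≤ b)
    (hθ' : 0 < θ') :
    ∃ γ : ℝ, 0 < γ ∧ ∀ (U : Set E) (g : E → ℝ) (F : E → E), IsSol lam M b U g F →
      ∀ (p : E) (r k : ℝ), 0 < r → r ≤ 1 → ball p (2 * r) ⊆ U → 0 < k →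
      θ' * r ^ n ≤ volume.real {x ∈ ball p r | k ≤ g x} → ∀ x ∈ ball p (r / 2), γ * k ≤ g x := by
  obtain ⟨γ, hγ, H⟩ := growth_unit (n := n) hn hlam hM hb hθ'
  refine ⟨γ, hγ, fun U g F h p r k hr hr1 hU hk hmeas x hx => ?_⟩
  set T := dilation p hr.ne' with hT
  have h1 := (h.mono isOpen_ball hU).comp_dilation p hr
  rw [mul_comm 2 r, dilation_preimage_ball p hr] at h1
  have h2 := h1.mono_drift (b' := b) (by nlinarith)
  have hset : {ξ ∈ ball (0 : E) 1 | k ≤ g (T ξ)} = T ⁻¹' {x ∈ ball p r | k ≤ g x} := by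
    have := dilation_preimage_ball p hr 1
    rw [mul_one] at this
    rw [← this]
    rfl
  have h3 := H _ _ h2 k hk (by
    rw [hset, measureReal_dilation_preimage p hr, inv_mul_eq_div, le_div_iff₀ (by positivity)]
    exact hmeas)
  have hx' : T.symm x ∈ ball (0 : E) (1 / 2) := by
    rw [← dilation_preimage_ball p hr (1 / 2), mem_preimage, ← hT, Homeomorph.apply_symm_apply]
    convert hx using 2
    ring
  simpa only [← hT, Homeomorph.apply_symm_apply] using h3 _ hx'

/-- Lower bounds on balls propagate to balls of twice the radius. -/
lemma doubling (hn : 3 ≤ n) {lam M b : ℝ} (hlam : 0 < lam) (hM : 0 < M) (hb : 0 ≤ b) :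
    ∃ γ : ℝ, 0 < γ ∧ γ ≤ 1 / 2 ∧ ∀ (U : Set E) (g : E → ℝ) (F : E → E), IsSol lam M b U g F →
      ∀ (p : E) (r k : ℝ), 0 < r → 4 * r ≤ 1 → ball p (8 * r) ⊆ U → 0 < k →
      (∀ x ∈ ball p r, k ≤ g x) → ∀ x ∈ ball p (2 * r), γ * k ≤ g x := by
  have hv : 0 < volume.real (ball (0 : E) 1) := ENNReal.toReal_pos (measure_ball_pos _ _ one_pos).ne' measure_ball_lt_top.ne
  obtain ⟨γ, hγ, H⟩ := growth (n := n) (θ' := volume.real (ball (0 : E) 1) / 4 ^ n)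
    hn hlam hM hb (by positivity)
  refine ⟨min γ (1 / 2), lt_min hγ (by norm_num), min_le_right _ _, fun U g F h p r k hr hr1 hU hk hball => ?_⟩
  intro x hx
  have h1 := H U g F h p (4 * r) k (by positivity) hr1 (by rwa [← mul_assoc, show (2 : ℝ) * 4 = 8 by
    norm_num]) hk ?_ x (by convert hx using 2; ring)
  · refine le_trans ?_ h1
    gcongr
    exact min_le_left _ _
  · have h2 : ball p r ⊆ {x ∈ ball p (4 * r) | k ≤ g x} := fun x hx =>
      ⟨ball_subset_ball (by linarith) hx, hball x hx⟩
    refine le_trans (le_of_eq ?_) (measureReal_mono h2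
      (measure_ne_top_of_subset (sep_subset _ _) measure_ball_lt_top.ne))
    rw [measureReal_def, measureReal_def, Measure.addHaar_ball_of_pos _ _ hr, ENNReal.toReal_mul,
      ENNReal.toReal_ofReal (by positivity), finrank_euclideanSpace_fin, mul_pow]
    field_simp

end IsSol

end Growth

section Landis

variable {n : ℕ}

local notation "E" => EuclideanSpace ℝ (Fin n)

namespace IsSol

/-- Propagation of lower bounds along a segment, by a chain of balls. -/
lemma chain {lam M b γ : ℝ} (hγ : 0 < γ)
    (hdoub : ∀ (U : Set E) (g : E → ℝ) (F : E → E), IsSol lam M b U g F →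
      ∀ (p : E) (r k : ℝ), 0 < r → 4 * r ≤ 1 → ball p (8 * r) ⊆ U → 0 < k →
      (∀ x ∈ ball p r, k ≤ g x) → ∀ x ∈ ball p (2 * r), γ * k ≤ g x)
    {U : Set E} {g : E → ℝ} {F : E → E} (h : IsSol lam M b U g F) {p q : E} {R k : ℝ} {m : ℕ}
    (hm : 0 < m) (hR : 0 < R) (hR1 : 4 * R ≤ 1) (hpq : ‖q - p‖ ≤ m * R)
    (hseg : ∀ t ∈ Icc (0 : ℝ) 1, ball (p + t • (q - p)) (8 * R) ⊆ U) (hk : 0 < k)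
    (hp : ∀ x ∈ ball p R, k ≤ g x) : ∀ x ∈ ball q R, γ ^ m * k ≤ g x := by
  have hm0 : (0 : ℝ) < m := by exact_mod_cast hm
  have key : ∀ i : ℕ, i ≤ m → ∀ x ∈ ball (p + ((i : ℝ) / m) • (q - p)) R, γ ^ i * k ≤ g x := by
    intro i
    induction i with
    | zero => intro _; simpa using hp
    | succ i ih =>
      intro hi x hx
      have hi' : (i : ℝ) ≤ m := by exact_mod_cast (Nat.le_succ i).trans hi
      have h1 := hdoub U g F h _ R (γ ^ i * k) hR hR1
        (hseg (i / m) ⟨by positivity, (div_le_one hm0).2 hi'⟩) (by positivity)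
        (ih ((Nat.le_succ i).trans hi)) x ?_
      · rw [pow_succ']
        linarith
      · rw [mem_ball] at hx ⊢
        have h2 : dist (p + (((i + 1 : ℕ) : ℝ) / m) • (q - p)) (p + ((i : ℝ) / m) • (q - p)) ≤
            R := by
          rw [dist_add_left, dist_eq_norm, ← sub_smul, norm_smul, Real.norm_eq_abs]
          have h3 : ((i + 1 : ℕ) : ℝ) / m - i / m = 1 / m := by push_cast; ring
          rw [h3, abs_of_pos (by positivity), div_mul_eq_mul_div, one_mul, div_le_iff₀ hm0]
          linarith
        linarith [dist_triangle x (p + (((i + 1 : ℕ) : ℝ) / m) • (q - p))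
          (p + ((i : ℝ) / m) • (q - p))]
  have h1 := key m le_rfl
  rw [div_self hm0.ne', one_smul, add_sub_cancel] at h1
  exact h1

lemma iterate_doubling {lam M b γ : ℝ} (hγ : 0 < γ)
    (hdoub : ∀ (U : Set E) (g : E → ℝ) (F : E → E), IsSol lam M b U g F →
      ∀ (p : E) (r k : ℝ), 0 < r → 4 * r ≤ 1 → ball p (8 * r) ⊆ U → 0 < k →
      (∀ x ∈ ball p r, k ≤ g x) → ∀ x ∈ ball p (2 * r), γ * k ≤ g x)
    {U : Set E} {g : E → ℝ} {F : E → E} (h : IsSol lam M b U g F) {p : E} {R : ℝ}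
    (hR : 0 < R) (hR1 : 4 * R ≤ 1) (hU : ball p (8 * R) ⊆ U) (m : ℕ) :
    ∀ r k : ℝ, 0 < r → 2 ^ m * r ≤ 2 * R → 0 < k → (∀ x ∈ ball p r, k ≤ g x) →
      ∀ x ∈ ball p (2 ^ m * r), γ ^ m * k ≤ g x := by
  induction m with
  | zero => intro r k _ _ _ hp; simpa using hp
  | succ m ih =>
    intro r k hr hrR hk hp x hx
    have h1 : 2 ^ m * r ≤ R := by rw [pow_succ] at hrR; linarith
    have h2 := ih r k hr (by linarith) hk hp
    have h3 := hdoub U g F h p (2 ^ m * r) (γ ^ m * k) (by positivity) (by linarith)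
      ((ball_subset_ball (by linarith)).trans hU) (by positivity) h2 x (by
        convert hx using 2; ring)
    rw [pow_succ']
    linarith

/-- If a solution is large at `x₀` compared with `μ`, while its lower bounds near `x₀` are
controlled by `μ`, then it would be unbounded near `x₀`. -/
lemma le_of_lower_bounds (hn : 3 ≤ n) {lam M b Γ : ℝ} (hlam : 0 < lam) (hM : 0 < M) (hb : 0 ≤ b)
    (hΓ : 0 < Γ) :
    ∃ C : ℝ, 0 < C ∧ ∀ (U : Set E) (g : E → ℝ) (F : E → E), IsSol lam M b U g F →
      ∀ (x₀ : E) (R μ : ℝ), 0 < R → 4 * R ≤ 1 → ball x₀ (9 * R) ⊆ U → 0 < μ →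
      (∀ k, 0 < k → (∀ x ∈ ball x₀ R, k ≤ g x) → Γ * k ≤ μ) → g x₀ ≤ C * μ := by
  obtain ⟨γ, hγ, hγ2, hdoub⟩ := doubling (n := n) hn hlam hM hb
  obtain ⟨θ, hθ, hDG⟩ := SubSol.le_one_of_integral_le (n := n) hn (b := b * (4 / γ)) hlam hM
    (by positivity) le_rfl
  obtain ⟨γ', hγ', hgrow⟩ := growth (n := n) (θ' := θ / (4 / γ) ^ 2) hn hlam hM hb (by positivity)
  set N : ℝ := 4 / (Γ * γ ^ 3 * γ') with hN
  have hN0 : 0 < N := by positivity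
  refine ⟨N, hN0, fun U g F h x₀ R μ hR hR1 hU hμ hlow => ?_⟩
  by_contra! hlarge
  have hseq : ∀ j : ℕ, ∃ x : E, dist x x₀ ≤ R * (1 - (1 / 2) ^ j) ∧ N * γ⁻¹ ^ j * μ ≤ g x := by
    intro j
    induction j with
    | zero => exact ⟨x₀, by simp, by simpa using hlarge.le⟩
    | succ j ih =>
      obtain ⟨p, hp, hgp⟩ := ih
      set ρ : ℝ := R * (1 / 2) ^ (j + 1) with hρ
      have hρ0 : 0 < ρ := by positivity
      have hhalf : ((1 : ℝ) / 2) ^ (j + 1) ≤ 1 / 2 := by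
        rw [pow_succ]
        have : ((1 : ℝ) / 2) ^ j ≤ 1 := pow_le_one₀ (by norm_num) (by norm_num)
        linarith
      have hρR : ρ ≤ R / 2 := by
        rw [hρ]
        nlinarith
      have hpR : dist p x₀ ≤ R := by
        refine hp.trans ?_
        have : 0 < ((1 : ℝ) / 2) ^ j := by positivity
        nlinarith
      have hpU : ball p (8 * R) ⊆ U := fun x hx => hU (by
        rw [mem_ball] at hx ⊢
        linarith [dist_triangle x p x₀])
      set k : ℝ := N * γ⁻¹ ^ j * μ with hk
      have hk0 : 0 < k := by positivity
      by_contra! hcon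
      have hsmall : ∀ x ∈ ball p ρ, g x < γ⁻¹ * k := by
        intro x hx
        have h1 := hcon x (by
          rw [mem_ball] at hx
          have h2 := dist_triangle x p x₀
          have h3 : R * (1 - (1 / 2) ^ (j + 1)) = R * (1 - (1 / 2) ^ j) + ρ := by
            rw [hρ, pow_succ]; ring
          linarith)
        refine h1.trans_eq ?_
        rw [hk, pow_succ]
        ring
      set T := dilation p hρ0.ne' with hT
      have hT1 : T ⁻¹' ball p ρ = ball 0 1 := by
        have := dilation_preimage_ball p hρ0 1
        rwa [mul_one] at this
      have hsol := (h.mono isOpen_ball ((ball_subset_ball (by linarith)).trans hpU :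
        ball p ρ ⊆ U)).comp_dilation p hρ0
      rw [← hT, hT1] at hsol
      have hsol' := hsol.mono_drift (b' := b) (by nlinarith)
      have hG : ∀ ξ ∈ ball (0 : E) 1, 4 / k * g (T ξ) ≤ 4 / γ := by
        intro ξ hξ
        have h1 := hsmall (T ξ) (by rwa [← mem_preimage, hT1])
        rw [div_mul_eq_mul_div, div_le_iff₀ hk0, div_mul_eq_mul_div, mul_div_assoc]
        have : k / γ = γ⁻¹ * k := by ring
        rw [this]
        linarith
      have hsub := hsol'.subSol_affine hb (a := 2) (by positivity) hG
      set v : E → ℝ := fun ξ => 4 / k * g (T ξ) - 2 with hv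
      have hv0 : 1 < v 0 := by
        have hT0 : T 0 = p := by simp [hT, dilation_apply]
        rw [hv]
        simp only
        rw [hT0]
        have : 4 ≤ 4 / k * g p := by
          rw [div_mul_eq_mul_div, le_div_iff₀ hk0]
          linarith
        linarith
      have hmint : θ < ∫ ξ in ball (0 : E) (3 / 4), max 0 (v ξ) ^ 2 := by
        by_contra! hle
        exact absurd (hDG v _ hsub hle 0 (mem_ball_self (by norm_num))) (not_le.2 hv0)
      set K : Set E := {x ∈ ball p ρ | k / 2 ≤ g x} with hKdef
      have hTK : T ⁻¹' K ⊆ ball 0 1 := by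
        rw [← hT1]
        exact preimage_mono (sep_subset _ _)
      have hTKfin : volume (T ⁻¹' K) ≠ ⊤ :=
        measure_ne_top_of_subset hTK measure_ball_lt_top.ne
      have hvc : ContinuousOn v (ball 0 1) := fun ξ hξ =>
        (hsub.diff ξ hξ).continuousAt.continuousWithinAt
      have hKm : MeasurableSet (T ⁻¹' K) := by
        have h1 : IsOpen (ball (0 : E) 1 ∩ v ⁻¹' Iio 0) :=
          hvc.isOpen_inter_preimage isOpen_ball isOpen_Iio
        have h2 : T ⁻¹' K = ball 0 1 \ (ball (0 : E) 1 ∩ v ⁻¹' Iio 0) := by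
          ext ξ
          rw [← hT1, hKdef]
          simp only [Set.mem_sdiff, mem_inter_iff, mem_preimage, mem_ofPred_eq, mem_Iio, hv]
          have e1 : 4 / k * g (T ξ) - 2 < 0 ↔ ¬ k / 2 ≤ g (T ξ) := by
            rw [not_le, sub_neg, div_mul_eq_mul_div, div_lt_iff₀ hk0]
            constructor <;> intro <;> linarith
          rw [e1]
          tauto
        rw [h2]
        exact measurableSet_ball.diff h1.measurableSet
      have hmeas : θ / (4 / γ) ^ 2 * ρ ^ n ≤ volume.real K := by
        have h1 := measureReal_dilation_preimage p hρ0 K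
        rw [← hT, inv_mul_eq_div, eq_div_iff (by positivity)] at h1
        rw [← h1]
        gcongr
        rw [div_le_iff₀ (by positivity)]
        refine hmint.le.trans ?_
        calc ∫ ξ in ball (0 : E) (3 / 4), max 0 (v ξ) ^ 2
            ≤ ∫ ξ in ball (0 : E) (3 / 4), (T ⁻¹' K).indicator (fun _ => (4 / γ) ^ 2) ξ := by
              have hfin : IsFiniteMeasure (volume.restrict (ball (0 : E) (3 / 4))) :=
                ⟨by simp [measure_ball_lt_top]⟩
              refine integral_mono_of_nonneg (Eventually.of_forall fun ξ => sq_nonneg _)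
                ((integrable_const _).indicator hKm) ?_
              refine (ae_restrict_iff' measurableSet_ball).2 (Eventually.of_forall fun ξ hξ => ?_)
              have hξ1 : ξ ∈ ball (0 : E) 1 := ball_subset_ball (by norm_num) hξ
              by_cases hξK : ξ ∈ T ⁻¹' K
              · rw [indicator_of_mem hξK]
                have h2 : v ξ ≤ 4 / γ := by
                  have := hG ξ hξ1
                  rw [hv]
                  simp only
                  linarith
                have h3 : 0 ≤ 4 / γ := by positivity
                exact pow_le_pow_left₀ (le_max_left _ _) (max_le h3 h2) 2
              · rw [indicator_of_notMem hξK]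
                have h2 : v ξ ≤ 0 := by
                  have h3 : ¬ k / 2 ≤ g (T ξ) := fun h4 =>
                    hξK ⟨by rwa [← mem_preimage, hT1], h4⟩
                  rw [hv]
                  simp only
                  rw [sub_nonpos, div_mul_eq_mul_div, div_le_iff₀ hk0]
                  linarith
                simp [max_eq_left h2]
          _ = volume.real (T ⁻¹' K ∩ ball 0 (3 / 4)) * (4 / γ) ^ 2 := by
              rw [integral_indicator_const _ hKm, measureReal_restrict_apply hKm, smul_eq_mul]
          _ ≤ _ := by
              gcongr
              exact inter_subset_left
      have hg1 := hgrow U g F h p ρ (k / 2) hρ0 (by linarith)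
        ((ball_subset_ball (by linarith)).trans hpU) (by positivity) hmeas
      have e2 : 2 ^ (j + 3) * (ρ / 2) = 2 * R := by
        rw [hρ, show j + 3 = (j + 1) + 2 by ring, pow_add, one_div, inv_pow]
        field_simp
      have hg2 := iterate_doubling hγ hdoub h hR hR1 hpU (j + 3) (ρ / 2) (γ' * (k / 2))
        (by positivity) e2.le (by positivity) hg1
      rw [e2] at hg2
      have hfinal := hlow (γ ^ (j + 3) * (γ' * (k / 2))) (by positivity) fun x hx => hg2 x (by
        rw [mem_ball] at hx ⊢
        linarith [dist_triangle x x₀ p, dist_comm x₀ p])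
      have e3 : Γ * (γ ^ (j + 3) * (γ' * (k / 2))) = 2 * μ := by
        rw [hk, hN, pow_add, inv_pow]
        field_simp
        norm_num
      linarith
  obtain ⟨Bd, hBd⟩ := (isCompact_closedBall x₀ R).exists_bound_of_continuousOn
    (h.continuousOn.mono ((closedBall_subset_ball (by linarith)).trans hU))
  obtain ⟨j, hj⟩ := pow_unbounded_of_one_lt (Bd / (N * μ))
    (show 1 < γ⁻¹ from (one_lt_inv₀ hγ).2 (by linarith))
  obtain ⟨x, hx, hgx⟩ := hseq j
  have hxR : x ∈ closedBall x₀ R := by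
    rw [mem_closedBall]
    refine hx.trans ?_
    have : 0 < ((1 : ℝ) / 2) ^ j := by positivity
    nlinarith
  have h1 := (le_abs_self _).trans (hBd x hxR)
  rw [div_lt_iff₀ (by positivity)] at hj
  linarith

end IsSol

end Landis

section PuncturedBall

variable {n : ℕ}

local notation "E" => EuclideanSpace ℝ (Fin n)

lemma le_norm_add_smul_sub {p q : E} {s : ℝ} (hs : 0 ≤ s) (hp : 2 * s ≤ ‖p‖) (hq : 2 * s ≤ ‖q‖)
    (hpq : 0 ≤ ⟪p, q⟫) {t : ℝ} (ht : t ∈ Icc (0 : ℝ) 1) : s ≤ ‖p + t • (q - p)‖ := by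
  obtain ⟨ht0, ht1⟩ := ht
  have h1 : p + t • (q - p) = (1 - t) • p + t • q := by module
  have h2 : ‖p + t • (q - p)‖ ^ 2 =
      (1 - t) ^ 2 * ‖p‖ ^ 2 + 2 * ((1 - t) * t * ⟪p, q⟫) + t ^ 2 * ‖q‖ ^ 2 := by
    rw [h1, norm_add_sq_real, norm_smul, norm_smul, mul_pow, mul_pow, Real.norm_eq_abs,
      Real.norm_eq_abs, sq_abs, sq_abs, inner_smul_left, inner_smul_right]
    simp only [conj_trivial]
    ring
  have h3 : 0 ≤ (1 - t) * t * ⟪p, q⟫ := mul_nonneg (mul_nonneg (by linarith) ht0) hpq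
  have h4 : (2 * s) ^ 2 ≤ ‖p‖ ^ 2 := by gcongr
  have h5 : (2 * s) ^ 2 ≤ ‖q‖ ^ 2 := by gcongr
  have h6 := mul_le_mul_of_nonneg_left h4 (sq_nonneg (1 - t))
  have h7 := mul_le_mul_of_nonneg_left h5 (sq_nonneg t)
  refine le_of_sq_le_sq ?_ (norm_nonneg _)
  nlinarith [sq_nonneg (2 * t - 1), sq_nonneg s, mul_nonneg (sq_nonneg (2 * t - 1)) (sq_nonneg s)]

/-- From any point one can reach the direction `ζ` in two steps, each of which turns by at most
a right angle. -/
lemma exists_intermediate_point (hn : 2 ≤ n) {ζ x : E} (hζ : ‖ζ‖ = 1) (hx : ‖x‖ ≤ 1) :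
    ∃ q : E, ‖x‖ ≤ ‖q‖ ∧ dist q ζ ≤ 1 + ‖x‖ ∧ 0 ≤ ⟪x, q⟫ ∧ 0 ≤ ⟪q, ζ⟫ := by
  rcases le_total 0 ⟪x, ζ⟫ with h | h
  · exact ⟨ζ, by rwa [hζ], by rw [dist_self]; positivity, h, real_inner_self_nonneg⟩
  · have hrank : 0 < Module.finrank ℝ (ℝ ∙ ζ)ᗮ := by
      have h1 := Submodule.finrank_add_finrank_orthogonal (ℝ ∙ ζ)
      rw [finrank_span_singleton (by rintro rfl; simp at hζ), finrank_euclideanSpace_fin] at h1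
      omega
    have hne : (ℝ ∙ ζ)ᗮ ≠ ⊥ := by
      intro h0
      rw [h0, finrank_bot] at hrank
      exact lt_irrefl _ hrank
    obtain ⟨e, he, he0⟩ := Submodule.exists_mem_ne_zero_of_ne_bot hne
    have heζ : ⟪e, ζ⟫ = 0 := by
      rw [real_inner_comm]
      exact Submodule.mem_orthogonal_singleton_iff_inner_right.1 he
    have key : ∀ e : E, e ≠ 0 → ⟪e, ζ⟫ = 0 → 0 ≤ ⟪x, e⟫ →
        ∃ q : E, ‖x‖ ≤ ‖q‖ ∧ dist q ζ ≤ 1 + ‖x‖ ∧ 0 ≤ ⟪x, q⟫ ∧ 0 ≤ ⟪q, ζ⟫ := by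
      intro e he0 heζ hxe
      have hepos : 0 < ‖e‖ := norm_pos_iff.2 he0
      have hnorm : ‖(‖x‖ / ‖e‖) • e‖ = ‖x‖ := by
        rw [norm_smul, Real.norm_eq_abs, abs_of_nonneg (by positivity), div_mul_cancel₀ _ hepos.ne']
      refine ⟨(‖x‖ / ‖e‖) • e, hnorm.ge, ?_, ?_, ?_⟩
      · rw [dist_eq_norm]
        refine (norm_sub_le _ _).trans ?_
        rw [hnorm, hζ, add_comm]
      · rw [inner_smul_right]
        positivity
      · rw [inner_smul_left, heζ, mul_zero]
    rcases le_total 0 ⟪x, e⟫ with h1 | h1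
    · exact key e he0 heζ h1
    · exact key (-e) (neg_ne_zero.2 he0) (by rw [inner_neg_left, heζ, neg_zero])
        (by rw [inner_neg_right]; linarith)

/-- Away from the puncture, a solution in a punctured ball is controlled by its value at the
center. -/
lemma IsSol.le_value_center (hn : 3 ≤ n) {lam M b : ℝ} (hlam : 0 < lam) (hM : 0 < M) (hb : 0 ≤ b) :
    ∃ C : ℝ, 0 < C ∧ ∀ (ζ : E), ‖ζ‖ = 1 → ∀ (g : E → ℝ) (F : E → E),
      IsSol lam M b (ball ζ (3 / 2) \ {0}) g F →
      ∀ x, 1 / 16 ≤ ‖x‖ → ‖x‖ ≤ 3 / 8 → g x ≤ C * g ζ := by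
  obtain ⟨γ, hγ, hγ2, hdoub⟩ := doubling (n := n) hn hlam hM hb
  obtain ⟨C, hC, H⟩ := le_of_lower_bounds (n := n) (Γ := γ ^ 704 * γ ^ 704) hn hlam hM hb
    (by positivity)
  refine ⟨C, hC, fun ζ hζ g F h x hx hx' => ?_⟩
  have hζU : ζ ∈ ball ζ (3 / 2) \ {0} :=
    ⟨mem_ball_self (by norm_num), by rintro rfl; simp at hζ⟩
  have hgζ := h.nonneg ζ hζU
  have hball : ∀ (p : E) (r : ℝ), r ≤ ‖p‖ → dist p ζ + r ≤ 3 / 2 →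
      ball p r ⊆ ball ζ (3 / 2) \ {0} := by
    intro p r h1 h2 w hw
    rw [mem_ball] at hw
    refine ⟨?_, ?_⟩
    · rw [mem_ball]
      linarith [dist_triangle w p ζ]
    · rintro rfl
      rw [dist_zero_left] at hw
      linarith
  have hxζ : dist x ζ ≤ 11 / 8 := by
    rw [dist_eq_norm]
    linarith [norm_sub_le x ζ]
  have hchain : ∀ p q : E, 1 / 16 ≤ ‖p‖ → 1 / 16 ≤ ‖q‖ → dist p ζ ≤ 11 / 8 → dist q ζ ≤ 11 / 8 →
      0 ≤ ⟪p, q⟫ → ∀ k, 0 < k → (∀ w ∈ ball p (1 / 256), k ≤ g w) →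
      ∀ w ∈ ball q (1 / 256), γ ^ 704 * k ≤ g w := by
    intro p q hp hq hpζ hqζ hpq k hk hgk
    refine chain hγ hdoub h (by norm_num) (by norm_num) (by norm_num) ?_ ?_ hk hgk
    · rw [← dist_eq_norm]
      have := dist_triangle q ζ p
      rw [dist_comm ζ p] at this
      norm_num
      linarith
    · intro t ht
      refine hball _ _ ?_ ?_
      · have := le_norm_add_smul_sub (s := 1 / 32) (by norm_num) (by linarith) (by linarith) hpq ht
        linarith
      · have : p + t • (q - p) ∈ closedBall ζ (11 / 8) :=
          (convex_closedBall ζ (11 / 8)).add_smul_sub_mem hpζ hqζ ht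
        rw [mem_closedBall] at this
        linarith
  have hε : ∀ ε : ℝ, 0 < ε → g x ≤ C * g ζ + ε := by
    intro ε hε
    have h1 := H _ g F h x (1 / 256) (g ζ + ε / C) (by norm_num) (by norm_num)
      (hball _ _ (by linarith) (by linarith)) (by positivity) ?_
    · rw [mul_add, mul_div_cancel₀ _ hC.ne'] at h1
      exact h1
    · intro k hk hgk
      obtain ⟨q, hq1, hq2, hq3, hq4⟩ := exists_intermediate_point (by omega) hζ
        (by linarith : ‖x‖ ≤ 1)
      have h2 := hchain x q hx (by linarith) hxζ (by linarith) hq3 k hk hgk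
      have h3 := hchain q ζ (by linarith) (by rw [hζ]; norm_num) (by linarith)
        (by rw [dist_self]; norm_num) hq4 _ (by positivity) h2 ζ (mem_ball_self (by norm_num))
      have : 0 < ε / C := by positivity
      rw [mul_assoc]
      linarith
  exact le_of_forall_pos_le_add hε

end PuncturedBall

section GreenFunction

variable {n : ℕ}

local notation "E" => EuclideanSpace ℝ (Fin n)

lemma continuous_gradient {η : E → ℝ} (h : ContDiff ℝ (⊤ : ℕ∞) η) : Continuous (gradient η) := by
  unfold gradient
  exact (InnerProductSpace.toDual ℝ E).symm.continuous.comp (h.continuous_fderiv (by simp))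

lemma isCutoff_of_contDiff {U : Set E} {η : E → ℝ} (h : ContDiff ℝ (⊤ : ℕ∞) η)
    (hc : HasCompactSupport η) (hs : tsupport η ⊆ U) : IsCutoff U η (gradient η) where
  grad x := (h.differentiable (by simp) x).hasGradientAt
  cont := continuous_gradient h
  compact := hc
  supp := hs

lemma exists_annulus_cutoff : ∃ (η : E → ℝ) (η' : E → E),
    IsCutoff {x | 1 / 16 ≤ ‖x‖ ∧ ‖x‖ ≤ 3 / 8} η η' ∧ (∀ x, 0 ≤ η x) ∧
      ∀ x, 1 / 8 ≤ ‖x‖ → ‖x‖ ≤ 1 / 4 → η x = 1 := by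
  let χ₁ : ContDiffBump (0 : E) := ⟨1 / 4, 3 / 8, by norm_num, by norm_num⟩
  let χ₂ : ContDiffBump (0 : E) := ⟨1 / 16, 1 / 8, by norm_num, by norm_num⟩
  have h1 : ∀ x : E, ‖x‖ ≤ 1 / 4 → χ₁ x = 1 := fun x hx =>
    χ₁.one_of_mem_closedBall (by simpa [χ₁] using hx)
  have h1' : ∀ x : E, 3 / 8 ≤ ‖x‖ → χ₁ x = 0 := fun x hx =>
    χ₁.zero_of_le_dist (by simpa [χ₁] using hx)
  have h2 : ∀ x : E, ‖x‖ ≤ 1 / 16 → χ₂ x = 1 := fun x hx =>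
    χ₂.one_of_mem_closedBall (by simpa [χ₂] using hx)
  have h2' : ∀ x : E, 1 / 8 ≤ ‖x‖ → χ₂ x = 0 := fun x hx =>
    χ₂.zero_of_le_dist (by simpa [χ₂] using hx)
  have hsupp : tsupport (fun x => χ₁ x - χ₂ x) ⊆ {x : E | 1 / 16 ≤ ‖x‖ ∧ ‖x‖ ≤ 3 / 8} := by
    refine closure_minimal (fun x hx => ?_) ?_
    · by_contra hcon
      refine hx ?_
      by_cases hx1 : 1 / 16 ≤ ‖x‖
      · have : 3 / 8 < ‖x‖ := by
          by_contra h
          exact hcon ⟨hx1, not_lt.1 h⟩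
        simp only
        rw [h1' x this.le, h2' x (by linarith), sub_zero]
      · simp only
        rw [h1 x (by linarith), h2 x (by linarith), sub_self]
    · exact (isClosed_le continuous_const continuous_norm).inter
        (isClosed_le continuous_norm continuous_const)
  refine ⟨fun x => χ₁ x - χ₂ x, _, isCutoff_of_contDiff (χ₁.contDiff.sub χ₂.contDiff) ?_ hsupp,
    fun x => ?_, fun x hx hx' => ?_⟩
  · refine HasCompactSupport.of_support_subset_isCompact (isCompact_closedBall (0 : E) (3 / 8))
      fun x hx => ?_
    simpa using (hsupp (subset_tsupport _ hx)).2
  · rcases le_total ‖x‖ (1 / 4) with h | h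
    · have := χ₂.le_one (x := x)
      simp only
      rw [h1 x h]
      linarith
    · simp only
      rw [h2' x (by linarith)]
      simpa using χ₁.nonneg
  · simp only
    rw [h1 x hx', h2' x hx, sub_zero]

lemma IsSol.integral_inner_le (hn : 3 ≤ n) {lam M b : ℝ} (hlam : 0 < lam) (hM : 0 < M)
    (hb : 0 ≤ b) {L : ℝ} (hL : 0 ≤ L) : ∃ C > 0, ∀ ζ : E, ‖ζ‖ = 1 → ∀ (g : E → ℝ) (F : E → E),
      IsSol lam M b (ball ζ (3 / 2) \ {0}) g F → ∀ Ψ : E → E, (∀ x, ‖Ψ x‖ ≤ L) →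
      (∀ x, Ψ x ≠ 0 → 1 / 8 ≤ ‖x‖ ∧ ‖x‖ ≤ 1 / 4) → ∫ x, ⟪F x, Ψ x⟫ ≤ C * g ζ := by
  obtain ⟨C₁, hC₁, H⟩ := IsSol.le_value_center hn hlam hM hb
  obtain ⟨η, η', hη, hη0, hη1⟩ := exists_annulus_cutoff (n := n)
  set D := ∫ x, ((4 * M ^ 2 / lam + 1) * ‖η' x‖ ^ 2 + (b ^ 2 / lam + b ^ 2) * η x ^ 2) with hD
  have hD0 : 0 ≤ D := integral_nonneg fun x => by positivity
  set J := ∫ x, η x ^ 2 with hJ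
  have hJ0 : 0 ≤ J := integral_nonneg fun x => by positivity
  have hηi : Integrable fun x => η x ^ 2 :=
    (hη.continuous.pow 2).integrable_of_hasCompactSupport hη.sq.compact
  set K := (M + b) * J + M * (2 / lam * D) with hK
  have hK0 : 0 ≤ K := by positivity
  refine ⟨L * C₁ * K + 1, by positivity, fun ζ hζ g F h Ψ hΨ hΨ0 => ?_⟩
  have hsub : {x : E | 1 / 16 ≤ ‖x‖ ∧ ‖x‖ ≤ 3 / 8} ⊆ ball ζ (3 / 2) \ {0} := by
    rintro x ⟨h1, h2⟩
    refine ⟨?_, fun h0 => ?_⟩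
    · rw [mem_ball, dist_eq_norm]
      have := norm_sub_le x ζ
      linarith
    · rw [h0, norm_zero] at h1
      norm_num at h1
  have hgζ : 0 ≤ g ζ := h.nonneg _ ⟨mem_ball_self (by norm_num), fun h0 => by
    rw [h0, norm_zero] at hζ
    norm_num at hζ⟩
  have hε : ∀ ε : ℝ, 0 < ε → ∫ x, ⟪F x, Ψ x⟫ ≤ L * K * (C₁ * g ζ + ε) := by
    intro ε hε
    obtain ⟨hi, hle⟩ := h.integral_log_le hlam hM hb hε (hη.mono hsub) hη0
    set X : E → ℝ := fun x => ‖gradient g x‖ / (g x + ε) with hX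
    have hpt : ∀ x, ‖⟪F x, Ψ x⟫‖ ≤
        L * (C₁ * g ζ + ε) * ((M + b) * η x ^ 2 + M * (η x ^ 2 * X x ^ 2)) := by
      intro x
      by_cases hx : Ψ x = 0
      · rw [hx, inner_zero_right, norm_zero]
        positivity
      · obtain ⟨hx1, hx2⟩ := hΨ0 x hx
        have hxU := hsub (show x ∈ {x : E | 1 / 16 ≤ ‖x‖ ∧ ‖x‖ ≤ 3 / 8} from
          ⟨by linarith, by linarith⟩)
        have hgx := H ζ hζ g F h x (by linarith) (by linarith)
        have hg0 := h.nonneg x hxU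
        have hX0 : ‖gradient g x‖ = (g x + ε) * X x := by
          rw [hX]
          field_simp
        have hXn : 0 ≤ X x := by positivity
        have hF : ‖F x‖ ≤ (C₁ * g ζ + ε) * (M * (1 + X x ^ 2) + b) := by
          calc ‖F x‖ ≤ M * ‖gradient g x‖ + b * g x := h.bound x hxU
            _ ≤ M * ((g x + ε) * (1 + X x ^ 2)) + b * (g x + ε) := by
                rw [hX0]
                gcongr
                · nlinarith [sq_nonneg (X x - 1)]
                · linarith
            _ = (g x + ε) * (M * (1 + X x ^ 2) + b) := by ring
            _ ≤ _ := by gcongr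
        rw [hη1 x hx1 hx2]
        calc ‖⟪F x, Ψ x⟫‖ ≤ ‖F x‖ * ‖Ψ x‖ := norm_inner_le_norm _ _
          _ ≤ ((C₁ * g ζ + ε) * (M * (1 + X x ^ 2) + b)) * L := by
              gcongr
              exact hΨ x
          _ = _ := by ring
    have hmint : Integrable fun x =>
        L * (C₁ * g ζ + ε) * ((M + b) * η x ^ 2 + M * (η x ^ 2 * X x ^ 2)) :=
      ((hηi.const_mul _).add (hi.const_mul _)).const_mul _
    calc ∫ x, ⟪F x, Ψ x⟫ ≤ ‖∫ x, ⟪F x, Ψ x⟫‖ := le_abs_self _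
      _ ≤ ∫ x, L * (C₁ * g ζ + ε) * ((M + b) * η x ^ 2 + M * (η x ^ 2 * X x ^ 2)) :=
          norm_integral_le_of_norm_le hmint (Eventually.of_forall hpt)
      _ = L * (C₁ * g ζ + ε) * ((M + b) * J + M * ∫ x, η x ^ 2 * X x ^ 2) := by
          rw [integral_const_mul, integral_add (hηi.const_mul _) (hi.const_mul _),
            integral_const_mul, integral_const_mul]
      _ ≤ L * (C₁ * g ζ + ε) * ((M + b) * J + M * (2 / lam * D)) := by
          gcongr
          calc ∫ x, η x ^ 2 * X x ^ 2 = 2 / lam * (lam / 2 * ∫ x, η x ^ 2 * X x ^ 2) := by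
                field_simp
            _ ≤ 2 / lam * D := by gcongr
      _ = _ := by ring
  clear_value K
  have hlim : ∫ x, ⟪F x, Ψ x⟫ ≤ L * C₁ * K * g ζ := by
    refine le_of_forall_pos_le_add fun ε hε' => ?_
    have h1 := hε (ε / (L * K + 1)) (by positivity)
    have h2 : L * K * (ε / (L * K + 1)) ≤ ε := by
      rw [mul_div_assoc', div_le_iff₀ (by positivity)]
      linarith [mul_comm ε (L * K)]
    calc ∫ x, ⟪F x, Ψ x⟫ ≤ L * K * (C₁ * g ζ + ε / (L * K + 1)) := h1
      _ = L * C₁ * K * g ζ + L * K * (ε / (L * K + 1)) := by ring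
      _ ≤ _ := by gcongr
  linarith

end GreenFunction

section GreenFlux

variable {n : ℕ}

local notation "E" => EuclideanSpace ℝ (Fin n)

/-- The flux `Aᵀ∇g - gB` of the adjoint equation. -/
def adjFlux (A : E → Matrix (Fin n) (Fin n) ℝ) (B : E → E) (g : E → ℝ) (x : E) : E :=
  WithLp.toLp 2 fun i => (∑ j, A x j i * gradient g x j) - g x * B x i

lemma inner_adjFlux (A : E → Matrix (Fin n) (Fin n) ℝ) (B : E → E) (g : E → ℝ) (x w : E) :
    ⟪adjFlux A B g x, w⟫ =
      (∑ i, ∑ j, A x j i * gradient g x j * w i) - g x * ∑ i, B x i * w i := by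
  simp only [adjFlux, PiLp.inner_apply, RCLike.inner_apply, conj_trivial, Finset.mul_sum]
  rw [← Finset.sum_sub_distrib]
  refine Finset.sum_congr rfl fun i _ => ?_
  rw [← Finset.sum_mul]
  ring

lemma abs_sum_coord_mul_le {M : ℝ} {a : Matrix (Fin n) (Fin n) ℝ} (ha : ∑ i, ∑ j, |a i j| ≤ M)
    (v w : E) : |∑ i, ∑ j, a j i * v j * w i| ≤ M * ‖v‖ * ‖w‖ := by
  calc |∑ i, ∑ j, a j i * v j * w i| ≤ ∑ i, ∑ j, |a j i| * (‖v‖ * ‖w‖) := by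
        refine (Finset.abs_sum_le_sum_abs _ _).trans (Finset.sum_le_sum fun i _ => ?_)
        refine (Finset.abs_sum_le_sum_abs _ _).trans (Finset.sum_le_sum fun j _ => ?_)
        have h1 : |v j| ≤ ‖v‖ := PiLp.norm_apply_le v j
        have h2 : |w i| ≤ ‖w‖ := PiLp.norm_apply_le w i
        rw [abs_mul, abs_mul, mul_assoc]
        gcongr
    _ = (∑ i, ∑ j, |a i j|) * (‖v‖ * ‖w‖) := by
        rw [Finset.sum_comm]
        simp only [Finset.sum_mul]
    _ ≤ M * (‖v‖ * ‖w‖) := by gcongr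
    _ = _ := by ring

lemma abs_sum_coord_le (v w : E) : |∑ i, v i * w i| ≤ ‖v‖ * ‖w‖ := by
  have h1 : ∑ i, v i * w i = ⟪v, w⟫ := by
    simp only [PiLp.inner_apply, RCLike.inner_apply, conj_trivial]
    exact Finset.sum_congr rfl fun i _ => mul_comm _ _
  rw [h1]
  exact abs_real_inner_le_norm v w

lemma norm_adjFlux_le {M b : ℝ} {A : E → Matrix (Fin n) (Fin n) ℝ} {B : E → E} {g : E → ℝ} {x : E}
    (hA : ∑ i, ∑ j, |A x i j| ≤ M) (hB : ‖B x‖ ≤ b) (hg : 0 ≤ g x) :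
    ‖adjFlux A B g x‖ ≤ M * ‖gradient g x‖ + b * g x := by
  set F := adjFlux A B g x with hF
  have h1 : ‖F‖ * ‖F‖ ≤ (M * ‖gradient g x‖ + b * g x) * ‖F‖ := by
    rw [← real_inner_self_eq_norm_mul_norm, hF, inner_adjFlux, ← hF]
    have h2 := le_of_abs_le (abs_sum_coord_mul_le hA (gradient g x) F)
    have h3 := neg_le_of_abs_le (abs_sum_coord_le (B x) F)
    have h4 : ‖B x‖ * ‖F‖ ≤ b * ‖F‖ := by gcongr
    have h5 := mul_le_mul_of_nonneg_left (show -(b * ‖F‖) ≤ ∑ i, B x i * F i by linarith) hg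
    linarith
  rcases (norm_nonneg F).eq_or_lt with h | h
  · rw [← h]
    have := (norm_nonneg _).trans hB
    have := (Finset.sum_nonneg fun i _ => Finset.sum_nonneg fun j _ => abs_nonneg _).trans hA
    positivity
  · exact le_of_mul_le_mul_right h1 h

lemma le_inner_adjFlux {lam b : ℝ} {A : E → Matrix (Fin n) (Fin n) ℝ} {B : E → E} {g : E → ℝ}
    {x : E} (hA : ∀ ξ : E, lam * ‖ξ‖ ^ 2 ≤ ∑ i, ∑ j, A x i j * ξ i * ξ j) (hB : ‖B x‖ ≤ b)
    (hg : 0 ≤ g x) :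
    lam * ‖gradient g x‖ ^ 2 - b * g x * ‖gradient g x‖ ≤ ⟪adjFlux A B g x, gradient g x⟫ := by
  rw [inner_adjFlux]
  set v := gradient g x
  have h1 := hA v
  rw [Finset.sum_comm] at h1
  have h3 := le_of_abs_le (abs_sum_coord_le (B x) v)
  have h4 : ‖B x‖ * ‖v‖ ≤ b * ‖v‖ := by gcongr
  have h5 := mul_le_mul_of_nonneg_left (h3.trans h4) hg
  linarith

variable {Ω : Set (EuclideanSpace ℝ (Fin n))}
  {A : EuclideanSpace ℝ (Fin n) → Matrix (Fin n) (Fin n) ℝ}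
  {B : EuclideanSpace ℝ (Fin n) → EuclideanSpace ℝ (Fin n)}
  {y : EuclideanSpace ℝ (Fin n)} {g : EuclideanSpace ℝ (Fin n) → ℝ}

lemma setIntegral_inner_adjFlux (h : IsGreenWithPole Ω A B y g) {φ : E → ℝ}
    (hφ : ContDiff ℝ (⊤ : ℕ∞) φ) (hc : HasCompactSupport φ) (hs : tsupport φ ⊆ Ω) :
    ∫ x in Ω, ⟪adjFlux A B g x, gradient φ x⟫ = φ y := by
  simp only [inner_adjFlux]
  exact h.2.2.2.2.2.2 φ hφ hc hs

lemma integral_inner_adjFlux (h : IsGreenWithPole Ω A B y g) {φ : E → ℝ}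
    (hφ : ContDiff ℝ (⊤ : ℕ∞) φ) (hc : HasCompactSupport φ) (hs : tsupport φ ⊆ Ω) :
    ∫ x, ⟪adjFlux A B g x, gradient φ x⟫ = φ y := by
  rw [← setIntegral_inner_adjFlux h hφ hc hs, setIntegral_eq_integral_of_forall_compl_eq_zero]
  intro x hx
  rw [(isCutoff_of_contDiff hφ hc hs).grad_eq_zero fun h => hx (hs h), inner_zero_right]

lemma integrable_inner_adjFlux (hΩ : IsOpen Ω) (hy : y ∈ Ω) (h : IsGreenWithPole Ω A B y g)
    {φ : E → ℝ} (hφ : ContDiff ℝ (⊤ : ℕ∞) φ) (hc : HasCompactSupport φ) (hs : tsupport φ ⊆ Ω) :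
    Integrable fun x => ⟪adjFlux A B g x, gradient φ x⟫ := by
  have key : ∀ φ : E → ℝ, ContDiff ℝ (⊤ : ℕ∞) φ → HasCompactSupport φ → tsupport φ ⊆ Ω →
      φ y ≠ 0 → Integrable fun x => ⟪adjFlux A B g x, gradient φ x⟫ := by
    intro φ hφ hc hs h0
    by_contra hcon
    exact h0 ((integral_inner_adjFlux h hφ hc hs).symm.trans (integral_undef hcon))
  by_cases h0 : φ y = 0
  · obtain ⟨R, hR, hRΩ⟩ := Metric.isOpen_iff.1 hΩ y hy
    let ψ : ContDiffBump y := ⟨R / 4, R / 2, by linarith, by linarith⟩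
    have hψ : ContDiff ℝ (⊤ : ℕ∞) ψ := ψ.contDiff
    have hψs : tsupport ψ ⊆ Ω := by
      rw [ψ.tsupport_eq]
      exact (closedBall_subset_ball (by simp only [ψ]; linarith)).trans hRΩ
    have hψy : ψ y = 1 := ψ.one_of_mem_closedBall (mem_closedBall_self ψ.rIn_pos.le)
    have h1 := key (fun x => φ x + ψ x) (hφ.add hψ) (hc.add ψ.hasCompactSupport)
      ((tsupport_add φ ψ).trans (union_subset hs hψs)) (by simp [h0, hψy])
    have h2 := key ψ hψ ψ.hasCompactSupport hψs (by simp [hψy])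
    refine (h1.sub h2).congr (Eventually.of_forall fun x => ?_)
    have h3 : HasGradientAt (fun x => φ x + ψ x) (gradient φ x + gradient ψ x) x := by
      rw [hasGradientAt_iff_hasFDerivAt, map_add]
      exact (hφ.differentiable (by simp) x).hasGradientAt.hasFDerivAt.add
        (hψ.differentiable (by simp) x).hasGradientAt.hasFDerivAt
    simp only [Pi.sub_apply]
    rw [h3.gradient, inner_add_right, add_sub_cancel_right]
  · exact key φ hφ hc hs h0

lemma aestronglyMeasurable_adjFlux (hΩ : IsOpen Ω) (hy : y ∈ Ω) (h : IsGreenWithPole Ω A B y g)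
    {z : E} {r R : ℝ} (hr : 0 < r) (hrR : r < R) (hRΩ : closedBall z R ⊆ Ω) :
    AEStronglyMeasurable (adjFlux A B g) (volume.restrict (ball z r)) := by
  have hcoord : ∀ i, AEMeasurable (fun x => adjFlux A B g x i) (volume.restrict (ball z r)) := by
    intro i
    let χ : ContDiffBump z := ⟨r, R, hr, hrR⟩
    set e : E := EuclideanSpace.single i 1 with he
    have hlin : ContDiff ℝ (⊤ : ℕ∞) fun x : E => ⟪e, x⟫ := (innerSL ℝ e).contDiff
    have h1 := integrable_inner_adjFlux hΩ hy h (φ := fun x => χ x * ⟪e, x⟫)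
      (χ.contDiff.mul hlin) χ.hasCompactSupport.mul_right
      ((tsupport_mul_subset_left).trans (by rw [χ.tsupport_eq]; exact hRΩ))
    refine (h1.aestronglyMeasurable.aemeasurable.restrict).congr ?_
    filter_upwards [ae_restrict_mem measurableSet_ball] with x hx
    have h2 : (fun x => χ x * ⟪e, x⟫) =ᶠ[𝓝 x] fun x => ⟪e, x⟫ := by
      filter_upwards [isOpen_ball.mem_nhds hx] with w hw
      rw [χ.one_of_mem_closedBall (ball_subset_closedBall hw), one_mul]
    have h3 : HasGradientAt (fun x => ⟪e, x⟫) e x := by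
      rw [hasGradientAt_iff_hasFDerivAt]
      exact (innerSL ℝ e).hasFDerivAt
    rw [h2.gradient_eq, h3.gradient, he, real_inner_comm, EuclideanSpace.inner_single_left]
    simp
  have h4 := (PiLp.continuous_toLp 2 fun _ : Fin n => ℝ).measurable.comp_aemeasurable
    (aemeasurable_pi_lambda _ hcoord)
  exact h4.aestronglyMeasurable

lemma ball_subset_of_le_bdryDist (hΩ : IsOpen Ω) {z : E} (hz : z ∈ Ω) {R : ℝ} (hR : 0 < R)
    (h : R ≤ bdryDist Ω z) : ball z R ⊆ Ω := by
  refine (convex_ball z R).isPreconnected.subset_of_closure_inter_subset hΩ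
    ⟨z, mem_ball_self hR, hz⟩ ?_
  rintro x ⟨hx1, hx2⟩
  by_contra hx
  have h1 : x ∈ frontier Ω := by
    rw [hΩ.frontier_eq]
    exact ⟨hx1, hx⟩
  have h2 : infDist z (frontier Ω) ≤ dist z x := infDist_le_dist_of_mem h1
  rw [mem_ball, dist_comm] at hx2
  unfold bdryDist at h
  linarith

lemma norm_drift_le {M r : ℝ} (hr : 0 < r) {z x : E} (hM : bdryDist Ω x * ‖B x‖ ≤ M)
    (hz : 2 * r ≤ bdryDist Ω z) (hx : x ∈ ball z (3 / 2 * r)) : ‖B x‖ ≤ 2 * M / r := by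
  have h1 : infDist z (frontier Ω) ≤ infDist x (frontier Ω) + dist z x :=
    infDist_le_infDist_add_dist
  rw [mem_ball, dist_comm] at hx
  unfold bdryDist at *
  have h2 : r / 2 ≤ infDist x (frontier Ω) := by linarith
  have h3 := (mul_le_mul_of_nonneg_right h2 (norm_nonneg (B x))).trans hM
  rw [le_div_iff₀ hr]
  linarith

lemma isSol_adjFlux {lam M r : ℝ} (hΩ : IsOpen Ω) (hAB : EllipticCoeffs Ω A B lam M) (hy : y ∈ Ω)
    (h : IsGreenWithPole Ω A B y g) {z : E} (hz : z ∈ Ω) (hr : 0 < r)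
    (hrz : 2 * r ≤ bdryDist Ω z) :
    IsSol lam M (2 * M / r) (ball z (3 / 2 * r) \ {y}) g (adjFlux A B g) := by
  obtain ⟨hA, hell, hB⟩ := hAB
  have hball := ball_subset_of_le_bdryDist hΩ hz (by positivity) hrz
  set U := ball z (3 / 2 * r) \ {y} with hU
  have hUΩ : U ⊆ Ω := sdiff_subset.trans ((ball_subset_ball (by linarith)).trans hball)
  have hUy : U ⊆ Ω \ {y} := fun x hx => ⟨hUΩ hx, hx.2⟩
  have hUo : IsOpen U := isOpen_ball.sdiff isClosed_singleton
  have hBx : ∀ x ∈ U, ‖B x‖ ≤ 2 * M / r := fun x hx => norm_drift_le hr (hB x (hUΩ hx)) hrz hx.1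
  have hg0 : ∀ x ∈ U, 0 ≤ g x := fun x hx => h.1 x (hUΩ hx)
  have hgd : ∀ x ∈ U, DifferentiableAt ℝ g x := fun x hx => h.2.2.1 x (hUy hx)
  have hgc : ContinuousOn g U := h.2.1.mono hUy
  have hsq : LocallyIntegrableOn (fun x => ‖gradient g x‖ ^ 2) U := h.2.2.2.1.mono_set hUy
  have hmeas : AEStronglyMeasurable (adjFlux A B g) (volume.restrict U) :=
    (aestronglyMeasurable_adjFlux hΩ hy h (by positivity) (by linarith : 3 / 2 * r < 7 / 4 * r)
      ((closedBall_subset_ball (by linarith)).trans hball)).mono_measure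
      (Measure.restrict_mono sdiff_subset le_rfl)
  have hbound : ∀ x ∈ U, ‖adjFlux A B g x‖ ≤ M * ‖gradient g x‖ + 2 * M / r * g x :=
    fun x hx => norm_adjFlux_le (hA x (hUΩ hx)) (hBx x hx) (hg0 x hx)
  refine ⟨hUo, hg0, hgd, hsq, hmeas, hbound,
    fun x hx => le_inner_adjFlux (hell x (hUΩ hx)) (hBx x hx) (hg0 x hx), ?_⟩
  intro η η' hη Φ Φ' hΦ hΦ'
  have hgm : MapsTo g U (Ici 0) := hg0
  have hΦc : ContinuousOn (fun x => Φ (g x)) U := by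
    have : ContinuousOn Φ (Ici 0) := fun s hs => (hΦ s hs).continuousAt.continuousWithinAt
    exact this.comp hgc hgm
  have hgrad : ∀ x ∈ U, HasGradientAt (fun x => Φ (g x)) (Φ' (g x) • gradient g x) x :=
    fun x hx => HasGradientAt.comp_deriv (hΦ _ (hg0 x hx)) (hgd x hx).hasGradientAt
  refine integral_inner_eq_zero_of_smooth (ψ := fun x => η x * Φ (g x)) hUo (fun K hKU hK => ?_)
    (fun φ hφ hφc hφs => ?_) (fun x => ?_) (hη.hasCompactSupport_mul _)
    ((IsCutoff.tsupport_mul_left _ _).trans hη.supp)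
    (hη.memLp_grad_mul hUo hΦc (hΦ'.comp hgc hgm) hsq)
  · exact memLp_two_restrict_of_norm_le hsq (continuousOn_const.mul hgc) hmeas
      hbound hKU hK
  · rw [integral_inner_adjFlux h hφ hφc (hφs.trans hUΩ)]
    exact image_eq_zero_of_notMem_tsupport fun hmem => (hφs hmem).2 rfl
  · have := hη.hasGradientAt_mul hgrad x
    rwa [smul_smul] at this

end GreenFlux

section LowerBound

variable {n : ℕ}

local notation "E" => EuclideanSpace ℝ (Fin n)

lemma exists_pole_bump : ∃ (χ : E → ℝ) (L : ℝ), 0 ≤ L ∧ ContDiff ℝ (⊤ : ℕ∞) χ ∧ χ 0 = 1 ∧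
    IsCutoff (closedBall 0 (1 / 4)) χ (gradient χ) ∧ (∀ x, ‖gradient χ x‖ ≤ L) ∧
    ∀ x, gradient χ x ≠ 0 → 1 / 8 ≤ ‖x‖ ∧ ‖x‖ ≤ 1 / 4 := by
  let χ : ContDiffBump (0 : E) := ⟨1 / 8, 1 / 4, by norm_num, by norm_num⟩
  have hχ : ContDiff ℝ (⊤ : ℕ∞) χ := χ.contDiff
  have hcut : IsCutoff (closedBall 0 (1 / 4)) χ (gradient χ) :=
    isCutoff_of_contDiff hχ χ.hasCompactSupport χ.tsupport_eq.subset
  obtain ⟨L, hL⟩ := (HasCompactSupport.of_support_subset_isCompact hcut.compact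
    ((subset_tsupport _).trans hcut.tsupport_grad)).exists_bound_of_continuous hcut.cont
  refine ⟨χ, L, (norm_nonneg _).trans (hL 0), hχ,
    χ.one_of_mem_closedBall (mem_closedBall_self χ.rIn_pos.le), hcut, hL, fun x hx => ⟨?_, ?_⟩⟩
  · by_contra! hlt
    refine hx ?_
    have h1 : χ =ᶠ[𝓝 x] fun _ => (1 : ℝ) := by
      filter_upwards [isOpen_ball.mem_nhds (mem_ball_zero_iff.2 hlt)] with w hw
      exact χ.one_of_mem_closedBall (ball_subset_closedBall hw)
    rw [h1.gradient_eq]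
    exact (hasGradientAt_const x 1).gradient
  · by_contra! hlt
    refine hx (hcut.grad_eq_zero fun hmem => ?_)
    have := hcut.supp hmem
    rw [mem_closedBall_zero_iff] at this
    linarith

lemma sq_dist_le_of_isGreenWithPole (hn : 3 ≤ n) {lam M : ℝ} (hlam : 0 < lam) (hM : 0 < M) :
    ∃ C > 0, ∀ Ω : Set E, IsOpen Ω → ∀ (A : E → Matrix (Fin n) (Fin n) ℝ) (B : E → E),
      EllipticCoeffs Ω A B lam M → ∀ y ∈ Ω, ∀ g : E → ℝ, IsGreenWithPole Ω A B y g →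
      ∀ z ∈ Ω, 0 < dist z y → 2 * dist z y ≤ bdryDist Ω z →
        dist z y ^ 2 ≤ dist z y ^ n * (C * g z) := by
  obtain ⟨χ, L, hL, hχ, hχ0, hcut, hχL, hχs⟩ := exists_pole_bump (n := n)
  obtain ⟨C, hC, H⟩ := IsSol.integral_inner_le hn hlam hM (by positivity : 0 ≤ 2 * M) hL
  refine ⟨C, hC, fun Ω hΩ A B hAB y hy g hg z hz hr hrz => ?_⟩
  set r := dist z y with hrdef
  set F := adjFlux A B g with hF
  set T := dilation y hr.ne' with hT
  set ζ : E := r⁻¹ • (z - y) with hζdef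
  have hTζ : T ζ = z := by
    rw [hT, dilation_apply, hζdef, smul_smul, mul_inv_cancel₀ hr.ne', one_smul]
    abel
  have hζ : ‖ζ‖ = 1 := by
    rw [hζdef, norm_smul, ← dist_eq_norm, ← hrdef, norm_inv, Real.norm_of_nonneg hr.le,
      inv_mul_cancel₀ hr.ne']
  have hdist : ∀ ξ, dist (T ξ) z = r * dist ξ ζ := fun ξ => by
    rw [← dist_dilation y hr ξ ζ, ← hT, hTζ]
  have hpre : T ⁻¹' (ball z (3 / 2 * r) \ {y}) = ball ζ (3 / 2) \ {0} := by
    ext ξ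
    have h1 : T ξ = y ↔ ξ = 0 := by
      rw [hT, dilation_apply, add_eq_left, smul_eq_zero, or_iff_right hr.ne']
    rw [mem_preimage, Set.mem_sdiff, Set.mem_sdiff, mem_ball, mem_ball, hdist, mem_singleton_iff,
      mem_singleton_iff, h1, mul_comm (3 / 2) r, mul_lt_mul_iff_right₀ hr]
  have hsol := (isSol_adjFlux hΩ hAB hy hg hz hr hrz).comp_dilation y hr
  rw [← hT, hpre, mul_div_cancel₀ _ hr.ne'] at hsol
  have hle := H ζ hζ _ _ hsol (gradient χ) hχL hχs
  simp only [hTζ] at hle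
  have hball := ball_subset_of_le_bdryDist hΩ hz (by positivity) hrz
  have hcut' : IsCutoff Ω (fun x => χ (T.symm x)) fun x => r⁻¹ • gradient χ (T.symm x) := by
    refine IsCutoff.comp_dilation_symm y hr.ne' (hcut.mono fun ξ hξ => hball ?_)
    rw [mem_closedBall_zero_iff] at hξ
    rw [← hT, mem_ball, hdist, mul_comm 2 r, mul_lt_mul_iff_right₀ hr, dist_eq_norm]
    have := norm_sub_le ξ ζ
    linarith
  have hsmooth : ContDiff ℝ (⊤ : ℕ∞) fun x => χ (T.symm x) := by
    simp only [hT, dilation_symm_apply]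
    exact hχ.comp ((contDiff_id.sub contDiff_const).const_smul r⁻¹)
  have h1 := integral_inner_adjFlux hg hsmooth hcut'.compact hcut'.supp
  have hTy : T.symm y = 0 := by
    rw [hT, dilation_symm_apply, sub_self, smul_zero]
  have h2 : ∀ x, gradient (fun x => χ (T.symm x)) x = r⁻¹ • gradient χ (T.symm x) :=
    fun x => (hcut'.grad x).gradient
  simp only [h2] at h1
  rw [hTy, hχ0] at h1
  have h3 := integral_comp_dilation y hr fun x => ⟪F x, r⁻¹ • gradient χ (T.symm x)⟫
  rw [h1, ← hT] at h3
  have h4 : ∫ ξ, ⟪r • F (T ξ), gradient χ ξ⟫ = r ^ 2 * (r ^ n)⁻¹ := by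
    rw [← mul_one (r ^ n)⁻¹, ← h3, ← integral_const_mul]
    refine integral_congr_ae (Eventually.of_forall fun ξ => ?_)
    simp only [Homeomorph.symm_apply_apply, inner_smul_left, inner_smul_right, conj_trivial]
    field_simp
  rw [h4, mul_inv_le_iff₀ (by positivity)] at hle
  linarith

end LowerBound

end GreenHarnack

/-- Lower Green function bound, Harnack form (Corollary 5.2 of the paper):
the lower bound holds at points `z` with `|z - y| ≤ δ(z)/2`. -/
theorem green_lower_bound_harnack_form (n : ℕ) (hn : 3 ≤ n) (lam M : ℝ)
    (hlam : 0 < lam) (hM : 0 < M) :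
    ∃ c₀ : ℝ, 0 < c₀ ∧
      ∀ (Ω : Set (EuclideanSpace ℝ (Fin n))), IsOpen Ω → Ω.Nonempty →
      ∀ (A : EuclideanSpace ℝ (Fin n) → Matrix (Fin n) (Fin n) ℝ)
        (B : EuclideanSpace ℝ (Fin n) → EuclideanSpace ℝ (Fin n)),
        EllipticCoeffs Ω A B lam M →
      ∀ y ∈ Ω, ∀ g : EuclideanSpace ℝ (Fin n) → ℝ, IsGreenWithPole Ω A B y g →
      ∀ z ∈ Ω, 0 < dist z y → dist z y ≤ bdryDist Ω z / 2 →
        c₀ * dist z y ^ ((2 : ℝ) - n) ≤ g z := by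
  obtain ⟨C, hC, H⟩ := GreenHarnack.sq_dist_le_of_isGreenWithPole hn hlam hM
  refine ⟨C⁻¹, inv_pos.2 hC, fun Ω hΩ _ A B hAB y hy g hg z hz hr hrz => ?_⟩
  have h1 := H Ω hΩ A B hAB y hy g hg z hz hr (by linarith)
  rw [Real.rpow_sub hr, Real.rpow_natCast, Real.rpow_ofNat, inv_mul_le_iff₀ hC,
    div_le_iff₀ (by positivity)]
  linarith
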